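/- arXiv:2212.08521 — 2 statements merged into one kernel-verified Lean document; each statement's English description precedes it below -/
import Mathlib

section
/- Let n ≥ 2 and let D ⊆ ℂⁿ be a nonempty open convex set. Then there exists a holomorphic map φ : 𝔻 → ℂⁿ which is an immersion (φ'(ζ) ≠ 0 for every ζ ∈ 𝔻), has image contained in D, is proper as a map from 𝔻 into D (preimages of compact subsets of D are compact), and is complete: for every divergent path γ : [0,1) → 𝔻 the path φ ∘ γ has infinite length. Moreover, if n ≥ 3 then φ can in addition be chosen injective. (Disc case of the Alarcón–López / Alarcón–Forstnerič theorems on complete proper holomorphic immersions into convex domains.) -/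
open Set Metric
open scoped ENNReal

noncomputable section

/-- A path `γ : [0,1) → E` is a divergent path in the open set `Ω` if it is continuous on
`[0,1)`, takes values in `Ω`, and eventually leaves every compact subset of `Ω`. -/
def DivergentPathIn {E : Type*} [TopologicalSpace E] (Ω : Set E) (γ : ℝ → E) : Prop :=
  ContinuousOn γ (Set.Ico 0 1) ∧
  (∀ t ∈ Set.Ico (0 : ℝ) 1, γ t ∈ Ω) ∧
  ∀ K : Set E, K ⊆ Ω → IsCompact K →
    ∃ t₀ ∈ Set.Ico (0 : ℝ) 1, ∀ t ∈ Set.Ico t₀ 1, γ t ∉ K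

open Filter Topology

section Potential

variable {F : Type*} [NormedAddCommGroup F] [InnerProductSpace ℝ F]

/-- `P` is the nearest point projection onto the convex set `K`. -/
structure IsNearestPointMap (K : Set F) (P : F → F) : Prop where
  mem : ∀ x, P x ∈ K
  inner_le : ∀ x, ∀ w ∈ K, inner ℝ (x - P x) (w - P x) ≤ 0

theorem exists_isNearestPointMap {K : Set F} (hne : K.Nonempty) (hK : IsComplete K)
    (hc : Convex ℝ K) : ∃ P : F → F, IsNearestPointMap K P := by
  choose P hP hP' using fun x => exists_norm_eq_iInf_of_complete_convex hne hK hc x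
  exact ⟨P, hP, fun x => (norm_eq_iInf_iff_real_inner_le_zero hc (hP x)).1 (hP' x)⟩

namespace IsNearestPointMap

variable {K : Set F} {P : F → F} (h : IsNearestPointMap K P)
include h

theorem eq_self {x : F} (hx : x ∈ K) : P x = x := by
  have := h.inner_le x x hx
  rw [real_inner_self_eq_norm_sq] at this
  have h2 : ‖x - P x‖ = 0 := by nlinarith [norm_nonneg (x - P x)]
  exact (sub_eq_zero.1 (norm_eq_zero.1 h2)).symm

theorem sq_le (x y : F) :
    ‖x - P x‖ ^ 2 + inner ℝ ((2 : ℝ) • (x - P x)) (y - x) ≤ ‖y - P y‖ ^ 2 := by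
  have h1 := h.inner_le x (P y) (h.mem y)
  have h2 : y - P y = (x - P x) + ((y - x) - (P y - P x)) := by abel
  rw [h2, norm_add_sq_real, inner_sub_right (x - P x) (y - x), real_inner_smul_left]
  nlinarith [sq_nonneg ‖(y - x) - (P y - P x)‖]

theorem le_sq (x y : F) :
    ‖y - P y‖ ^ 2 ≤ ‖x - P x‖ ^ 2 + inner ℝ ((2 : ℝ) • (x - P x)) (y - x) + ‖y - x‖ ^ 2 := by
  have h1 := h.inner_le y (P x) (h.mem x)
  have h2 : (x - P x) = (y - P y) + (-(y - x) + (P y - P x)) := by abel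
  have h3 : y - P x = (y - P y) + (P y - P x) := by abel
  have h4 : ‖y - P y‖ ^ 2 ≤ ‖y - P x‖ ^ 2 := by
    rw [h3, norm_add_sq_real]
    have : P y - P x = - (P x - P y) := by abel
    rw [this, inner_neg_right]
    nlinarith [sq_nonneg ‖-(P x - P y)‖]
  have h5 : y - P x = (x - P x) + (y - x) := by abel
  rw [h5, norm_add_sq_real] at h4
  rw [inner_smul_left]
  simpa using h4

theorem continuous : Continuous P := by
  refine (LipschitzWith.of_dist_le_mul (K := 1) fun x y => ?_).continuous
  have h1 := h.inner_le x (P y) (h.mem y)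
  have h2 := h.inner_le y (P x) (h.mem x)
  have h3 : inner ℝ (x - P x) (P y - P x) + inner ℝ (y - P y) (P x - P y)
      = ‖P x - P y‖ ^ 2 - inner ℝ (x - y) (P x - P y) := by
    rw [← real_inner_self_eq_norm_sq]
    simp only [inner_sub_left, inner_sub_right]
    ring
  have h4 := real_inner_le_norm (x - y) (P x - P y)
  rw [dist_eq_norm, dist_eq_norm]
  simp only [NNReal.coe_one, one_mul]
  by_contra! h5
  nlinarith [norm_nonneg (x - y), norm_nonneg (P x - P y)]

end IsNearestPointMap

/-- An open convex set is exhausted by compact convex subsets, each staying away from the complement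
of the next. -/
theorem Convex.exists_convex_exhaustion [ProperSpace F] {D : Set F} (hDo : IsOpen D)
    (hDc : Convex ℝ D) (hne : D.Nonempty) :
    ∃ (K : ℕ → Set F) (δ : ℕ → ℝ), (∀ k, IsCompact (K k)) ∧ (∀ k, Convex ℝ (K k)) ∧
      (∀ k, (K k).Nonempty) ∧ (∀ k, K k ⊆ D) ∧ (∀ k, 0 < δ k) ∧ (∀ x ∈ D, ∃ k, x ∈ K k) ∧
      ∀ k, ∀ x ∉ K (k + 1), ∀ w ∈ K k, δ k ≤ ‖x - w‖ := by
  let S : ℕ → Set F := fun k => {x | ‖x‖ ≤ k ∧ ∀ u ∉ D, 1 / ((k : ℝ) + 1) ≤ dist x u}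
  have hSmem : ∀ x ∈ D, ∃ B : ℕ, ∀ k, x ∈ S (k + B) := by
    intro x hx
    obtain ⟨ε, hε, hb⟩ := Metric.isOpen_iff.1 hDo x hx
    obtain ⟨N, hN⟩ := exists_nat_ge ‖x‖
    obtain ⟨N', hN'⟩ := exists_nat_one_div_lt hε
    refine ⟨N + N', fun k => ⟨?_, fun u hu => ?_⟩⟩
    · push_cast; have := Nat.cast_nonneg (α := ℝ) k
      have := Nat.cast_nonneg (α := ℝ) N'; linarith
    · by_contra! hlt
      refine hu (hb ?_)
      rw [mem_ball, dist_comm]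
      refine hlt.trans_le (le_trans ?_ hN'.le)
      apply one_div_le_one_div_of_le (by positivity)
      push_cast; have := Nat.cast_nonneg (α := ℝ) k
      have := Nat.cast_nonneg (α := ℝ) N; linarith
  obtain ⟨x₀, hx₀⟩ := hne
  obtain ⟨B, hB⟩ := hSmem x₀ hx₀
  refine ⟨fun k => S (k + B), fun k => 1 / ((↑(k + B) : ℝ) + 1) - 1 / ((↑(k + B) : ℝ) + 2),
    fun k => ?_, fun k => ?_, fun k => ⟨x₀, hB k⟩, fun k x hx => ?_, fun k => ?_, fun x hx => ?_,
    fun k x hx w hw => ?_⟩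
  · refine Metric.isCompact_of_isClosed_isBounded ?_ ?_
    · have : S (k + B) = {x | ‖x‖ ≤ (↑(k + B) : ℝ)} ∩
          ⋂ u ∈ Dᶜ, {x | 1 / ((↑(k + B) : ℝ) + 1) ≤ dist x u} := by
        ext x; simp [S]
      change IsClosed (S (k + B))
      rw [this]
      refine (isClosed_le continuous_norm continuous_const).inter
        (isClosed_biInter fun u _ => isClosed_le continuous_const (continuous_id.dist continuous_const))
    · exact (Metric.isBounded_closedBall (x := (0 : F)) (r := ↑(k + B))).subset
        fun x hx => by simpa using hx.1
  · rintro x ⟨hx1, hx2⟩ y ⟨hy1, hy2⟩ a b ha hb hab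
    refine ⟨?_, fun u hu => ?_⟩
    · calc ‖a • x + b • y‖ ≤ ‖a • x‖ + ‖b • y‖ := norm_add_le _ _
        _ = a * ‖x‖ + b * ‖y‖ := by rw [norm_smul_of_nonneg ha, norm_smul_of_nonneg hb]
        _ ≤ a * ↑(k + B) + b * ↑(k + B) := by gcongr
        _ = ↑(k + B) := by rw [← add_mul, hab, one_mul]
    · by_contra! hlt
      have key : ∀ z : F, (∀ u ∉ D, 1 / ((↑(k + B) : ℝ) + 1) ≤ dist z u) →
          z + (u - (a • x + b • y)) ∈ D := by
        intro z hz
        by_contra hn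
        have := hz _ hn
        rw [dist_eq_norm, sub_add_cancel_left, norm_neg, ← dist_eq_norm, dist_comm] at this
        linarith
      apply hu
      have := hDc (key x hx2) (key y hy2) ha hb hab
      convert this using 1
      rw [smul_add, smul_add, add_add_add_comm, ← add_smul, hab, one_smul]
      abel
  · by_contra hn
    have := hx.2 x hn
    rw [dist_self] at this
    have : (0 : ℝ) < 1 / ((↑(k + B) : ℝ) + 1) := by positivity
    linarith
  · rw [sub_pos]
    exact one_div_lt_one_div_of_lt (by positivity) (by linarith)
  · obtain ⟨B', hB'⟩ := hSmem x hx
    exact ⟨B', by simpa [add_comm] using hB' B⟩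
  · have hle : 1 / ((↑(k + B) : ℝ) + 1) - 1 / ((↑(k + B) : ℝ) + 2) ≤ 1 := by
      have h1 : 1 / ((↑(k + B) : ℝ) + 1) ≤ 1 := by
        rw [div_le_one (by positivity)]; have := Nat.cast_nonneg (α := ℝ) (k + B); linarith
      have h2 : 0 ≤ 1 / ((↑(k + B) : ℝ) + 2) := by positivity
      linarith
    have hcast : ((↑(k + 1 + B) : ℝ)) = ↑(k + B) + 1 := by push_cast; ring
    by_cases hx1 : ‖x‖ ≤ (↑(k + 1 + B) : ℝ)
    · have : ∃ u ∉ D, dist x u < 1 / ((↑(k + 1 + B) : ℝ) + 1) := by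
        by_contra! hcon
        exact hx ⟨hx1, hcon⟩
      obtain ⟨u, hu, hxu⟩ := this
      have h1 := hw.2 u hu
      have h2 := dist_triangle w x u
      rw [hcast, add_assoc, one_add_one_eq_two] at hxu
      rw [← dist_eq_norm, dist_comm x w]
      linarith
    · push Not at hx1
      have h1 := norm_sub_norm_le x w
      have h2 : ‖w‖ ≤ ↑(k + B) := hw.1
      linarith

/-- A strongly convex function `ρ` with gradient `G` on `D` whose sublevel sets stay away from the
boundary of `D`, and which is uniformly of class `C^{1,1}` near each of them. -/
structure IsConvexPotential (D : Set F) (ρ : F → ℝ) (G : F → F) : Prop where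
  continuousOn : ContinuousOn ρ D
  continuousOn_grad : ContinuousOn G D
  nonneg : ∀ x, 0 ≤ ρ x
  lower : ∀ x ∈ D, ∀ y ∈ D, ρ x + inner ℝ (G x) (y - x) + ‖y - x‖ ^ 2 ≤ ρ y
  upper : ∀ M : ℝ, ∃ C ≥ 1, ∃ σ > 0, ∀ x ∈ D, ρ x ≤ M → ∀ y, ‖y - x‖ ≤ σ →
    y ∈ D ∧ ρ y ≤ ρ x + inner ℝ (G x) (y - x) + C * ‖y - x‖ ^ 2

theorem exists_isConvexPotential [ProperSpace F] {D : Set F} (hDo : IsOpen D)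
    (hDc : Convex ℝ D) (hne : D.Nonempty) :
    ∃ (ρ : F → ℝ) (G : F → F), IsConvexPotential D ρ G := by
  obtain ⟨K, δ, hKc, hKv, hKne, hKD, hδ, hKex, hKδ⟩ := hDc.exists_convex_exhaustion hDo hne
  choose P hP using fun k => exists_isNearestPointMap (hKne k) (hKc k).isComplete (hKv k)
  have hmono : Monotone K := monotone_nat_of_le_succ fun k x hx => by
    by_contra hn
    have := hKδ k x hn x hx
    simp at this
    linarith [hδ k]
  let A : ℕ → ℝ := fun k => k / (δ k) ^ 2
  have hA : ∀ k, 0 ≤ A k := fun k => by positivity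
  have hz : ∀ m, ∀ x ∈ K m, ∀ k, m ≤ k → P k x = x := fun m x hx k hk =>
    (hP k).eq_self (hmono hk hx)
  let ρ : F → ℝ := fun x => ‖x‖ ^ 2 + ∑' k, A k * ‖x - P k x‖ ^ 2
  let G : F → F := fun x => (2 : ℝ) • x + ∑' k, A k • (2 : ℝ) • (x - P k x)
  have hρ : ∀ m, ∀ x ∈ K m, ρ x = ‖x‖ ^ 2 + ∑ k ∈ Finset.range m, A k * ‖x - P k x‖ ^ 2 := by
    intro m x hx
    simp only [ρ]
    rw [tsum_eq_sum]
    intro k hk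
    rw [hz m x hx k (by simpa using hk)]; simp
  have hG : ∀ m, ∀ x ∈ K m, G x = (2 : ℝ) • x
      + ∑ k ∈ Finset.range m, A k • (2 : ℝ) • (x - P k x) := by
    intro m x hx
    simp only [G]
    rw [tsum_eq_sum]
    intro k hk
    rw [hz m x hx k (by simpa using hk)]; simp
  have hnhds : ∀ x ∈ D, ∃ m, K m ∈ 𝓝 x := by
    intro x hx
    obtain ⟨m, hm⟩ := hKex x hx
    refine ⟨m + 1, Metric.mem_nhds_iff.2 ⟨δ m, hδ m, fun y hy => ?_⟩⟩
    by_contra hn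
    have := hKδ m y hn x hm
    rw [mem_ball, dist_eq_norm] at hy
    linarith
  have hsq : ∀ x y : F, ‖y‖ ^ 2 = ‖x‖ ^ 2 + inner ℝ ((2 : ℝ) • x) (y - x) + ‖y - x‖ ^ 2 := by
    intro x y
    rw [inner_smul_left, ← real_inner_self_eq_norm_sq, ← real_inner_self_eq_norm_sq,
      ← real_inner_self_eq_norm_sq]
    simp only [inner_sub_left, inner_sub_right, real_inner_comm x y, conj_trivial]
    ring
  have hinner : ∀ m, ∀ x ∈ K m, ∀ v, inner ℝ (G x) v = inner ℝ ((2 : ℝ) • x) v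
      + ∑ k ∈ Finset.range m, A k * inner ℝ ((2 : ℝ) • (x - P k x)) v := by
    intro m x hx v
    rw [hG m x hx, inner_add_left, sum_inner]
    congr 1
    exact Finset.sum_congr rfl fun k _ => real_inner_smul_left _ _ (A k)
  refine ⟨ρ, G, fun x hx => ?_, fun x hx => ?_, fun x => ?_, fun x hx y hy => ?_, fun M => ?_⟩
  · obtain ⟨m, hm⟩ := hnhds x hx
    apply ContinuousAt.continuousWithinAt
    have : ContinuousAt (fun x => ‖x‖ ^ 2 + ∑ k ∈ Finset.range m, A k * ‖x - P k x‖ ^ 2) x := by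
      apply Continuous.continuousAt
      have := fun k => (hP k).continuous
      fun_prop
    exact this.congr (by filter_upwards [hm] with y hy using (hρ m y hy).symm)
  · obtain ⟨m, hm⟩ := hnhds x hx
    apply ContinuousAt.continuousWithinAt
    have : ContinuousAt (fun x => (2 : ℝ) • x
      + ∑ k ∈ Finset.range m, A k • (2 : ℝ) • (x - P k x)) x := by
      apply Continuous.continuousAt
      have := fun k => (hP k).continuous
      fun_prop
    exact this.congr (by filter_upwards [hm] with y hy using (hG m y hy).symm)
  · have : 0 ≤ ∑' k, A k * ‖x - P k x‖ ^ 2 :=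
      tsum_nonneg fun k => mul_nonneg (hA k) (by positivity)
    positivity
  · obtain ⟨m, hm⟩ := hKex x hx
    obtain ⟨m', hm'⟩ := hKex y hy
    have hx' := hmono (le_max_left m m') hm
    have hy' := hmono (le_max_right m m') hm'
    rw [hρ _ x hx', hρ _ y hy', hinner _ x hx', hsq x y]
    have : ∑ k ∈ Finset.range (max m m'), A k * ‖x - P k x‖ ^ 2
        + ∑ k ∈ Finset.range (max m m'), A k * inner ℝ ((2 : ℝ) • (x - P k x)) (y - x)
        ≤ ∑ k ∈ Finset.range (max m m'), A k * ‖y - P k y‖ ^ 2 := by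
      rw [← Finset.sum_add_distrib]
      refine Finset.sum_le_sum fun k _ => ?_
      rw [← mul_add]
      exact mul_le_mul_of_nonneg_left ((hP k).sq_le x y) (hA k)
    linarith
  · obtain ⟨m, hm⟩ := exists_nat_gt M
    have hsub : ∀ x ∈ D, ρ x ≤ M → x ∈ K (m + 1) := by
      intro x hx hxM
      by_contra hn
      obtain ⟨m', hm'⟩ := hKex x hx
      have h1 : A m * ‖x - P m x‖ ^ 2 ≤ ρ x := by
        have h2 : A m * ‖x - P m x‖ ^ 2
            ≤ ∑ k ∈ Finset.range (max m' (m + 1)), A k * ‖x - P k x‖ ^ 2 :=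
          Finset.single_le_sum (f := fun k => A k * ‖x - P k x‖ ^ 2)
            (fun k _ => mul_nonneg (hA k) (by positivity)) (by simp)
        rw [hρ _ x (hmono (le_max_left m' (m + 1)) hm')]
        have := sq_nonneg ‖x‖
        linarith
      have h3 := hKδ m x hn (P m x) ((hP m).mem x)
      have h4 : (m : ℝ) ≤ A m * ‖x - P m x‖ ^ 2 := by
        calc (m : ℝ) = A m * (δ m) ^ 2 := by
              simp only [A]; rw [div_mul_cancel₀]; exact (pow_pos (hδ m) 2).ne'
          _ ≤ _ := by
              refine mul_le_mul_of_nonneg_left ?_ (hA m)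
              exact pow_le_pow_left₀ (hδ m).le h3 2
      linarith
    refine ⟨1 + ∑ k ∈ Finset.range (m + 2), A k, ?_, δ (m + 1) / 2, half_pos (hδ _),
      fun x hx hxM y hxy => ?_⟩
    · have := Finset.sum_nonneg fun k (_ : k ∈ Finset.range (m + 2)) => hA k
      linarith
    · have hxK := hsub x hx hxM
      have hyK : y ∈ K (m + 2) := by
        by_contra hn
        have := hKδ (m + 1) y hn x hxK
        linarith [hδ (m + 1)]
      refine ⟨hKD _ hyK, ?_⟩
      have hx' := hmono (Nat.le_succ (m + 1)) hxK
      rw [hρ _ x hx', hρ _ y hyK, hinner _ x hx', hsq x y]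
      have : ∑ k ∈ Finset.range (m + 2), A k * ‖y - P k y‖ ^ 2 ≤
          ∑ k ∈ Finset.range (m + 2), A k * ‖x - P k x‖ ^ 2
          + ∑ k ∈ Finset.range (m + 2), A k * inner ℝ ((2 : ℝ) • (x - P k x)) (y - x)
          + (∑ k ∈ Finset.range (m + 2), A k) * ‖y - x‖ ^ 2 := by
        rw [Finset.sum_mul, ← Finset.sum_add_distrib, ← Finset.sum_add_distrib]
        refine Finset.sum_le_sum fun k _ => ?_
        rw [← mul_add, ← mul_add]
        exact mul_le_mul_of_nonneg_left ((hP k).le_sq x y) (hA k)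
      simp only [Nat.succ_eq_add_one, add_assoc, one_add_one_eq_two] at this ⊢
      linarith

end Potential

section Polynomial

variable {E : Type*} [NormedAddCommGroup E] [NormedSpace ℂ E]

variable (E) in
/-- Vector-valued polynomial maps of one complex variable. -/
def polyMaps : Submodule ℂ (ℂ → E) :=
  Submodule.span ℂ {f | ∃ (j : ℕ) (a : E), f = fun z => z ^ j • a}

theorem pow_smul_const_mem_polyMaps (j : ℕ) (a : E) : (fun z : ℂ => z ^ j • a) ∈ polyMaps E :=
  Submodule.subset_span ⟨j, a, rfl⟩

theorem const_mem_polyMaps (a : E) : (fun _ : ℂ => a) ∈ polyMaps E := by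
  simpa using pow_smul_const_mem_polyMaps 0 a

theorem id_smul_const_mem_polyMaps (a : E) : (fun z : ℂ => z • a) ∈ polyMaps E := by
  simpa using pow_smul_const_mem_polyMaps 1 a

theorem pow_smul_mem_polyMaps {f : ℂ → E} (hf : f ∈ polyMaps E) (k : ℕ) :
    (fun z => z ^ k • f z) ∈ polyMaps E := by
  induction hf using Submodule.span_induction with
  | mem f hf =>
    obtain ⟨j, a, rfl⟩ := hf
    simpa only [smul_smul, ← pow_add] using pow_smul_const_mem_polyMaps (k + j) a
  | zero => simpa using const_mem_polyMaps (0 : E)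
  | add f g _ _ hf hg =>
    have := add_mem hf hg
    convert this using 1
    ext z
    simp only [Pi.add_apply, smul_add]
  | smul c f _ hf =>
    have := (polyMaps E).smul_mem c hf
    convert this using 1
    ext z
    simp only [Pi.smul_apply]
    rw [smul_comm]

theorem contDiff_of_mem_polyMaps {f : ℂ → E} (hf : f ∈ polyMaps E) : ContDiff ℂ 2 f := by
  induction hf using Submodule.span_induction with
  | mem f hf =>
    obtain ⟨j, a, rfl⟩ := hf
    fun_prop
  | zero => exact contDiff_const
  | add f g _ _ hf hg => exact hf.add hg
  | smul c f _ hf => exact contDiff_const.smul hf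

theorem differentiable_of_mem_polyMaps {f : ℂ → E} (hf : f ∈ polyMaps E) :
    Differentiable ℂ f :=
  (contDiff_of_mem_polyMaps hf).differentiable (by norm_num)

theorem continuous_deriv_of_mem_polyMaps {f : ℂ → E} (hf : f ∈ polyMaps E) :
    Continuous (deriv f) :=
  (contDiff_of_mem_polyMaps hf).continuous_deriv (by norm_num)

theorem exists_dividedDifference {f : ℂ → E} (hf : f ∈ polyMaps E) :
    ∃ Q : ℂ × ℂ → E, ContDiff ℝ 1 Q ∧ (∀ z w, f z - f w = (z - w) • Q (z, w)) ∧
      ∀ z, deriv f z = Q (z, z) := by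
  have key : ∃ Q : ℂ × ℂ → E, ContDiff ℝ 1 Q ∧ ∀ z w, f z - f w = (z - w) • Q (z, w) := by
    induction hf using Submodule.span_induction with
    | mem f hf =>
      obtain ⟨j, a, rfl⟩ := hf
      refine ⟨fun q => (∑ i ∈ Finset.range j, q.1 ^ i * q.2 ^ (j - 1 - i)) • a, ?_, fun z w => ?_⟩
      · fun_prop
      · simp only
        rw [smul_smul, mul_comm, (Commute.all z w).geom_sum₂_mul, sub_smul]
    | zero => exact ⟨0, contDiff_const, by simp⟩
    | add f g _ _ hf hg =>
      obtain ⟨Q, hQ, hQ'⟩ := hf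
      obtain ⟨R, hR, hR'⟩ := hg
      refine ⟨Q + R, hQ.add hR, fun z w => ?_⟩
      simp only [Pi.add_apply, smul_add, ← hQ', ← hR']
      abel
    | smul c f _ hf =>
      obtain ⟨Q, hQ, hQ'⟩ := hf
      refine ⟨c • Q, contDiff_const.smul hQ, fun z w => ?_⟩
      simp only [Pi.smul_apply]
      rw [smul_comm, ← hQ', smul_sub]
  obtain ⟨Q, hQ, hQ'⟩ := key
  refine ⟨Q, hQ, hQ', fun z => ?_⟩
  have h1 : Tendsto (slope f z) (𝓝[≠] z) (𝓝 (deriv f z)) :=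
    hasDerivAt_iff_tendsto_slope.1 (differentiable_of_mem_polyMaps hf z).hasDerivAt
  have h2 : Tendsto (fun w => Q (w, z)) (𝓝[≠] z) (𝓝 (Q (z, z))) := by
    have : Continuous fun w => Q (w, z) := hQ.continuous.comp (by fun_prop)
    exact (this.tendsto z).mono_left nhdsWithin_le_nhds
  refine tendsto_nhds_unique (h1.congr' ?_) h2
  filter_upwards [self_mem_nhdsWithin] with w hw
  rw [slope_def_module, hQ', smul_smul, inv_mul_cancel₀ (sub_ne_zero.2 hw), one_smul]

theorem exists_polyMaps_approx_scalar {h : ℂ → ℂ} (hh : ContinuousOn h (sphere 0 1)) {ε : ℝ}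
    (hε : 0 < ε) : ∃ p ∈ polyMaps ℂ, ∃ d : ℕ, ∀ ζ ∈ sphere (0 : ℂ) 1, ‖p ζ - ζ ^ d • h ζ‖ < ε := by
  have : Fact (0 < 2 * Real.pi) := ⟨Real.two_pi_pos⟩
  let H : C(AddCircle (2 * Real.pi), ℂ) :=
    ⟨fun x => h (AddCircle.toCircle x), by
      refine hh.comp_continuous (f := fun x => ((AddCircle.toCircle x : Circle) : ℂ)) ?_ ?_
      · exact continuous_subtype_val.comp AddCircle.continuous_toCircle
      · intro x; rw [mem_sphere_zero_iff_norm]; exact Circle.norm_coe _⟩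
  have hH : H ∈ (Submodule.span ℂ (range (@fourier (2 * Real.pi)))).topologicalClosure := by
    rw [span_fourier_closure_eq_top]; trivial
  rw [← SetLike.mem_coe, Submodule.topologicalClosure_coe, Metric.mem_closure_iff] at hH
  obtain ⟨q, hq, hHq⟩ := hH ε hε
  have key : ∃ p ∈ polyMaps ℂ, ∃ d : ℕ, ∀ x : AddCircle (2 * Real.pi),
      p (AddCircle.toCircle x) = (AddCircle.toCircle x : ℂ) ^ d * q x := by
    clear hHq
    induction hq using Submodule.span_induction with
    | mem q hq =>
      obtain ⟨m, rfl⟩ := hq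
      refine ⟨_, pow_smul_const_mem_polyMaps (m + m.natAbs).toNat 1, m.natAbs, fun x => ?_⟩
      have hne : (AddCircle.toCircle x : ℂ) ≠ 0 := Circle.coe_ne_zero _
      rw [fourier_apply, AddCircle.toCircle_zsmul, Circle.coe_zpow, smul_eq_mul, mul_one,
        ← zpow_natCast, ← zpow_natCast, ← zpow_add₀ hne]
      congr 1
      omega
    | zero => exact ⟨0, zero_mem _, 0, by simp⟩
    | add q r _ _ hq hr =>
      obtain ⟨p, hp, d, h1⟩ := hq
      obtain ⟨p', hp', d', h2⟩ := hr
      refine ⟨_, add_mem (pow_smul_mem_polyMaps hp d') (pow_smul_mem_polyMaps hp' d), d + d',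
        fun x => ?_⟩
      simp only [Pi.add_apply, smul_eq_mul, h1, h2, ContinuousMap.add_apply]
      ring
    | smul c q _ hq =>
      obtain ⟨p, hp, d, h1⟩ := hq
      refine ⟨c • p, (polyMaps ℂ).smul_mem c hp, d, fun x => ?_⟩
      simp only [Pi.smul_apply, smul_eq_mul, h1, ContinuousMap.smul_apply]
      ring
  obtain ⟨p, hp, d, hpd⟩ := key
  refine ⟨p, hp, d, fun ζ hζ => ?_⟩
  obtain ⟨x, hx⟩ : ∃ x : AddCircle (2 * Real.pi), (AddCircle.toCircle x : ℂ) = ζ := by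
    obtain ⟨x, hx⟩ := (AddCircle.homeomorphCircle Real.two_pi_pos.ne').surjective
      (⟨ζ, by simpa [Submonoid.unitSphere] using hζ⟩ : Circle)
    refine ⟨x, ?_⟩
    rw [AddCircle.homeomorphCircle_apply] at hx
    rw [hx]
  rw [← hx, hpd, smul_eq_mul, ← mul_sub, norm_mul, norm_pow, Circle.norm_coe, one_pow, one_mul,
    ← dist_eq_norm, dist_comm]
  exact (ContinuousMap.dist_apply_le_dist (f := H) (g := q) x).trans_lt hHq

theorem exists_polyMaps_approx {n : ℕ} {h : ℂ → EuclideanSpace ℂ (Fin n)}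
    (hh : ContinuousOn h (sphere 0 1)) {ε : ℝ} (hε : 0 < ε) :
    ∃ p ∈ polyMaps (EuclideanSpace ℂ (Fin n)), ∃ d : ℕ,
      ∀ ζ ∈ sphere (0 : ℂ) 1, ‖p ζ - ζ ^ d • h ζ‖ < ε := by
  have hsum : h = ∑ i, fun ζ => h ζ i • EuclideanSpace.single i (1 : ℂ) := by
    ext ζ j
    simp [Finset.sum_apply, Pi.single_apply]
  have : ∀ ε > 0, ∃ p ∈ polyMaps (EuclideanSpace ℂ (Fin n)), ∃ d : ℕ,
      ∀ ζ ∈ sphere (0 : ℂ) 1, ‖p ζ - ζ ^ d •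
        (∑ i, fun ζ => h ζ i • EuclideanSpace.single i (1 : ℂ)) ζ‖ < ε := by
    refine Finset.sum_induction (s := Finset.univ)
      (fun i => fun ζ => h ζ i • EuclideanSpace.single i (1 : ℂ))
      (fun g => ∀ ε > 0, ∃ p ∈ polyMaps (EuclideanSpace ℂ (Fin n)), ∃ d : ℕ,
      ∀ ζ ∈ sphere (0 : ℂ) 1, ‖p ζ - ζ ^ d • g ζ‖ < ε) ?_ ?_ ?_
    · intro g g' hg hg' ε hε
      obtain ⟨p, hp, d, h1⟩ := hg (ε / 2) (half_pos hε)
      obtain ⟨p', hp', d', h2⟩ := hg' (ε / 2) (half_pos hε)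
      refine ⟨_, add_mem (pow_smul_mem_polyMaps hp d') (pow_smul_mem_polyMaps hp' d), d + d',
        fun ζ hζ => ?_⟩
      have hζ1 : ‖ζ‖ = 1 := by simpa using hζ
      have : ζ ^ d' • p ζ + ζ ^ d • p' ζ - ζ ^ (d + d') • (g ζ + g' ζ)
          = ζ ^ d' • (p ζ - ζ ^ d • g ζ) + ζ ^ d • (p' ζ - ζ ^ d' • g' ζ) := by
        simp only [smul_add, smul_sub, smul_smul, ← pow_add, add_comm d d']
        abel
      simp only [Pi.add_apply]
      rw [this]
      refine (norm_add_le _ _).trans_lt ?_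
      rw [norm_smul, norm_smul, norm_pow, norm_pow, hζ1]
      simp only [one_pow, one_mul]
      linarith [h1 ζ hζ, h2 ζ hζ]
    · exact fun ε hε => ⟨0, zero_mem _, 0, by simpa using fun _ _ => hε⟩
    · intro i _ ε hε
      obtain ⟨p, hp, d, h1⟩ := exists_polyMaps_approx_scalar (h := fun ζ => h ζ i)
        ((EuclideanSpace.proj (𝕜 := ℂ) i).continuous.comp_continuousOn hh) hε
      refine ⟨fun z => p z • EuclideanSpace.single i (1 : ℂ), ?_, d, fun ζ hζ => ?_⟩
      · clear h1
        induction hp using Submodule.span_induction with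
        | mem p hp =>
          obtain ⟨j, a, rfl⟩ := hp
          simpa only [smul_assoc] using pow_smul_const_mem_polyMaps j
            (a • EuclideanSpace.single i (1 : ℂ))
        | zero => simpa using const_mem_polyMaps _
        | add p q _ _ hp hq =>
          have := add_mem hp hq
          convert this using 1
          ext1 z
          simp only [Pi.add_apply, add_smul]
        | smul c p _ hp =>
          have := (polyMaps _).smul_mem c hp
          convert this using 1
          ext1 z
          simp only [Pi.smul_apply, smul_assoc]
      · rw [smul_smul, ← sub_smul, norm_smul]
        simpa using h1 ζ hζ
  rw [← hsum] at this
  exact this ε hε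

end Polynomial

section Tangential

variable {n : ℕ}

theorem finrank_real_euclideanSpace_complex (n : ℕ) :
    Module.finrank ℝ (EuclideanSpace ℂ (Fin n)) = 2 * n := by
  simpa using finrank_real_of_complex (EuclideanSpace ℂ (Fin n))

theorem exists_forall_smul_ne (hn : 2 ≤ n) {P : ℂ → EuclideanSpace ℂ (Fin n)}
    (hP : P ∈ polyMaps (EuclideanSpace ℂ (Fin n))) :
    ∃ e, ∀ ζ ∈ sphere (0 : ℂ) 1, ∀ c : ℂ, c • P ζ ≠ e := by
  let Φ : ℂ × ℝ → EuclideanSpace ℂ (Fin n) := fun q => q.1 • P (Complex.exp (q.2 * Complex.I))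
  have hΦ : ContDiff ℝ 1 Φ := by
    have h1 : ContDiff ℝ 1 P := ((contDiff_of_mem_polyMaps hP).restrict_scalars ℝ).of_le
      (by norm_num)
    have h2 : ContDiff ℝ 1 fun q : ℂ × ℝ => Complex.exp (q.2 * Complex.I) := by
      have : ContDiff ℝ 1 fun t : ℝ => (t : ℂ) := Complex.ofRealCLM.contDiff
      exact ((this.comp contDiff_snd).mul contDiff_const).cexp
    exact contDiff_fst.smul (h1.comp h2)
  have hd := hΦ.dense_compl_range_of_finrank_lt_finrank (by
    rw [finrank_real_euclideanSpace_complex, Module.finrank_prod, Complex.finrank_real_complex,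
      Module.finrank_self]
    omega)
  obtain ⟨e, he⟩ := hd.nonempty
  refine ⟨e, fun ζ hζ c hc => he ⟨(c, ζ.arg), ?_⟩⟩
  have : Complex.exp (ζ.arg * Complex.I) = ζ := by
    have := Complex.norm_mul_exp_arg_mul_I ζ
    rwa [mem_sphere_zero_iff_norm.1 hζ, Complex.ofReal_one, one_mul] at this
  simp only [Φ, this, hc]

theorem exists_tangential_polyMaps (hn : 2 ≤ n) {g : ℂ → EuclideanSpace ℂ (Fin n)}
    (hg : ContinuousOn g (sphere 0 1)) (hg0 : ∀ ζ ∈ sphere (0 : ℂ) 1, g ζ ≠ 0) {s : ℂ → ℝ}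
    (hs : ContinuousOn s (sphere 0 1)) (hs0 : ∀ ζ ∈ sphere (0 : ℂ) 1, 0 ≤ s ζ) {ε : ℝ}
    (hε : 0 < ε) :
    ∃ p ∈ polyMaps (EuclideanSpace ℂ (Fin n)), ∀ ζ ∈ sphere (0 : ℂ) 1,
      ‖inner ℂ (g ζ) (p ζ)‖ < ε ∧ |‖p ζ‖ ^ 2 - s ζ| < ε := by
  have hcpt : IsCompact (sphere (0 : ℂ) 1) := isCompact_sphere 0 1
  have hne : (sphere (0 : ℂ) 1).Nonempty := ⟨1, by simp⟩
  obtain ⟨ζ₀, hζ₀, hmin⟩ := hcpt.exists_isMinOn hne hg.norm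
  have hm : 0 < ‖g ζ₀‖ := norm_pos_iff.2 (hg0 ζ₀ hζ₀)
  obtain ⟨B, hB⟩ := hcpt.exists_bound_of_continuousOn hg
  obtain ⟨S, hS⟩ := hcpt.exists_bound_of_continuousOn hs.sqrt
  have hB0 : 0 ≤ B := (norm_nonneg _).trans (hB ζ₀ hζ₀)
  have hS0 : 0 ≤ S := (norm_nonneg _).trans (hS ζ₀ hζ₀)
  obtain ⟨P, hP, d, hPg⟩ := exists_polyMaps_approx hg
    (ε := min ‖g ζ₀‖ (ε / (2 * (S + 1)))) (by positivity)
  have hP0 : ∀ ζ ∈ sphere (0 : ℂ) 1, P ζ ≠ 0 := by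
    intro ζ hζ h0
    have h1 := (hPg ζ hζ).trans_le (min_le_left _ _)
    rw [h0, zero_sub, norm_neg, norm_smul, norm_pow, mem_sphere_zero_iff_norm.1 hζ, one_pow,
      one_mul] at h1
    exact absurd (hmin hζ) (not_le.2 h1)
  obtain ⟨e, he⟩ := exists_forall_smul_ne hn hP
  let u : ℂ → EuclideanSpace ℂ (Fin n) := fun ζ => e - (inner ℂ (P ζ) e / (‖P ζ‖ : ℂ) ^ 2) • P ζ
  have hPc : Continuous P := (differentiable_of_mem_polyMaps hP).continuous
  have hu0 : ∀ ζ ∈ sphere (0 : ℂ) 1, u ζ ≠ 0 := fun ζ hζ h0 => he ζ hζ _ (sub_eq_zero.1 h0).symm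
  have hPu : ∀ ζ ∈ sphere (0 : ℂ) 1, inner ℂ (P ζ) (u ζ) = 0 := by
    intro ζ hζ
    have : (‖P ζ‖ : ℂ) ≠ 0 := by simpa using hP0 ζ hζ
    simp only [u]
    rw [inner_sub_right, inner_smul_right, inner_self_eq_norm_sq_to_K]
    simp only [Complex.coe_algebraMap]
    field_simp
    simp
  have huc : ContinuousOn u (sphere 0 1) := by
    have h1 : ContinuousOn (fun ζ => inner ℂ (P ζ) e / (‖P ζ‖ : ℂ) ^ 2) (sphere 0 1) := by
      refine ContinuousOn.div ?_ ?_ ?_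
      · exact (hPc.inner continuous_const).continuousOn
      · exact ((Complex.continuous_ofReal.comp hPc.norm).pow 2).continuousOn
      · intro ζ hζ
        simpa using hP0 ζ hζ
    exact continuousOn_const.sub (h1.smul hPc.continuousOn)
  let w : ℂ → EuclideanSpace ℂ (Fin n) := fun ζ => ((√(s ζ) / ‖u ζ‖ : ℝ) : ℂ) • u ζ
  have hwc : ContinuousOn w (sphere 0 1) := by
    refine ContinuousOn.smul (Complex.continuous_ofReal.comp_continuousOn
      (hs.sqrt.div huc.norm fun ζ hζ => norm_ne_zero_iff.2 (hu0 ζ hζ))) huc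
  have hwn : ∀ ζ ∈ sphere (0 : ℂ) 1, ‖w ζ‖ = √(s ζ) := by
    intro ζ hζ
    have := norm_ne_zero_iff.2 (hu0 ζ hζ)
    simp only [w]
    rw [norm_smul, Complex.norm_real, Real.norm_of_nonneg (by positivity), div_mul_cancel₀ _ this]
  obtain ⟨p, hp, d', hpw⟩ := exists_polyMaps_approx hwc
    (ε := min 1 (min (ε / (2 * (B + 1))) (ε / (2 * (S + 1))))) (by positivity)
  refine ⟨p, hp, fun ζ hζ => ?_⟩
  have hζ1 := mem_sphere_zero_iff_norm.1 hζ
  have hp1 := hpw ζ hζ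
  have hp2 := hp1.trans_le (min_le_left _ _)
  have hp3 := hp1.trans_le ((min_le_right _ _).trans (min_le_left _ _))
  have hp4 := hp1.trans_le ((min_le_right _ _).trans (min_le_right _ _))
  have hS1 : √(s ζ) ≤ S := (le_abs_self _).trans (hS ζ hζ)
  constructor
  · have h1 : ‖inner ℂ (g ζ) (w ζ)‖ ≤ ε / 2 := by
      have h2 : inner ℂ (ζ ^ d • g ζ) (w ζ) = inner ℂ (ζ ^ d • g ζ - P ζ) (w ζ) := by
        simp only [w]
        rw [inner_sub_left, inner_smul_right (P ζ), hPu ζ hζ, mul_zero, sub_zero]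
      have h3 : ‖inner ℂ (g ζ) (w ζ)‖ = ‖inner ℂ (ζ ^ d • g ζ) (w ζ)‖ := by
        rw [inner_smul_left, norm_mul, RCLike.norm_conj, norm_pow, hζ1, one_pow, one_mul]
      rw [h3, h2]
      refine (norm_inner_le_norm _ _).trans ?_
      rw [hwn ζ hζ]
      have h4 := (hPg ζ hζ).trans_le (min_le_right _ _)
      rw [norm_sub_rev] at h4
      calc ‖ζ ^ d • g ζ - P ζ‖ * √(s ζ) ≤ ε / (2 * (S + 1)) * (S + 1) := by
            gcongr; linarith
        _ = ε / 2 := by field_simp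
    have h2 : inner ℂ (g ζ) (p ζ) = inner ℂ (g ζ) (p ζ - ζ ^ d' • w ζ)
        + ζ ^ d' * inner ℂ (g ζ) (w ζ) := by
      rw [inner_sub_right, inner_smul_right]; ring
    rw [h2]
    refine (norm_add_le _ _).trans_lt ?_
    rw [norm_mul, norm_pow, hζ1, one_pow, one_mul]
    have h3 : ‖inner ℂ (g ζ) (p ζ - ζ ^ d' • w ζ)‖ < ε / 2 := by
      refine (norm_inner_le_norm _ _).trans_lt ?_
      calc ‖g ζ‖ * ‖p ζ - ζ ^ d' • w ζ‖ ≤ B * ‖p ζ - ζ ^ d' • w ζ‖ := by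
            gcongr; exact hB ζ hζ
        _ ≤ B * (ε / (2 * (B + 1))) := by gcongr
        _ < (B + 1) * (ε / (2 * (B + 1))) := by gcongr; linarith
        _ = ε / 2 := by field_simp
    linarith
  · have h1 : |‖p ζ‖ - √(s ζ)| ≤ ‖p ζ - ζ ^ d' • w ζ‖ := by
      have := abs_norm_sub_norm_le (p ζ) (ζ ^ d' • w ζ)
      rwa [norm_smul, norm_pow, hζ1, one_pow, one_mul, hwn ζ hζ] at this
    have h2 : ‖p ζ‖ ^ 2 - s ζ = (‖p ζ‖ - √(s ζ)) * (‖p ζ‖ + √(s ζ)) := by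
      have := Real.sq_sqrt (hs0 ζ hζ)
      nlinarith
    have h3 : ‖p ζ‖ + √(s ζ) < 2 * (S + 1) := by
      have := le_abs_self (‖p ζ‖ - √(s ζ))
      linarith
    rw [h2, abs_mul, abs_of_nonneg (a := ‖p ζ‖ + √(s ζ)) (by positivity)]
    calc |‖p ζ‖ - √(s ζ)| * (‖p ζ‖ + √(s ζ)) ≤ |‖p ζ‖ - √(s ζ)| * (2 * (S + 1)) := by gcongr
      _ < ε / (2 * (S + 1)) * (2 * (S + 1)) := by
          have := h1.trans_lt hp4
          gcongr
      _ = ε := by field_simp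

theorem exists_small_perturbation (hn : 2 ≤ n) {f : ℂ → EuclideanSpace ℂ (Fin n)}
    (hf : f ∈ polyMaps (EuclideanSpace ℂ (Fin n))) {ε : ℝ} (hε : 0 < ε) :
    ∃ a : EuclideanSpace ℂ (Fin n), ‖a‖ < ε ∧ (∀ z, deriv f z + a ≠ 0) ∧
      (3 ≤ n → Function.Injective fun z => f z + z • a) := by
  obtain ⟨Q, hQ, hQf, hQd⟩ := exists_dividedDifference hf
  by_cases h3 : 3 ≤ n
  · have hd := hQ.neg.dense_compl_range_of_finrank_lt_finrank (by
      rw [finrank_real_euclideanSpace_complex, Module.finrank_prod, Complex.finrank_real_complex]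
      omega)
    obtain ⟨a, ha, haε⟩ := hd.exists_dist_lt 0 hε
    have key : ∀ q, Q q + a ≠ 0 := fun q h0 => ha ⟨q, neg_eq_of_add_eq_zero_right h0⟩
    refine ⟨a, by simpa using haε, fun z => by rw [hQd]; exact key _, fun _ z w hzw => ?_⟩
    by_contra hne
    have h1 : (z - w) • (Q (z, w) + a) = 0 := by
      rw [smul_add, ← hQf, sub_smul]
      simp only at hzw
      rw [sub_add_sub_comm, hzw, sub_self]
    exact (smul_ne_zero (sub_ne_zero.2 hne) (key _)) h1
  · have hd := (hQ.neg.comp (contDiff_id.prodMk contDiff_id :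
        ContDiff ℝ 1 fun z : ℂ => (z, z))).dense_compl_range_of_finrank_lt_finrank (by
      rw [finrank_real_euclideanSpace_complex, Complex.finrank_real_complex]
      omega)
    obtain ⟨a, ha, haε⟩ := hd.exists_dist_lt 0 hε
    refine ⟨a, by simpa using haε, fun z h0 => ha ⟨z, ?_⟩, fun h => absurd h h3⟩
    rw [hQd] at h0
    exact neg_eq_of_add_eq_zero_right h0

end Tangential

section Length

variable {E : Type*} [NormedAddCommGroup E]

theorem ofReal_sub_le_eVariationOn {u : ℝ → E} {h : ℝ → ℝ} {a b : ℝ} (hab : a ≤ b)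
    (hloc : ∀ t ∈ Icc a b, ∀ᶠ q : ℝ × ℝ in 𝓝[Icc a b] t ×ˢ 𝓝[Icc a b] t,
      |h q.1 - h q.2| ≤ ‖u q.1 - u q.2‖) :
    ENNReal.ofReal (h b - h a) ≤ eVariationOn u (Icc a b) := by
  have hex : ∀ t : Icc a b, ∃ U : Set ℝ, IsOpen U ∧ t.1 ∈ U ∧
      ∀ x ∈ U ∩ Icc a b, ∀ y ∈ U ∩ Icc a b, |h x - h y| ≤ ‖u x - u y‖ := by
    intro t
    obtain ⟨A, hA, B, hB, hAB⟩ := eventually_prod_iff.1 (hloc t t.2)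
    obtain ⟨U, hU, htU, hUA⟩ := mem_nhdsWithin.1 (hA.and hB)
    exact ⟨U, hU, htU, fun x hx y hy => hAB (hUA hx).1 (hUA hy).2⟩
  choose U hUo htU hU using hex
  obtain ⟨t, ht0, htm, ⟨m, hm⟩, htU'⟩ := exists_monotone_Icc_subset_open_cover_Icc hab
    (c := fun i : Icc a b => Subtype.val ⁻¹' U i)
    (fun i => (hUo i).preimage continuous_subtype_val)
    (fun x _ => mem_iUnion.2 ⟨x, htU x⟩)
  have key : ∀ k, ENNReal.ofReal (h (t k) - h a) ≤ eVariationOn u (Icc a (t k)) := by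
    intro k
    induction k with
    | zero => rw [ht0]; simp
    | succ k ih =>
      obtain ⟨i, hi⟩ := htU' k
      have hle : t k ≤ t (k + 1) := htm (Nat.le_succ k)
      have h1 := hU i (t k) ⟨hi ⟨le_rfl, hle⟩, (t k).2⟩ (t (k + 1))
        ⟨hi ⟨hle, le_rfl⟩, (t (k + 1)).2⟩
      have h2 : ENNReal.ofReal (h (t (k + 1)) - h (t k))
          ≤ eVariationOn u (Icc (t k : ℝ) (t (k + 1))) := by
        refine le_trans ?_ (eVariationOn.edist_le u (left_mem_Icc.2 hle) (right_mem_Icc.2 hle))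
        rw [edist_dist, dist_eq_norm]
        refine ENNReal.ofReal_le_ofReal (le_trans ?_ h1)
        rw [abs_sub_comm]
        exact le_abs_self _
      have h3 := eVariationOn.Icc_add_Icc u (s := univ) (t k).2.1
        (show (t k : ℝ) ≤ t (k + 1) from hle) (mem_univ _)
      simp only [univ_inter] at h3
      rw [← h3, show h (t (k + 1)) - h a = (h (t k) - h a) + (h (t (k + 1)) - h (t k)) by ring]
      exact ENNReal.ofReal_add_le.trans (add_le_add ih h2)
  simpa [hm m le_rfl] using key m

variable [NormedSpace ℂ E]

/-- `RadialLength f r R L` certifies, through lower bounds for `‖deriv f‖` on finitely many disjoint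
annuli between radii `r` and `R`, that paths crossing from radius `r` to radius `R` have `f`-images
of length at least `L`. -/
inductive RadialLength (f : ℂ → E) (r : ℝ) : ℝ → ℝ → Prop
  | refl : RadialLength f r r 0
  | step {R L a b c L' : ℝ} : RadialLength f r R L → R ≤ a → a ≤ b →
      (∀ z, a ≤ ‖z‖ → ‖z‖ ≤ b → c < ‖deriv f z‖) → L' ≤ L + c * (b - a) → RadialLength f r b L'

namespace RadialLength

theorem le {f : ℂ → E} {r R L : ℝ} (h : RadialLength f r R L) : r ≤ R := by
  induction h with
  | refl => exact le_rfl
  | step _ h1 h2 _ _ ih => linarith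

theorem trans {f : ℂ → E} {r R R' L L' : ℝ} (h : RadialLength f r R L)
    (h' : RadialLength f R R' L') : RadialLength f r R' (L + L') := by
  induction h' with
  | refl => simpa using h
  | step _ h1 h2 h3 h4 ih => exact ih.step h1 h2 h3 (by linarith)

theorem mono {f : ℂ → E} {r R L L' : ℝ} (h : RadialLength f r R L) (hL : L' ≤ L) :
    RadialLength f r R L' :=
  h.step le_rfl le_rfl (c := -1) (fun _ _ _ => by linarith [norm_nonneg (deriv f ‹_›)])
    (by simpa using hL)

theorem extend {f : ℂ → E} {r R R' L : ℝ} (h : RadialLength f r R L) (hR : R ≤ R') :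
    RadialLength f r R' L :=
  h.step hR le_rfl (c := -1) (fun _ _ _ => by linarith [norm_nonneg (deriv f ‹_›)]) (by simp)

theorem of_norm_deriv_sub_le {f g : ℂ → E} {r R L ε : ℝ} (h : RadialLength f r R L) (hε : 0 ≤ ε)
    (hfg : ∀ z, ‖z‖ ≤ R → ‖deriv g z - deriv f z‖ ≤ ε) :
    RadialLength g r R (L - ε * (R - r)) := by
  induction h with
  | refl => simpa using refl
  | @step R L a b c L' _ h1 h2 h3 h4 ih =>
    refine (ih fun z hz => hfg z (by linarith)).step h1 h2 (c := c - ε) (fun z hz hz' => ?_) ?_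
    · have := norm_sub_norm_le (deriv f z) (deriv g z)
      rw [norm_sub_rev] at this
      linarith [hfg z hz', h3 z hz hz']
    · nlinarith

theorem le_eVariationOn [CompleteSpace E] {f : ℂ → E} {r R L : ℝ} (h : RadialLength f r R L)
    (hf : DifferentiableOn ℂ f (ball 0 1)) {γ : ℝ → ℂ} {a b : ℝ} (hab : a ≤ b)
    (hγ : ContinuousOn γ (Icc a b)) (hγ1 : ∀ t ∈ Icc a b, γ t ∈ ball (0 : ℂ) 1)
    (ha : ‖γ a‖ ≤ r) (hb : R ≤ ‖γ b‖) :
    ENNReal.ofReal L ≤ eVariationOn (fun t => f (γ t)) (Icc a b) := by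
  induction h generalizing b with
  | refl => simp
  | @step R L s t c L' h0 h1 h2 h3 h4 ih =>
    obtain ⟨t₁, ht₁, htR⟩ : R ∈ (fun t => ‖γ t‖) '' Icc a b :=
      intermediate_value_Icc hab hγ.norm ⟨ha.trans h0.le, by linarith⟩
    have hsub : Icc a t₁ ⊆ Icc a b := Icc_subset_Icc_right ht₁.2
    have hsub' : Icc t₁ b ⊆ Icc a b := Icc_subset_Icc_left ht₁.1
    have hIH := ih ht₁.1 (hγ.mono hsub) (fun t ht => hγ1 t (hsub ht)) htR.ge
    have hadd := eVariationOn.Icc_add_Icc (fun t => f (γ t)) (s := univ) ht₁.1 ht₁.2 (mem_univ _)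
    simp only [univ_inter] at hadd
    rw [← hadd]
    refine (ENNReal.ofReal_le_ofReal h4).trans (ENNReal.ofReal_add_le.trans (add_le_add hIH ?_))
    rcases le_or_gt c 0 with hc | hc
    · rw [ENNReal.ofReal_of_nonpos (by nlinarith)]
      exact zero_le
    have htR' : ‖γ t₁‖ = R := htR
    have hval : c * (t - s) = c * max s (min t ‖γ b‖) - c * max s (min t ‖γ t₁‖) := by
      rw [min_eq_left hb, htR', min_eq_right (h1.trans h2), max_eq_right h2, max_eq_left h1]
      ring
    rw [hval]
    refine ofReal_sub_le_eVariationOn (h := fun τ => c * max s (min t ‖γ τ‖)) ht₁.2 fun τ hτ => ?_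
    have hcont : Tendsto γ (𝓝[Icc t₁ b] τ) (𝓝 (γ τ)) := (hγ.mono hsub') τ hτ
    have hcomp : ∀ P : ℝ → Prop, (∀ᶠ y in 𝓝 ‖γ τ‖, P y) →
        ∀ᶠ q : ℝ × ℝ in 𝓝[Icc t₁ b] τ ×ˢ 𝓝[Icc t₁ b] τ, P ‖γ q.1‖ ∧ P ‖γ q.2‖ := fun P hP =>
      (hcont.norm.eventually hP).prod_mk (hcont.norm.eventually hP)
    by_cases hs : ‖γ τ‖ < s
    · filter_upwards [hcomp _ (eventually_lt_nhds hs)] with q hq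
      have h5 : ∀ x, x < s → max s (min t x) = s := fun x hx =>
        max_eq_left ((min_le_right _ _).trans hx.le)
      simp only [h5 _ hq.1, h5 _ hq.2, sub_self, abs_zero]
      exact norm_nonneg _
    by_cases ht : t < ‖γ τ‖
    · filter_upwards [hcomp _ (eventually_gt_nhds ht)] with q hq
      have h5 : ∀ x, t < x → min t x = t := fun x hx => min_eq_left hx.le
      simp only [h5 _ hq.1, h5 _ hq.2, sub_self, abs_zero]
      exact norm_nonneg _
    push Not at hs ht
    have hder := ((hf.analyticAt (isOpen_ball.mem_nhds (hγ1 τ (hsub' hτ)))).hasStrictDerivAt)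
    have hgap : 0 < ‖deriv f (γ τ)‖ - c := sub_pos.2 (h3 _ hs ht)
    have hlo := (hder.isLittleO.def hgap)
    rw [nhds_prod_eq] at hlo
    filter_upwards [(hcont.prodMap hcont).eventually hlo] with q hq
    simp only [Prod.map] at hq
    have h5 : ‖(γ q.1 - γ q.2) • deriv f (γ τ)‖ = ‖γ q.1 - γ q.2‖ * ‖deriv f (γ τ)‖ := norm_smul _ _
    have h6 : c * ‖γ q.1 - γ q.2‖ ≤ ‖f (γ q.1) - f (γ q.2)‖ := by
      have h7 := norm_sub_norm_le ((γ q.1 - γ q.2) • deriv f (γ τ)) (f (γ q.1) - f (γ q.2))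
      rw [norm_sub_rev (_ • _), h5] at h7
      simp at hq
      linarith
    refine le_trans ?_ h6
    rw [← mul_sub, abs_mul, abs_of_pos hc]
    refine mul_le_mul_of_nonneg_left ?_ hc.le
    rw [max_comm s, max_comm s]
    refine (abs_max_sub_max_le_abs _ _ _).trans ((abs_min_sub_min_le_max _ _ _ _).trans ?_)
    simpa using abs_norm_sub_norm_le _ _

end RadialLength

end Length

section Step

theorem exists_collar {P : ℂ → Prop}
    (hP : ∀ ζ, ‖ζ‖ = 1 → ∀ᶠ z in 𝓝[closedBall (0 : ℂ) 1] ζ, P z) (r : ℝ) (hr : r < 1) :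
    ∃ r₁, r ≤ r₁ ∧ r₁ < 1 ∧ ∀ z, r₁ ≤ ‖z‖ → ‖z‖ ≤ 1 → P z := by
  by_contra! hcon
  have hlim := tendsto_one_div_add_atTop_nhds_zero_nat (𝕜 := ℝ)
  choose z hz1 hz2 hz3 using fun k : ℕ =>
    hcon (max r (1 - 1 / ((k : ℝ) + 1))) (le_max_left _ _)
      (max_lt hr (by have : 0 < 1 / ((k : ℝ) + 1) := by positivity
                     linarith))
  obtain ⟨ζ, hζ, φ, hφ, hlimz⟩ := (isCompact_closedBall (0 : ℂ) 1).tendsto_subseq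
    (x := z) (fun k => by simpa using hz2 k)
  have h1 : 1 ≤ ‖ζ‖ := by
    refine le_of_tendsto_of_tendsto' (f := fun k => 1 - 1 / (((φ k : ℕ) : ℝ) + 1)) ?_ hlimz.norm
      fun k => (le_max_right _ _).trans (hz1 (φ k))
    simpa using (hlim.comp hφ.tendsto_atTop).const_sub 1
  have h2 : ‖ζ‖ = 1 := le_antisymm (by simpa using hζ) h1
  have h3 : Tendsto (z ∘ φ) atTop (𝓝[closedBall (0 : ℂ) 1] ζ) :=
    tendsto_nhdsWithin_iff.2 ⟨hlimz, Eventually.of_forall fun k => by simpa using hz2 (φ k)⟩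
  obtain ⟨k, hk⟩ := (h3.eventually (hP ζ h2)).exists
  exact hz3 _ hk

theorem exists_pow_smul_perturbation {E : Type*} [NormedAddCommGroup E] [NormedSpace ℂ E]
    {f p : ℂ → E} (hf : f ∈ polyMaps E) (hp : p ∈ polyMaps E) {r ε β : ℝ} (hr0 : 0 ≤ r)
    (hr : r < 1) (hε : 0 < ε) (hβ : 0 < β) (hpβ : ∀ z, r ≤ ‖z‖ → ‖z‖ ≤ 1 → β ≤ ‖p z‖) (B : ℝ) :
    ∃ K : ℕ, ∃ R, r < R ∧ R < 1 ∧ (∀ z : ℂ, ‖z‖ ≤ r → ‖z‖ ^ K * B ≤ ε) ∧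
      (∀ z, ‖z‖ ≤ r → ‖(f z + z ^ K • p z) - f z‖ ≤ ε ∧
        ‖deriv (fun z => f z + z ^ K • p z) z - deriv f z‖ ≤ ε) ∧
      RadialLength (fun z => f z + z ^ K • p z) r R (β / 16) := by
  have hball := isCompact_closedBall (0 : ℂ) 1
  have hfd := differentiable_of_mem_polyMaps hf
  have hpd := differentiable_of_mem_polyMaps hp
  obtain ⟨B₁, hB₁⟩ := hball.exists_bound_of_continuousOn hpd.continuous.continuousOn
  obtain ⟨B₂, hB₂⟩ := hball.exists_bound_of_continuousOn
    (continuous_deriv_of_mem_polyMaps hp).continuousOn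
  obtain ⟨B₃, hB₃⟩ := hball.exists_bound_of_continuousOn
    (continuous_deriv_of_mem_polyMaps hf).continuousOn
  simp only [mem_closedBall, dist_zero_right] at hB₁ hB₂ hB₃
  have hB₁0 : 0 ≤ B₁ := (norm_nonneg _).trans (hB₁ 0 (by simp))
  have hB₂0 : 0 ≤ B₂ := (norm_nonneg _).trans (hB₂ 0 (by simp))
  have hder : ∀ (m : ℕ) z, HasDerivAt (fun z => f z + z ^ (m + 1) • p z)
      (deriv f z + (z ^ (m + 1) • deriv p z + (((m : ℂ) + 1) * z ^ m) • p z)) z := fun m z => by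
    have := (hfd z).hasDerivAt.add ((hasDerivAt_pow (m + 1) z).smul (hpd z).hasDerivAt)
    simp only [Nat.cast_add, Nat.cast_one, add_tsub_cancel_right] at this
    exact this
  have l1 : Tendsto (fun m : ℕ => r ^ m) atTop (𝓝 0) := tendsto_pow_atTop_nhds_zero_of_lt_one hr0 hr
  have l2 : Tendsto (fun m : ℕ => (m : ℝ) * r ^ m) atTop (𝓝 0) :=
    tendsto_self_mul_const_pow_of_lt_one hr0 hr
  have l3 : Tendsto (fun m : ℕ => r ^ m * (|B| + B₁ + B₂) + (m * r ^ m + r ^ m) * B₁) atTop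
      (𝓝 0) := by
    simpa using (l1.mul_const (|B| + B₁ + B₂)).add ((l2.add l1).mul_const B₁)
  have l4 : Tendsto (fun m : ℕ => 1 - 1 / (2 * ((m : ℝ) + 1))) atTop (𝓝 1) := by
    have := (tendsto_one_div_add_atTop_nhds_zero_nat (𝕜 := ℝ)).const_mul (1 / 2)
    simpa [mul_comm] using this.const_sub 1
  have l5 : Tendsto (fun m : ℕ => (m : ℝ) * (β / 4)) atTop atTop :=
    tendsto_natCast_atTop_atTop.atTop_mul_const (by positivity)
  obtain ⟨m, hm1, hm2, hm3⟩ := ((l3.eventually_lt_const hε).and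
    ((l4.eventually_const_lt hr).and (l5.eventually_gt_atTop (B₃ + B₂)))).exists
  have hrm : 0 ≤ r ^ m := by positivity
  have hK : (0 : ℝ) < (m : ℝ) + 1 := by positivity
  have hzr : ∀ z : ℂ, ‖z‖ ≤ r → ‖z‖ ^ (m + 1) ≤ r ^ m := fun z hz =>
    (pow_le_pow_left₀ (norm_nonneg _) hz _).trans (pow_le_pow_of_le_one hr0 hr.le (Nat.le_succ m))
  have hzr' : ∀ z : ℂ, ‖z‖ ≤ r → ‖z‖ ^ m ≤ r ^ m := fun z hz =>
    pow_le_pow_left₀ (norm_nonneg _) hz _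
  have e1 : 0 ≤ (m * r ^ m + r ^ m) * B₁ := by positivity
  have e2 : 0 ≤ r ^ m * |B| := by positivity
  have e3 : 0 ≤ r ^ m * B₁ := by positivity
  have e4 : 0 ≤ r ^ m * B₂ := by positivity
  have hRa : 1 - 1 / (2 * ((m : ℝ) + 1)) < 1 - 1 / (4 * ((m : ℝ) + 1)) := by
    have : 1 / (4 * ((m : ℝ) + 1)) < 1 / (2 * ((m : ℝ) + 1)) :=
      one_div_lt_one_div_of_lt (by positivity) (by linarith)
    linarith
  have hR1 : 1 - 1 / (4 * ((m : ℝ) + 1)) < 1 := by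
    have : 0 < 1 / (4 * ((m : ℝ) + 1)) := by positivity
    linarith
  refine ⟨m + 1, 1 - 1 / (4 * ((m : ℝ) + 1)), hm2.trans hRa, hR1, fun z hz => ?_, fun z hz => ?_, ?_⟩
  · calc ‖z‖ ^ (m + 1) * B ≤ ‖z‖ ^ (m + 1) * |B| :=
          mul_le_mul_of_nonneg_left (le_abs_self B) (by positivity)
      _ ≤ r ^ m * |B| := mul_le_mul_of_nonneg_right (hzr z hz) (abs_nonneg _)
      _ ≤ ε := by linarith
  · have h1 : ‖z ^ (m + 1) • p z‖ ≤ r ^ m * B₁ := by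
      rw [norm_smul, norm_pow]
      exact mul_le_mul (hzr z hz) (hB₁ z (by linarith)) (norm_nonneg _) hrm
    have h2 : ‖z ^ (m + 1) • deriv p z‖ ≤ r ^ m * B₂ := by
      rw [norm_smul, norm_pow]
      exact mul_le_mul (hzr z hz) (hB₂ z (by linarith)) (norm_nonneg _) hrm
    have h3 : ‖(((m : ℂ) + 1) * z ^ m) • p z‖ ≤ (m * r ^ m + r ^ m) * B₁ := by
      rw [norm_smul, norm_mul, norm_pow]
      refine mul_le_mul ?_ (hB₁ z (by linarith)) (norm_nonneg _) (by positivity)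
      have : ‖(m : ℂ) + 1‖ = (m : ℝ) + 1 := by
        rw [← Nat.cast_succ, Complex.norm_natCast, Nat.cast_succ]
      rw [this]
      nlinarith [hzr' z hz]
    refine ⟨?_, ?_⟩
    · rw [add_sub_cancel_left]
      linarith
    · rw [(hder m z).deriv, add_sub_cancel_left]
      exact (norm_add_le _ _).trans (by linarith)
  · refine (RadialLength.refl).step hm2.le hRa.le (c := (m + 1) * (β / 4)) (fun z hz hz' => ?_) ?_
    · rw [(hder m z).deriv]
      have hz1 : ‖z‖ ≤ 1 := by linarith
      have h0 : (1 : ℝ) / 2 ≤ ‖z‖ ^ (m + 1) := by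
        have hb := one_add_mul_le_pow (a := -(1 / (2 * ((m : ℝ) + 1)))) (by
          have : 1 / (2 * ((m : ℝ) + 1)) ≤ 1 := by
            rw [div_le_one (by positivity)]
            linarith [(Nat.cast_nonneg m : (0 : ℝ) ≤ m)]
          linarith) (m + 1)
        have he : 1 + ((m + 1 : ℕ) : ℝ) * -(1 / (2 * ((m : ℝ) + 1))) = 1 / 2 := by
          push_cast
          field_simp
          ring
        rw [he] at hb
        refine hb.trans (pow_le_pow_left₀ (by linarith) (by linarith) _)
      have h0' : (1 : ℝ) / 2 ≤ ‖z‖ ^ m :=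
        h0.trans (pow_le_pow_of_le_one (norm_nonneg _) hz1 (Nat.le_succ m))
      have h2 : ‖z ^ (m + 1) • deriv p z‖ ≤ B₂ := by
        rw [norm_smul, norm_pow]
        exact (mul_le_of_le_one_left (norm_nonneg _) (pow_le_one₀ (norm_nonneg _) hz1)).trans
          (hB₂ z hz1)
      have h3 : (m + 1) * (β / 2) ≤ ‖(((m : ℂ) + 1) * z ^ m) • p z‖ := by
        rw [norm_smul, norm_mul, norm_pow]
        have : ‖(m : ℂ) + 1‖ = (m : ℝ) + 1 := by
          rw [← Nat.cast_succ, Complex.norm_natCast, Nat.cast_succ]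
        rw [this, mul_assoc]
        refine mul_le_mul_of_nonneg_left ?_ hK.le
        have := mul_le_mul h0' (hpβ z (by linarith) hz1) hβ.le (by positivity)
        linarith
      have h4 := norm_sub_norm_le ((((m : ℂ) + 1) * z ^ m) • p z)
        (-(deriv f z + z ^ (m + 1) • deriv p z))
      rw [norm_neg, sub_neg_eq_add] at h4
      have h5 := norm_add_le (deriv f z) (z ^ (m + 1) • deriv p z)
      have h6 : deriv f z + (z ^ (m + 1) • deriv p z + (((m : ℂ) + 1) * z ^ m) • p z)
          = (((m : ℂ) + 1) * z ^ m) • p z + (deriv f z + z ^ (m + 1) • deriv p z) := by abel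
      rw [h6]
      have := hB₃ z hz1
      linarith
    · have : ((m : ℝ) + 1) * (β / 4) * (1 - 1 / (4 * ((m : ℝ) + 1)) - (1 - 1 / (2 * ((m : ℝ) + 1))))
          = β / 16 := by
        field_simp
        ring
      linarith

theorem re_inner_complex_eq_inner_real {n : ℕ} (x y : EuclideanSpace ℂ (Fin n)) :
    (inner ℂ x y).re = inner ℝ x y := by
  simp [PiLp.inner_apply]

theorem IsConvexPotential.exists_polyMaps_step {n : ℕ} (hn : 2 ≤ n)
    {D : Set (EuclideanSpace ℂ (Fin n))} {ρ : EuclideanSpace ℂ (Fin n) → ℝ}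
    {G : EuclideanSpace ℂ (Fin n) → EuclideanSpace ℂ (Fin n)} (h : IsConvexPotential D ρ G)
    {M C σ κ : ℝ} (hC : 1 ≤ C) (hσ : 0 < σ)
    (hup : ∀ x ∈ D, ρ x ≤ M → ∀ y, ‖y - x‖ ≤ σ →
      y ∈ D ∧ ρ y ≤ ρ x + inner ℝ (G x) (y - x) + C * ‖y - x‖ ^ 2)
    (hκ : 0 < κ) (hκσ : κ * M ≤ σ ^ 2 / 2) {f : ℂ → EuclideanSpace ℂ (Fin n)}
    (hf : f ∈ polyMaps _) (hfD : ∀ z, ‖z‖ ≤ 1 → f z ∈ D ∧ ρ (f z) < M)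
    {q : EuclideanSpace ℂ (Fin n)} (hqD : q ∈ D) (hq : ∀ z, ‖z‖ = 1 → ρ q < ρ (f z))
    {r ε α : ℝ} (hr0 : 0 ≤ r) (hr : r < 1) (hε : 0 < ε) (hα : 0 < α)
    (hfα : ∀ z, ‖z‖ = 1 → α ≤ M - ρ (f z)) :
    ∃ g ∈ polyMaps (EuclideanSpace ℂ (Fin n)), ∃ R, r < R ∧ R < 1 ∧
      (∀ z, ‖z‖ ≤ 1 → g z ∈ D ∧ ρ (f z) - ε ≤ ρ (g z) ∧
        (1 - 2 * C * κ) * (M - ρ (f z)) ≤ M - ρ (g z)) ∧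
      (∀ z, ‖z‖ = 1 → M - ρ (g z) ≤ (1 - κ / 2) * (M - ρ (f z))) ∧
      (∀ z, ‖z‖ ≤ r → ‖g z - f z‖ ≤ ε ∧ ‖deriv g z - deriv f z‖ ≤ ε) ∧
      RadialLength g r R (√(κ * α) / 32) := by
  have hball := isCompact_closedBall (0 : ℂ) 1
  have hfc : ContinuousOn f (closedBall 0 1) :=
    (differentiable_of_mem_polyMaps hf).continuous.continuousOn
  have hmaps : MapsTo f (closedBall 0 1) D := fun z hz => (hfD z (by simpa using hz)).1
  have hρc : ContinuousOn (fun z => M - ρ (f z)) (closedBall 0 1) :=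
    continuousOn_const.sub (h.continuousOn.comp hfc hmaps)
  have hGc : ContinuousOn (fun z => G (f z)) (closedBall 0 1) := h.continuousOn_grad.comp hfc hmaps
  have hsc : sphere (0 : ℂ) 1 ⊆ closedBall 0 1 := sphere_subset_closedBall
  obtain ⟨τ, hτ, hτf⟩ : ∃ τ > 0, ∀ z, ‖z‖ ≤ 1 → τ ≤ M - ρ (f z) := by
    obtain ⟨z, hz, hmin⟩ := hball.exists_isMinOn ⟨0, by simp⟩ hρc
    exact ⟨_, sub_pos.2 (hfD z (by simpa using hz)).2, fun w hw => hmin (by simpa using hw)⟩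
  have hG0 : ∀ ζ ∈ sphere (0 : ℂ) 1, G (f ζ) ≠ 0 := fun ζ hζ h0 => by
    have hζ1 : ‖ζ‖ = 1 := by simpa using hζ
    have h1 := h.lower (f ζ) (hfD ζ hζ1.le).1 q hqD
    rw [h0, inner_zero_left] at h1
    nlinarith [hq ζ hζ1, sq_nonneg ‖q - f ζ‖]
  set η := min ε (min (κ * τ / 4) (σ ^ 2 / 2)) with hη
  have hη0 : 0 < η := by positivity
  have hη1 : η ≤ ε := min_le_left _ _
  have hη2 : η ≤ κ * τ / 4 := (min_le_right _ _).trans (min_le_left _ _)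
  have hη3 : η ≤ σ ^ 2 / 2 := (min_le_right _ _).trans (min_le_right _ _)
  obtain ⟨p, hp, hpt⟩ := exists_tangential_polyMaps hn (hGc.mono hsc) hG0
    (s := fun z => κ * (M - ρ (f z))) (continuousOn_const.mul (hρc.mono hsc))
    (fun ζ hζ => mul_nonneg hκ.le (hτ.le.trans (hτf ζ (by simpa using hζ.le)))) hη0
  have hpc : Continuous p := (differentiable_of_mem_polyMaps hp).continuous
  have hin : ContinuousOn (fun z => ‖inner ℂ (G (f z)) (p z)‖) (closedBall 0 1) :=
    (hGc.inner hpc.continuousOn).norm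
  have hdiff : ContinuousOn (fun z => |‖p z‖ ^ 2 - κ * (M - ρ (f z))|) (closedBall 0 1) :=
    ((hpc.norm.pow 2).continuousOn.sub (continuousOn_const.mul hρc)).abs
  have hsq : ∀ ζ, ‖ζ‖ = 1 → (√(κ * α) / 2) ^ 2 < ‖p ζ‖ ^ 2 := fun ζ hζ => by
    rw [div_pow, Real.sq_sqrt (by positivity)]
    have h1 := (abs_lt.1 (hpt ζ (by simpa using hζ)).2).1
    have h2 := hτf ζ hζ.le
    have h3 := hfα ζ hζ
    have : κ * τ ≤ κ * (M - ρ (f ζ)) := by gcongr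
    have : κ * α ≤ κ * (M - ρ (f ζ)) := by gcongr
    have : 0 < κ * α := by positivity
    linarith
  obtain ⟨r₁, hrr₁, hr₁, hcol⟩ := exists_collar
    (P := fun z => ‖inner ℂ (G (f z)) (p z)‖ < η ∧ |‖p z‖ ^ 2 - κ * (M - ρ (f z))| < η ∧
      (√(κ * α) / 2) ^ 2 < ‖p z‖ ^ 2) (fun ζ hζ => by
      have hζb : ζ ∈ closedBall (0 : ℂ) 1 := by simpa using hζ.le
      have hζs : ζ ∈ sphere (0 : ℂ) 1 := by simpa using hζ
      exact ((hin ζ hζb).eventually_lt_const (hpt ζ hζs).1).and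
        (((hdiff ζ hζb).eventually_lt_const (hpt ζ hζs).2).and
        (((hpc.norm.pow 2).continuousOn ζ hζb).eventually_const_lt (hsq ζ hζ)))) r hr
  obtain ⟨B₁, hB₁⟩ := hball.exists_bound_of_continuousOn hin
  obtain ⟨B₂, hB₂⟩ := hball.exists_bound_of_continuousOn (f := fun z => ‖p z‖ ^ 2)
    (hpc.norm.pow 2).continuousOn
  have hr₁0 : 0 ≤ r₁ := hr0.trans hrr₁
  obtain ⟨K, R, hrR, hR, hKB, hclose, hlen⟩ := exists_pow_smul_perturbation hf hp hr₁0 hr₁ hη0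
    (β := √(κ * α) / 2) (by positivity)
    (fun z hz hz' => (lt_of_pow_lt_pow_left₀ 2 (norm_nonneg _) (hcol z hz hz').2.2).le) (max B₁ B₂)
  have hinner : ∀ z, ‖z‖ ≤ 1 → |inner ℝ (G (f z)) (z ^ K • p z)| ≤ η := fun z hz => by
    rw [← re_inner_complex_eq_inner_real, inner_smul_right]
    refine (Complex.abs_re_le_norm _).trans ?_
    rw [norm_mul, norm_pow]
    rcases le_total ‖z‖ r₁ with h1 | h1
    · refine le_trans ?_ (hKB z h1)
      gcongr
      have := hB₁ z (by simpa using hz)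
      rw [norm_norm] at this
      exact this.trans (le_max_left _ _)
    · exact (mul_le_of_le_one_left (norm_nonneg _) (pow_le_one₀ (norm_nonneg _) hz)).trans
        (hcol z h1 hz).1.le
  have hτ0 : ∀ z, ‖z‖ ≤ 1 → 0 < κ * (M - ρ (f z)) := fun z hz =>
    mul_pos hκ (hτ.trans_le (hτf z hz))
  have hnormsq : ∀ z, ‖z‖ ≤ 1 → ‖z ^ K • p z‖ ^ 2 ≤ κ * (M - ρ (f z)) + η := fun z hz => by
    rw [norm_smul, norm_pow, mul_pow]
    have hz1 : ‖z‖ ^ K ≤ 1 := pow_le_one₀ (norm_nonneg _) hz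
    have hz0 : 0 ≤ ‖z‖ ^ K := by positivity
    have hzz : (‖z‖ ^ K) ^ 2 ≤ ‖z‖ ^ K := by nlinarith
    rcases le_total ‖z‖ r₁ with h1 | h1
    · have h2 := hB₂ z (by simpa using hz)
      rw [Real.norm_of_nonneg (by positivity)] at h2
      have h3 : (‖z‖ ^ K) ^ 2 * ‖p z‖ ^ 2 ≤ ‖z‖ ^ K * max B₁ B₂ :=
        mul_le_mul hzz (h2.trans (le_max_right _ _)) (by positivity) hz0
      linarith [hKB z h1, hτ0 z hz]
    · have h2 := (abs_lt.1 (hcol z h1 hz).2.1).2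
      have h3 : (‖z‖ ^ K) ^ 2 * ‖p z‖ ^ 2 ≤ ‖p z‖ ^ 2 :=
        mul_le_of_le_one_left (by positivity) (by nlinarith)
      linarith
  have hup' : ∀ z, ‖z‖ ≤ 1 → f z + z ^ K • p z ∈ D ∧
      ρ (f z + z ^ K • p z) ≤ ρ (f z) + η + C * (κ * (M - ρ (f z)) + η) := fun z hz => by
    have h1 : ‖f z + z ^ K • p z - f z‖ ≤ σ := by
      rw [add_sub_cancel_left]
      refine le_of_sq_le_sq ?_ hσ.le
      have : κ * (M - ρ (f z)) ≤ κ * M := by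
        gcongr
        linarith [h.nonneg (f z)]
      linarith [hnormsq z hz]
    obtain ⟨h2, h3⟩ := hup (f z) (hfD z hz).1 (hfD z hz).2.le _ h1
    rw [add_sub_cancel_left] at h3
    refine ⟨h2, h3.trans ?_⟩
    have := (abs_le.1 (hinner z hz)).2
    have := mul_le_mul_of_nonneg_left (hnormsq z hz) (by linarith : 0 ≤ C)
    linarith
  have hlow : ∀ z, ‖z‖ ≤ 1 → ρ (f z) - η + ‖z ^ K • p z‖ ^ 2 ≤ ρ (f z + z ^ K • p z) :=
    fun z hz => by
    have h1 := h.lower (f z) (hfD z hz).1 _ (hup' z hz).1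
    rw [add_sub_cancel_left] at h1
    have := (abs_le.1 (hinner z hz)).1
    linarith
  refine ⟨fun z => f z + z ^ K • p z, Submodule.add_mem _ hf (pow_smul_mem_polyMaps hp K), R,
    hrr₁.trans_lt hrR, hR, fun z hz => ⟨(hup' z hz).1, ?_, ?_⟩, fun z hz => ?_, fun z hz => ?_, ?_⟩
  · have := hlow z hz
    have := sq_nonneg ‖z ^ K • p z‖
    simp only
    linarith
  · have h1 := (hup' z hz).2
    have h2 : κ * τ ≤ κ * (M - ρ (f z)) := mul_le_mul_of_nonneg_left (hτf z hz) hκ.le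
    have h3 : (1 + C) * η ≤ C * (κ * (M - ρ (f z))) := by
      have : (1 + C) * η ≤ 2 * C * η := by gcongr; linarith
      have : C * (2 * η) ≤ C * (κ * (M - ρ (f z))) :=
        mul_le_mul_of_nonneg_left (by linarith [hτ0 z hz]) (by linarith)
      linarith
    simp only
    linarith
  · have h1 := hlow z hz.le
    have h2 : κ * τ ≤ κ * (M - ρ (f z)) := mul_le_mul_of_nonneg_left (hτf z hz.le) hκ.le
    have h3 := (abs_lt.1 (hpt z (by simpa using hz)).2).1
    rw [norm_smul, norm_pow, hz, one_pow, one_mul] at h1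
    simp only
    linarith
  · obtain ⟨h1, h2⟩ := hclose z (hz.trans hrr₁)
    exact ⟨h1.trans hη1, h2.trans hη1⟩
  · exact ((RadialLength.refl.extend hrr₁).trans hlen).mono (by linarith)

end Step

section Stage

variable {n : ℕ} {D : Set (EuclideanSpace ℂ (Fin n))} {ρ : EuclideanSpace ℂ (Fin n) → ℝ}
  {G : EuclideanSpace ℂ (Fin n) → EuclideanSpace ℂ (Fin n)}

theorem IsConvexPotential.exists_polyMaps_iterate (hn : 2 ≤ n) (h : IsConvexPotential D ρ G)
    {M C σ κ : ℝ} (hC : 1 ≤ C) (hσ : 0 < σ)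
    (hup : ∀ x ∈ D, ρ x ≤ M → ∀ y, ‖y - x‖ ≤ σ →
      y ∈ D ∧ ρ y ≤ ρ x + inner ℝ (G x) (y - x) + C * ‖y - x‖ ^ 2)
    (hκ : 0 < κ) (hκσ : κ * M ≤ σ ^ 2 / 2) (hκC : 2 * C * κ < 1)
    {f : ℂ → EuclideanSpace ℂ (Fin n)}
    (hf : f ∈ polyMaps _) (hfD : ∀ z, ‖z‖ ≤ 1 → f z ∈ D ∧ ρ (f z) < M)
    {q : EuclideanSpace ℂ (Fin n)} (hqD : q ∈ D) {r α : ℝ} (hr0 : 0 ≤ r) (hr : r < 1)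
    (hα : 0 < α) (hfα : ∀ z, ‖z‖ = 1 → α ≤ M - ρ (f z)) (J : ℕ) {ε : ℝ} (hε : 0 < ε)
    (hq : ∀ z, ‖z‖ = 1 → ρ q + ε < ρ (f z)) :
    ∃ g ∈ polyMaps (EuclideanSpace ℂ (Fin n)), ∃ R, r ≤ R ∧ R < 1 ∧
      (∀ z, ‖z‖ ≤ 1 → g z ∈ D ∧ ρ (f z) - ε ≤ ρ (g z) ∧
        (1 - 2 * C * κ) ^ J * (M - ρ (f z)) ≤ M - ρ (g z)) ∧
      (∀ z, ‖z‖ = 1 → M - ρ (g z) ≤ (1 - κ / 2) ^ J * (M - ρ (f z))) ∧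
      (∀ z, ‖z‖ ≤ r → ‖g z - f z‖ ≤ ε ∧ ‖deriv g z - deriv f z‖ ≤ ε) ∧
      RadialLength g r R (J * (√(κ * ((1 - 2 * C * κ) ^ J * α)) / 32) - ε) := by
  have hθ : 0 < 1 - 2 * C * κ := by linarith
  have hθ1 : 1 - 2 * C * κ ≤ 1 := by
    have : 0 ≤ 2 * C * κ := by positivity
    linarith
  have hκ2 : 0 ≤ 1 - κ / 2 := by nlinarith
  induction J generalizing ε with
  | zero =>
    refine ⟨f, hf, r, le_rfl, hr, fun z hz => ⟨(hfD z hz).1, by linarith, by simp⟩,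
      fun z hz => by simp, fun z hz => by simp [hε.le], ?_⟩
    exact RadialLength.refl.mono (by simpa using hε.le)
  | succ J ih =>
    obtain ⟨g, hg, R, hrR, hR, hgD, hgc, hclose, hlen⟩ := ih (half_pos hε)
      (fun z hz => by linarith [hq z hz])
    have hgM : ∀ z, ‖z‖ ≤ 1 → g z ∈ D ∧ ρ (g z) < M := fun z hz => by
      obtain ⟨h1, h2, h3⟩ := hgD z hz
      have : 0 < (1 - 2 * C * κ) ^ J * (M - ρ (f z)) :=
        mul_pos (pow_pos hθ J) (sub_pos.2 (hfD z hz).2)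
      exact ⟨h1, by linarith⟩
    obtain ⟨g', hg', R', hRR', hR', hgD', hgc', hclose', hlen'⟩ :=
      h.exists_polyMaps_step hn hC hσ hup hκ hκσ hg hgM hqD
      (fun z hz => by linarith [hq z hz, (hgD z hz.le).2.1]) (hr0.trans hrR) hR (half_pos hε)
      (α := (1 - 2 * C * κ) ^ J * α) (by positivity)
      (fun z hz => (mul_le_mul_of_nonneg_left (hfα z hz) (by positivity)).trans
        (hgD z hz.le).2.2)
    refine ⟨g', hg', R', hrR.trans hRR'.le, hR', fun z hz => ⟨(hgD' z hz).1, ?_, ?_⟩,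
      fun z hz => ?_, fun z hz => ?_, ?_⟩
    · linarith [(hgD' z hz).2.1, (hgD z hz).2.1]
    · refine le_trans ?_ (hgD' z hz).2.2
      rw [pow_succ', mul_assoc]
      exact mul_le_mul_of_nonneg_left (hgD z hz).2.2 hθ.le
    · refine (hgc' z hz).trans ?_
      rw [pow_succ', mul_assoc]
      exact mul_le_mul_of_nonneg_left (hgc z hz) hκ2
    · obtain ⟨h1, h2⟩ := hclose z hz
      obtain ⟨h3, h4⟩ := hclose' z (hz.trans hrR)
      have h5 := norm_sub_le_norm_sub_add_norm_sub (g' z) (g z) (f z)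
      have h6 := norm_sub_le_norm_sub_add_norm_sub (deriv g' z) (deriv g z) (deriv f z)
      exact ⟨by linarith, by linarith⟩
    · refine ((hlen.of_norm_deriv_sub_le (half_pos hε).le
        fun z hz => (hclose' z hz).2).trans hlen').mono ?_
      have h1 : √(κ * ((1 - 2 * C * κ) ^ (J + 1) * α)) ≤ √(κ * ((1 - 2 * C * κ) ^ J * α)) := by
        refine Real.sqrt_le_sqrt ?_
        have := pow_le_pow_of_le_one hθ.le hθ1 (Nat.le_succ J)
        gcongr
      have h2 : ε / 2 * (R - r) ≤ ε / 2 := mul_le_of_le_one_right (by linarith) (by linarith)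
      have h3 := mul_le_mul_of_nonneg_left h1 (Nat.cast_nonneg (α := ℝ) J)
      push_cast
      linarith

theorem IsConvexPotential.exists_gap (h : IsConvexPotential D ρ G) {M : ℝ}
    {f : ℂ → EuclideanSpace ℂ (Fin n)} (hf : f ∈ polyMaps _)
    (hfD : ∀ z, ‖z‖ ≤ 1 → f z ∈ D ∧ ρ (f z) < M) :
    ∃ α > 0, ∀ z, ‖z‖ ≤ 1 → α ≤ M - ρ (f z) := by
  have hρc : ContinuousOn (fun z => M - ρ (f z)) (closedBall 0 1) :=
    continuousOn_const.sub (h.continuousOn.comp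
      (differentiable_of_mem_polyMaps hf).continuous.continuousOn
      fun z hz => (hfD z (by simpa using hz)).1)
  obtain ⟨z, hz, hmin⟩ := (isCompact_closedBall (0 : ℂ) 1).exists_isMinOn ⟨0, by simp⟩ hρc
  exact ⟨_, sub_pos.2 (hfD z (by simpa using hz)).2, fun w hw => hmin (by simpa using hw)⟩

theorem IsConvexPotential.exists_polyMaps_stage (hn : 2 ≤ n) (h : IsConvexPotential D ρ G)
    {M : ℝ} {f : ℂ → EuclideanSpace ℂ (Fin n)} (hf : f ∈ polyMaps _)
    (hfD : ∀ z, ‖z‖ ≤ 1 → f z ∈ D ∧ ρ (f z) < M)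
    {q : EuclideanSpace ℂ (Fin n)} (hqD : q ∈ D) {r : ℝ} (hr0 : 0 ≤ r) (hr : r < 1)
    {ε : ℝ} (hε : 0 < ε) (hq : ∀ z, ‖z‖ = 1 → ρ q + ε < ρ (f z)) (L : ℝ) :
    ∃ g ∈ polyMaps (EuclideanSpace ℂ (Fin n)), ∃ R, r ≤ R ∧ R < 1 ∧
      (∀ z, ‖z‖ ≤ 1 → g z ∈ D ∧ ρ (f z) - ε ≤ ρ (g z) ∧ ρ (g z) < M) ∧
      (∀ z, ‖z‖ = 1 → M - 1 < ρ (g z)) ∧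
      (∀ z, ‖z‖ ≤ r → ‖g z - f z‖ ≤ ε ∧ ‖deriv g z - deriv f z‖ ≤ ε) ∧
      RadialLength g r R L := by
  have hM : 0 < M := (h.nonneg _).trans_lt (hfD 0 (by simp)).2
  obtain ⟨C, hC, σ, hσ, hup⟩ := h.upper M
  obtain ⟨α, hα, hfα⟩ := h.exists_gap hf hfD
  have hC0 : 0 < C := by linarith
  set κ := min (1 / (4 * C)) (σ ^ 2 / 2 / M) with hκdef
  have hκ : 0 < κ := by positivity
  have hκC : 2 * C * κ ≤ 1 / 2 := by
    have : 2 * C * κ ≤ 2 * C * (1 / (4 * C)) := by gcongr; exact min_le_left _ _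
    refine this.trans (le_of_eq ?_)
    field_simp
    norm_num
  have hκσ : κ * M ≤ σ ^ 2 / 2 := (le_div_iff₀ hM).1 (min_le_right _ _)
  have hκ4 : κ ≤ 1 / 4 := by nlinarith
  obtain ⟨J, hJ⟩ := exists_nat_gt (max 1 ((32 * (L + 2 * ε)) ^ 2 / (κ * α / 2)))
  have hJ1 : (1 : ℝ) < J := (le_max_left _ _).trans_lt hJ
  have hJ0 : (0 : ℝ) < J := by linarith
  have hJ2 : (32 * (L + 2 * ε)) ^ 2 ≤ J * (κ * α / 2) :=
    (div_le_iff₀ (by positivity)).1 ((le_max_right _ _).trans hJ.le)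
  have hκJ : κ / J ≤ κ := div_le_self hκ.le hJ1.le
  have hε2 := half_pos hε
  obtain ⟨g, hg, R, hrR, hR, hgD, -, hclose, hlen⟩ := h.exists_polyMaps_iterate hn hC hσ hup
    (κ := κ / J) (by positivity) ((mul_le_mul_of_nonneg_right hκJ hM.le).trans hκσ)
    (by nlinarith) hf hfD hqD hr0 hr hα (fun z hz => hfα z hz.le) J hε2
    (fun z hz => by linarith [hq z hz])
  have hθ : 0 < 1 - 2 * C * (κ / J) := by nlinarith
  have hgM : ∀ z, ‖z‖ ≤ 1 → g z ∈ D ∧ ρ (g z) < M := fun z hz => by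
    obtain ⟨h1, h2, h3⟩ := hgD z hz
    have : 0 < (1 - 2 * C * (κ / J)) ^ J * (M - ρ (f z)) :=
      mul_pos (pow_pos hθ J) (sub_pos.2 (hfD z hz).2)
    exact ⟨h1, by linarith⟩
  have hbern : 1 / 2 ≤ (1 - 2 * C * (κ / J)) ^ J := by
    have := one_add_mul_le_pow (a := -(2 * C * (κ / J))) (by linarith) J
    rw [← sub_eq_add_neg] at this
    refine le_trans ?_ this
    have : (J : ℝ) * -(2 * C * (κ / J)) = -(2 * C * κ) := by field_simp
    linarith
  have hlenL : L + 2 * ε ≤ J * (√(κ / J * ((1 - 2 * C * (κ / J)) ^ J * α)) / 32) := by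
    have h1 : 32 * (L + 2 * ε) / J ≤ √(κ / J * ((1 - 2 * C * (κ / J)) ^ J * α)) := by
      refine Real.le_sqrt_of_sq_le ?_
      have h2 : κ / J * (1 / 2 * α) ≤ κ / J * ((1 - 2 * C * (κ / J)) ^ J * α) := by gcongr
      refine le_trans ?_ h2
      rw [div_pow, div_le_iff₀ (by positivity)]
      refine hJ2.trans (le_of_eq ?_)
      field_simp
    rw [div_le_iff₀ hJ0] at h1
    linarith
  obtain ⟨α', hα', hgα⟩ := h.exists_gap hg hgM
  obtain ⟨J', hJ'⟩ := exists_pow_lt_of_lt_one (one_div_pos.2 hM) (show 1 - κ / 2 < 1 by linarith)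
  obtain ⟨g', hg', R', hRR', hR', hgD', hgc', hclose', hlen'⟩ := h.exists_polyMaps_iterate hn hC hσ
    hup hκ hκσ (by linarith) hg hgM hqD (hr0.trans hrR) hR hα' (fun z hz => hgα z hz.le) J' hε2
    (fun z hz => by linarith [hq z hz, (hgD z hz.le).2.1])
  refine ⟨g', hg', R', hrR.trans hRR', hR', fun z hz => ⟨(hgD' z hz).1, ?_, ?_⟩,
      fun z hz => ?_, fun z hz => ?_, ?_⟩
  · linarith [(hgD' z hz).2.1, (hgD z hz).2.1]
  · have : 0 < (1 - 2 * C * κ) ^ J' * (M - ρ (g z)) :=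
      mul_pos (pow_pos (by linarith) J') (sub_pos.2 (hgM z hz).2)
    linarith [(hgD' z hz).2.2]
  · have h1 : (1 - κ / 2) ^ J' * (M - ρ (g z)) ≤ (1 - κ / 2) ^ J' * M :=
      mul_le_mul_of_nonneg_left (by linarith [h.nonneg (g z)]) (pow_nonneg (by linarith) _)
    have h2 := (lt_div_iff₀ hM).1 hJ'
    linarith [hgc' z hz]
  · obtain ⟨h1, h2⟩ := hclose z hz
    obtain ⟨h3, h4⟩ := hclose' z (hz.trans hrR)
    have h5 := norm_sub_le_norm_sub_add_norm_sub (g' z) (g z) (f z)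
    have h6 := norm_sub_le_norm_sub_add_norm_sub (deriv g' z) (deriv g z) (deriv f z)
    exact ⟨by linarith, by linarith⟩
  · refine ((hlen.of_norm_deriv_sub_le hε2.le fun z hz => (hclose' z hz).2).trans hlen').mono ?_
    have h2 : ε / 2 * (R - r) ≤ ε / 2 := mul_le_of_le_one_right (by linarith) (by linarith)
    have h3 : 0 ≤ J' * (√(κ * ((1 - 2 * C * κ) ^ J' * α')) / 32) := by positivity
    linarith

theorem IsConvexPotential.exists_tolerance (h : IsConvexPotential D ρ G)
    {f : ℂ → EuclideanSpace ℂ (Fin n)} (hf : f ∈ polyMaps _) (hfD : ∀ z, ‖z‖ ≤ 1 → f z ∈ D)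
    {η : ℝ} (hη : 0 < η) :
    ∃ δ > 0, ∀ z, ‖z‖ ≤ 1 → ∀ y, ‖y - f z‖ ≤ δ → y ∈ D ∧ |ρ y - ρ (f z)| ≤ η := by
  have hball := isCompact_closedBall (0 : ℂ) 1
  have hfc : ContinuousOn f (closedBall 0 1) :=
    (differentiable_of_mem_polyMaps hf).continuous.continuousOn
  have hmaps : MapsTo f (closedBall 0 1) D := fun z hz => hfD z (by simpa using hz)
  obtain ⟨M, hM⟩ := hball.exists_bound_of_continuousOn (h.continuousOn.comp hfc hmaps)
  obtain ⟨B, hB⟩ := hball.exists_bound_of_continuousOn (h.continuousOn_grad.comp hfc hmaps)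
  simp only [mem_closedBall, dist_zero_right, Function.comp_apply] at hM hB
  obtain ⟨C, hC, σ, hσ, hup⟩ := h.upper M
  have hB0 : 0 ≤ B := (norm_nonneg _).trans (hB 0 (by simp))
  have hBC : 0 < B + C := by linarith
  refine ⟨min (min σ 1) (η / (B + C)), by positivity, fun z hz y hy => ?_⟩
  have hy1 : ‖y - f z‖ ≤ σ := hy.trans ((min_le_left _ _).trans (min_le_left _ _))
  have hy2 : ‖y - f z‖ ≤ 1 := hy.trans ((min_le_left _ _).trans (min_le_right _ _))
  have hy3 : ‖y - f z‖ * (B + C) ≤ η := (le_div_iff₀ hBC).1 (hy.trans (min_le_right _ _))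
  obtain ⟨h1, h2⟩ := hup (f z) (hfD z hz) ((le_abs_self _).trans (hM z hz)) y hy1
  have h3 := h.lower (f z) (hfD z hz) y h1
  have h4 : |inner ℝ (G (f z)) (y - f z)| ≤ B * ‖y - f z‖ :=
    (abs_real_inner_le_norm _ _).trans (mul_le_mul_of_nonneg_right (hB z hz) (norm_nonneg _))
  have h5 : C * ‖y - f z‖ ^ 2 ≤ C * ‖y - f z‖ := by
    have := norm_nonneg (y - f z)
    refine mul_le_mul_of_nonneg_left ?_ (by linarith)
    nlinarith
  have h6 := abs_le.1 h4
  have h7 : 0 ≤ C * ‖y - f z‖ := by positivity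
  refine ⟨h1, abs_le.2 ⟨?_, ?_⟩⟩
  · nlinarith [sq_nonneg ‖y - f z‖]
  · nlinarith

theorem IsConvexPotential.exists_regular_perturbation (hn : 2 ≤ n) (h : IsConvexPotential D ρ G)
    {f : ℂ → EuclideanSpace ℂ (Fin n)} (hf : f ∈ polyMaps _) (hfD : ∀ z, ‖z‖ ≤ 1 → f z ∈ D)
    {η : ℝ} (hη : 0 < η) :
    ∃ g ∈ polyMaps (EuclideanSpace ℂ (Fin n)),
      (∀ z, ‖z‖ ≤ 1 → ‖g z - f z‖ ≤ η ∧ ‖deriv g z - deriv f z‖ ≤ η) ∧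
      (∀ z, ‖z‖ ≤ 1 → g z ∈ D ∧ |ρ (g z) - ρ (f z)| ≤ η) ∧
      (∀ z, deriv g z ≠ 0) ∧ (3 ≤ n → Function.Injective g) := by
  obtain ⟨δ, hδ, hδf⟩ := h.exists_tolerance hf hfD hη
  obtain ⟨a, ha, ha', hinj⟩ := exists_small_perturbation hn hf (lt_min hδ hη)
  have hder : ∀ z, deriv (fun z => f z + z • a) z = deriv f z + a := fun z => by
    have := ((differentiable_of_mem_polyMaps hf z).hasDerivAt.add
      ((hasDerivAt_id z).smul_const a)).deriv
    rw [one_smul] at this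
    exact this
  have hza : ∀ z : ℂ, ‖z‖ ≤ 1 → ‖f z + z • a - f z‖ < min δ η := fun z hz => by
    rw [add_sub_cancel_left, norm_smul]
    exact (mul_le_of_le_one_left (norm_nonneg _) hz).trans_lt ha
  refine ⟨fun z => f z + z • a, Submodule.add_mem _ hf (id_smul_const_mem_polyMaps a),
    fun z hz => ⟨(hza z hz).le.trans (min_le_right _ _), ?_⟩,
    fun z hz => hδf z hz _ ((hza z hz).le.trans (min_le_left _ _)), fun z => ?_, hinj⟩
  · rw [hder, add_sub_cancel_left]
    exact ha.le.trans (min_le_right _ _)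
  · rw [hder]
    exact ha' z

theorem exists_stable_immersion {f : ℂ → EuclideanSpace ℂ (Fin n)} (hf : f ∈ polyMaps _)
    (hf0 : ∀ z, deriv f z ≠ 0) (hinj : 3 ≤ n → Function.Injective f) :
    ∃ δ > 0, ∀ r < 1, ∀ g : ℂ → EuclideanSpace ℂ (Fin n), DifferentiableOn ℂ g (ball 0 1) →
      (∀ z, ‖z‖ ≤ r → ‖deriv g z - deriv f z‖ ≤ δ) →
      (∀ z, ‖z‖ ≤ r → deriv g z ≠ 0) ∧ (3 ≤ n → InjOn g (closedBall 0 r)) := by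
  have hball := isCompact_closedBall (0 : ℂ) 1
  obtain ⟨Q, hQ, hQf, hQd⟩ := exists_dividedDifference hf
  obtain ⟨z₀, -, hmin⟩ := hball.exists_isMinOn ⟨0, by simp⟩
    (continuous_deriv_of_mem_polyMaps hf).norm.continuousOn
  have hm : 0 < ‖deriv f z₀‖ := norm_pos_iff.2 (hf0 z₀)
  obtain ⟨m, hm0, hmQ⟩ : ∃ m > 0, 3 ≤ n → ∀ z w : ℂ, ‖z‖ ≤ 1 → ‖w‖ ≤ 1 → m ≤ ‖Q (z, w)‖ := by
    by_cases h3 : 3 ≤ n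
    · obtain ⟨p, -, hp⟩ := (hball.prod hball).exists_isMinOn ⟨(0, 0), by simp⟩
        hQ.continuous.norm.continuousOn
      refine ⟨‖Q p‖, norm_pos_iff.2 fun h0 => ?_, fun _ z w hz hw => hp (by simp [hz, hw])⟩
      by_cases hpp : p.1 = p.2
      · refine hf0 p.1 ?_
        rw [hQd]
        nth_rw 2 [hpp]
        exact h0
      · refine hpp (hinj h3 (sub_eq_zero.1 ?_))
        rw [hQf, h0, smul_zero]
    · exact ⟨1, one_pos, fun h => absurd h h3⟩
  refine ⟨min ‖deriv f z₀‖ m / 2, by positivity, fun r hr g hg hgf =>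
    ⟨fun z hz h0 => ?_, fun h3 z hz w hw hzw => ?_⟩⟩
  · have h1 := hgf z hz
    have h2 : ‖deriv f z₀‖ ≤ ‖deriv f z‖ := hmin (by simpa using hz.trans hr.le)
    rw [h0, zero_sub, norm_neg] at h1
    have := min_le_left ‖deriv f z₀‖ m
    linarith
  · by_contra hne
    simp only [mem_closedBall, dist_zero_right] at hz hw
    have hfd := differentiable_of_mem_polyMaps hf
    have hgd : ∀ x ∈ closedBall (0 : ℂ) r, DifferentiableAt ℂ g x := fun x hx =>
      hg.differentiableAt (isOpen_ball.mem_nhds (closedBall_subset_ball hr hx))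
    have h1 := Convex.norm_image_sub_le_of_norm_deriv_le (f := fun z => g z - f z)
      (s := closedBall (0 : ℂ) r) (C := min ‖deriv f z₀‖ m / 2)
      (fun x hx => (hgd x hx).sub (hfd x))
      (fun x hx => by
        rw [deriv_fun_sub (hgd x hx) (hfd x)]
        exact hgf x (by simpa using hx))
      (convex_closedBall 0 r) (x := w) (y := z) (by simpa using hw) (by simpa using hz)
    rw [hzw, sub_sub_sub_cancel_left, norm_sub_rev, hQf, norm_smul] at h1
    have h2 := hmQ h3 z w (hz.trans hr.le) (hw.trans hr.le)
    have h3 : 0 < ‖z - w‖ := norm_pos_iff.2 (sub_ne_zero.2 hne)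
    have h4 := min_le_right ‖deriv f z₀‖ m
    nlinarith

variable (D ρ) in
/-- A stage of the inductive construction: the polynomial map `f` sends the closed disc into `D`
and the circles of radius at least `r` into `{β + k < ρ}`, and these properties together with its
regularity are stable under perturbations of size `2 * δ`. -/
structure DiscStage (β : ℝ) (k : ℕ) (f : ℂ → EuclideanSpace ℂ (Fin n)) (r δ : ℝ) : Prop where
  mem_polyMaps : f ∈ polyMaps (EuclideanSpace ℂ (Fin n))
  radius_nonneg : 0 ≤ r
  radius_lt : r < 1
  le_radius : 1 - 1 / ((k : ℝ) + 1) ≤ r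
  pos : 0 < δ
  le_one : δ ≤ 1
  mem : ∀ z, ‖z‖ ≤ 1 → f z ∈ D
  lt_potential : ∀ z, r ≤ ‖z‖ → ‖z‖ ≤ 1 → β + k < ρ (f z)
  tolerance : ∀ z, ‖z‖ ≤ 1 → ∀ y, ‖y - f z‖ ≤ 2 * δ → y ∈ D ∧ |ρ y - ρ (f z)| ≤ 1
  regular : ∀ g : ℂ → EuclideanSpace ℂ (Fin n), DifferentiableOn ℂ g (ball 0 1) →
      (∀ z, ‖z‖ ≤ r → ‖deriv g z - deriv f z‖ ≤ 2 * δ) →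
      (∀ z, ‖z‖ ≤ r → deriv g z ≠ 0) ∧ (3 ≤ n → InjOn g (closedBall 0 r))

theorem IsConvexPotential.exists_discStage (h : IsConvexPotential D ρ G) {β : ℝ} {k : ℕ}
    {f : ℂ → EuclideanSpace ℂ (Fin n)} (hf : f ∈ polyMaps _) (hfD : ∀ z, ‖z‖ ≤ 1 → f z ∈ D)
    (hf0 : ∀ z, deriv f z ≠ 0) (hinj : 3 ≤ n → Function.Injective f) {r δ₀ : ℝ} (hr0 : 0 ≤ r)
    (hr1 : r < 1) (hrk : 1 - 1 / ((k : ℝ) + 1) ≤ r)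
    (hρ : ∀ z, r ≤ ‖z‖ → ‖z‖ ≤ 1 → β + k < ρ (f z)) (hδ₀ : 0 < δ₀) :
    ∃ δ ≤ δ₀, DiscStage D ρ β k f r δ := by
  obtain ⟨δ₁, hδ₁, h1⟩ := h.exists_tolerance hf hfD one_pos
  obtain ⟨δ₂, hδ₂, h2⟩ := exists_stable_immersion hf hf0 hinj
  have e1 : min (min δ₀ 1) (min δ₁ δ₂ / 2) ≤ min δ₁ δ₂ / 2 := min_le_right _ _
  have e2 := min_le_left δ₁ δ₂
  have e3 := min_le_right δ₁ δ₂
  refine ⟨min (min δ₀ 1) (min δ₁ δ₂ / 2), (min_le_left _ _).trans (min_le_left _ _), hf, hr0, hr1,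
    hrk, by positivity, (min_le_left _ _).trans (min_le_right _ _), hfD, hρ,
    fun z hz y hy => h1 z hz y (by linarith),
    fun g hg hgf => h2 r hr1 g hg fun z hz => by linarith [hgf z hz]⟩

theorem DiscStage.exists_succ (hn : 2 ≤ n) (h : IsConvexPotential D ρ G)
    {q : EuclideanSpace ℂ (Fin n)} (hqD : q ∈ D) {β : ℝ} (hβ : ρ q < β) {k : ℕ}
    {f : ℂ → EuclideanSpace ℂ (Fin n)} {r δ : ℝ} (hs : DiscStage D ρ β k f r δ) :
    ∃ g R δ', DiscStage D ρ β (k + 1) g R δ' ∧ δ' ≤ δ / 2 ∧ r ≤ R ∧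
      (∀ z, ‖z‖ ≤ r → ‖g z - f z‖ ≤ δ ∧ ‖deriv g z - deriv f z‖ ≤ δ) ∧
      (∀ z, r ≤ ‖z‖ → ‖z‖ ≤ 1 → β + k - 1 ≤ ρ (g z)) ∧ RadialLength g r R 2 := by
  have hball := isCompact_closedBall (0 : ℂ) 1
  have hmaps : ∀ g : ℂ → EuclideanSpace ℂ (Fin n), g ∈ polyMaps _ → (∀ z, ‖z‖ ≤ 1 → g z ∈ D) →
      ContinuousOn (fun z => ρ (g z)) (closedBall 0 1) := fun g hg hgD =>
    h.continuousOn.comp (differentiable_of_mem_polyMaps hg).continuous.continuousOn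
      fun z hz => hgD z (by simpa using hz)
  obtain ⟨M₀, hM₀⟩ := hball.exists_bound_of_continuousOn (hmaps f hs.mem_polyMaps hs.mem)
  set M := max (M₀ + 1) (β + k + 4) with hM
  have hδ := hs.pos
  have hk : (0 : ℝ) ≤ k := Nat.cast_nonneg k
  set η := min (min (δ / 2) (1 / 2)) (β - ρ q) with hη
  have hη0 : 0 < η := by have := sub_pos.2 hβ; positivity
  have hη1 : η ≤ δ / 2 := (min_le_left _ _).trans (min_le_left _ _)
  have hη2 : η ≤ 1 / 2 := (min_le_left _ _).trans (min_le_right _ _)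
  have hη3 : η ≤ β - ρ q := min_le_right _ _
  obtain ⟨g, hg, R, hrR, hR, hgD, hgc, hclose, hlen⟩ := h.exists_polyMaps_stage hn
    hs.mem_polyMaps (M := M) (fun z hz => ⟨hs.mem z hz, by
      have h1 := (le_abs_self _).trans (hM₀ z (by simpa using hz))
      have h2 := le_max_left (M₀ + 1) (β + k + 4)
      linarith⟩) hqD hs.radius_nonneg hs.radius_lt hη0
      (fun z hz => by linarith [hs.lt_potential z (hz ▸ hs.radius_lt.le) hz.le]) 3
  obtain ⟨g', hg', hclose', hgD', hreg, hinj⟩ := h.exists_regular_perturbation hn hg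
    (fun z hz => (hgD z hz).1) hη0
  have hgc' : ∀ ζ, ‖ζ‖ = 1 → ∀ᶠ z in 𝓝[closedBall (0 : ℂ) 1] ζ, β + (k + 1 : ℕ) < ρ (g' z) := by
    intro ζ hζ
    refine ((hmaps g' hg' fun z hz => (hgD' z hz).1) ζ
      (by simpa using hζ.le)).eventually_const_lt ?_
    have h1 := hgc ζ hζ
    have h2 := (abs_le.1 (hgD' ζ hζ.le).2).1
    have h3 := le_max_right (M₀ + 1) (β + k + 4)
    push_cast
    linarith
  have hk1 : 1 - 1 / (((k + 1 : ℕ) : ℝ) + 1) < 1 := by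
    have : 0 < 1 / (((k + 1 : ℕ) : ℝ) + 1) := by positivity
    linarith
  obtain ⟨R', hRR', hR', hcol⟩ := exists_collar hgc' _ (max_lt hR hk1)
  have hRR : R ≤ R' := (le_max_left _ _).trans hRR'
  obtain ⟨δ', hδ', hs'⟩ := h.exists_discStage hg' (fun z hz => (hgD' z hz).1) hreg hinj
    (hs.radius_nonneg.trans (hrR.trans hRR)) hR' ((le_max_right _ _).trans hRR') hcol (half_pos hδ)
  refine ⟨g', R', δ', hs', hδ', hrR.trans hRR, fun z hz => ?_, fun z hz hz' => ?_, ?_⟩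
  · obtain ⟨h1, h2⟩ := hclose z hz
    obtain ⟨h3, h4⟩ := hclose' z (hz.trans hs.radius_lt.le)
    have h5 := norm_sub_le_norm_sub_add_norm_sub (g' z) (g z) (f z)
    have h6 := norm_sub_le_norm_sub_add_norm_sub (deriv g' z) (deriv g z) (deriv f z)
    exact ⟨by linarith, by linarith⟩
  · have h1 := (abs_le.1 (hgD' z hz').2).1
    have h2 := (hgD z hz').2.1
    have h3 := hs.lt_potential z hz hz'
    linarith
  · refine ((hlen.of_norm_deriv_sub_le hη0.le
      fun z hz => (hclose' z (hz.trans hR.le)).2).mono ?_).extend hRR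
    have : η * (R - r) ≤ η := mul_le_of_le_one_right hη0.le (by linarith [hs.radius_nonneg])
    linarith

theorem IsConvexPotential.exists_lt (hn : 2 ≤ n) (h : IsConvexPotential D ρ G) (hDo : IsOpen D)
    (hne : D.Nonempty) : ∃ x ∈ D, ∃ y ∈ D, ρ x < ρ y := by
  obtain ⟨x, hx⟩ := hne
  obtain ⟨c, hc, hcD⟩ := Metric.isOpen_iff.1 hDo x hx
  have : Nonempty (Fin n) := ⟨⟨0, by omega⟩⟩
  obtain ⟨u, hu⟩ := exists_norm_eq (EuclideanSpace ℂ (Fin n)) (half_pos hc).le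
  have key : ∀ v : EuclideanSpace ℂ (Fin n), ‖v‖ = c / 2 → 0 ≤ inner ℝ (G x) v →
      ∃ y ∈ D, ρ x < ρ y := fun v hv hv0 => by
    have hvD : x + v ∈ D := hcD (by simp [hv, hc])
    refine ⟨x + v, hvD, ?_⟩
    have h1 := h.lower x hx _ hvD
    rw [add_sub_cancel_left, hv] at h1
    have : 0 < (c / 2) ^ 2 := by positivity
    linarith
  refine ⟨x, hx, ?_⟩
  rcases le_total 0 (inner ℝ (G x) u) with h0 | h0
  · exact key u hu h0
  · exact key (-u) (by rwa [norm_neg]) (by rw [inner_neg_right]; linarith)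

theorem IsConvexPotential.exists_discStage_seq (hn : 2 ≤ n) (h : IsConvexPotential D ρ G)
    (hDo : IsOpen D) (hne : D.Nonempty) :
    ∃ (β : ℝ) (f : ℕ → ℂ → EuclideanSpace ℂ (Fin n)) (r δ : ℕ → ℝ), ∀ k,
      DiscStage D ρ β k (f k) (r k) (δ k) ∧ δ (k + 1) ≤ δ k / 2 ∧ r k ≤ r (k + 1) ∧
      (∀ z, ‖z‖ ≤ r k → ‖f (k + 1) z - f k z‖ ≤ δ k ∧
        ‖deriv (f (k + 1)) z - deriv (f k) z‖ ≤ δ k) ∧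
      (∀ z, r k ≤ ‖z‖ → ‖z‖ ≤ 1 → β + k - 1 ≤ ρ (f (k + 1) z)) ∧
      RadialLength (f (k + 1)) (r k) (r (k + 1)) 2 := by
  obtain ⟨q, hq, q', hq', hqq⟩ := h.exists_lt hn hDo hne
  obtain ⟨β, hβ, hβ'⟩ := exists_between hqq
  obtain ⟨f, hf, -, hfD, hreg, hinj⟩ := h.exists_regular_perturbation hn
    (const_mem_polyMaps q') (fun _ _ => hq') (half_pos (sub_pos.2 hβ'))
  obtain ⟨δ, -, hs⟩ := h.exists_discStage (β := β) (k := 0) hf (fun z hz => (hfD z hz).1) hreg hinj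
    le_rfl one_pos (by simp) (fun z _ hz => by
      have := (abs_le.1 (hfD z hz).2).1
      push_cast
      linarith) one_pos
  let T : ℕ → Type := fun k => {p : (ℂ → EuclideanSpace ℂ (Fin n)) × ℝ × ℝ //
    DiscStage D ρ β k p.1 p.2.1 p.2.2}
  have hnext : ∀ k (p : T k), ∃ p' : T (k + 1), p'.1.2.2 ≤ p.1.2.2 / 2 ∧ p.1.2.1 ≤ p'.1.2.1 ∧
      (∀ z, ‖z‖ ≤ p.1.2.1 → ‖p'.1.1 z - p.1.1 z‖ ≤ p.1.2.2 ∧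
        ‖deriv p'.1.1 z - deriv p.1.1 z‖ ≤ p.1.2.2) ∧
      (∀ z, p.1.2.1 ≤ ‖z‖ → ‖z‖ ≤ 1 → β + k - 1 ≤ ρ (p'.1.1 z)) ∧
      RadialLength p'.1.1 p.1.2.1 p'.1.2.1 2 := fun k p => by
    obtain ⟨g, R, δ', h1, h2⟩ := p.2.exists_succ hn h hq hβ
    exact ⟨⟨(g, R, δ'), h1⟩, h2⟩
  choose next hnext using hnext
  let s : ∀ k, T k := fun k => Nat.rec ⟨(f, 0, δ), hs⟩ next k
  exact ⟨β, fun k => (s k).1.1, fun k => (s k).1.2.1, fun k => (s k).1.2.2,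
    fun k => ⟨(s k).2, hnext k (s k)⟩⟩

/-- A telescoping estimate for sequences whose increments are dominated by geometrically decreasing
bounds. -/
theorem norm_sub_le_two_mul_of_halving {E : Type*} [SeminormedAddCommGroup E] {u : ℕ → E}
    {δ : ℕ → ℝ} (hδ : ∀ k, 0 ≤ δ k) (hδ2 : ∀ k, δ (k + 1) ≤ δ k / 2) {k : ℕ}
    (hu : ∀ m, k ≤ m → ‖u (m + 1) - u m‖ ≤ δ m) {m : ℕ} (hm : k ≤ m) :
    ‖u m - u k‖ ≤ 2 * δ k := by
  have : ‖u m - u k‖ ≤ 2 * δ k - 2 * δ m := by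
    induction m, hm using Nat.le_induction with
    | base => simp
    | succ m hm ih =>
      have h1 := norm_sub_le_norm_sub_add_norm_sub (u (m + 1)) (u m) (u k)
      linarith [hu m hm, hδ2 m]
  linarith [hδ m]

end Stage

/-- Disc case of the Alarcón–López / Alarcón–Forstnerič theorem: every nonempty open convex
domain `D ⊆ ℂⁿ` (`n ≥ 2`) contains a complete properly immersed complex disc, which can be
chosen embedded when `n ≥ 3`. -/
theorem complete_proper_disc_in_convex_domain (n : ℕ) (hn : 2 ≤ n)
    (D : Set (EuclideanSpace ℂ (Fin n))) (hDo : IsOpen D) (hDc : Convex ℝ D)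
    (hDne : D.Nonempty) :
    ∃ φ : ℂ → EuclideanSpace ℂ (Fin n),
      DifferentiableOn ℂ φ (Metric.ball (0 : ℂ) 1) ∧
      (∀ ζ ∈ Metric.ball (0 : ℂ) 1, deriv φ ζ ≠ 0) ∧
      (∀ ζ ∈ Metric.ball (0 : ℂ) 1, φ ζ ∈ D) ∧
      (∀ K : Set (EuclideanSpace ℂ (Fin n)), K ⊆ D → IsCompact K →
        IsCompact {ζ ∈ Metric.ball (0 : ℂ) 1 | φ ζ ∈ K}) ∧
      (∀ γ : ℝ → ℂ, DivergentPathIn (Metric.ball (0 : ℂ) 1) γ →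
        eVariationOn (fun t => φ (γ t)) (Set.Ico 0 1) = ⊤) ∧
      (3 ≤ n → Set.InjOn φ (Metric.ball (0 : ℂ) 1)) := by
  obtain ⟨ρ, G, h⟩ := exists_isConvexPotential hDo hDc hDne
  obtain ⟨β, f, r, δ, hseq⟩ := h.exists_discStage_seq hn hDo hDne
  have hs := fun k => (hseq k).1
  have hδ2 := fun k => (hseq k).2.1
  have hδ0 := fun k => (hs k).pos.le
  have hrm : Monotone r := monotone_nat_of_le_succ fun k => (hseq k).2.2.1
  have hδlim : Tendsto δ atTop (𝓝 0) := by
    have hb : ∀ k, δ k ≤ (1 / 2) ^ k := fun k => by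
      induction k with
      | zero => simpa using (hs 0).le_one
      | succ k ih =>
        rw [pow_succ]
        linarith [hδ2 k]
    exact squeeze_zero hδ0 hb (tendsto_pow_atTop_nhds_zero_of_lt_one (by norm_num) (by norm_num))
  have hrlim : ∀ x < 1, ∃ k, x < r k := fun x hx => by
    obtain ⟨k, hk⟩ := exists_nat_one_div_lt (sub_pos.2 hx)
    exact ⟨k, by linarith [(hs k).le_radius]⟩
  have hfm : ∀ k m, k ≤ m → ∀ z, ‖z‖ ≤ r k → ‖f m z - f k z‖ ≤ 2 * δ k := fun k m hkm z hz =>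
    norm_sub_le_two_mul_of_halving hδ0 hδ2 (u := fun m => f m z)
      (fun m hm => ((hseq m).2.2.2.1 z (hz.trans (hrm hm))).1) hkm
  have hfm' : ∀ k m, k ≤ m → ∀ z, ‖z‖ ≤ r k → ‖deriv (f m) z - deriv (f k) z‖ ≤ 2 * δ k :=
    fun k m hkm z hz => norm_sub_le_two_mul_of_halving hδ0 hδ2 (u := fun m => deriv (f m) z)
      (fun m hm => ((hseq m).2.2.2.1 z (hz.trans (hrm hm))).2) hkm
  have hconv : ∀ z : ℂ, ∃ y, ‖z‖ < 1 → Tendsto (fun k => f k z) atTop (𝓝 y) := fun z => by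
    by_cases hz : ‖z‖ < 1
    · obtain ⟨k₀, hk₀⟩ := hrlim _ hz
      have hc : CauchySeq fun k => f (k + k₀) z :=
        cauchySeq_of_le_tendsto_0' (fun k => 2 * δ (k + k₀)) (fun k m hkm => by
          rw [dist_comm, dist_eq_norm]
          exact hfm _ _ (by omega) z (hk₀.le.trans (hrm (by omega))))
          (by simpa using ((tendsto_add_atTop_iff_nat k₀).2 hδlim).const_mul 2)
      obtain ⟨y, hy⟩ := cauchySeq_tendsto_of_complete hc
      exact ⟨y, fun _ => (tendsto_add_atTop_iff_nat k₀).1 hy⟩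
    · exact ⟨0, fun h => absurd h hz⟩
  choose φ hφ using hconv
  have hφf : ∀ k z, ‖z‖ ≤ r k → ‖φ z - f k z‖ ≤ 2 * δ k := fun k z hz =>
    le_of_tendsto ((hφ z (hz.trans_lt (hs k).radius_lt)).sub_const _).norm
      (eventually_atTop.2 ⟨k, fun m hm => hfm k m hm z hz⟩)
  have hunif : TendstoLocallyUniformlyOn f φ atTop (ball (0 : ℂ) 1) := by
    refine Metric.tendstoLocallyUniformlyOn_iff.2 fun ε hε x hx => ?_
    obtain ⟨k, hk⟩ := hrlim ‖x‖ (by simpa using hx)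
    refine ⟨ball 0 (r k), mem_nhdsWithin_of_mem_nhds (isOpen_ball.mem_nhds (by simpa using hk)), ?_⟩
    filter_upwards [(hδlim.const_mul 2).eventually_lt_const (by simpa using hε),
      eventually_ge_atTop k] with m hm hkm y hy
    have hy' : ‖y‖ < r k := by simpa using hy
    rw [dist_eq_norm]
    exact (hφf m y (hy'.le.trans (hrm hkm))).trans_lt hm
  have hfd : ∀ k, DifferentiableOn ℂ (f k) (ball 0 1) := fun k =>
    (differentiable_of_mem_polyMaps (hs k).mem_polyMaps).differentiableOn
  have hφd : DifferentiableOn ℂ φ (ball 0 1) :=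
    hunif.differentiableOn (Eventually.of_forall hfd) isOpen_ball
  have hderiv := hunif.deriv (Eventually.of_forall hfd) isOpen_ball
  have hφf' : ∀ k z, ‖z‖ ≤ r k → ‖deriv φ z - deriv (f k) z‖ ≤ 2 * δ k := fun k z hz =>
    le_of_tendsto ((hderiv.tendsto_at (show z ∈ ball (0 : ℂ) 1 by
      simpa using hz.trans_lt (hs k).radius_lt)).sub_const _).norm
      (eventually_atTop.2 ⟨k, fun m hm => hfm' k m hm z hz⟩)
  have hφD : ∀ z ∈ ball (0 : ℂ) 1, φ z ∈ D := fun z hz => by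
    have hz1 : ‖z‖ < 1 := by simpa using hz
    obtain ⟨k, hk⟩ := hrlim _ hz1
    exact ((hs k).tolerance z hz1.le _ (hφf k z hk.le)).1
  have hlow : ∀ k z, r k ≤ ‖z‖ → ‖z‖ < 1 → β + k - 2 ≤ ρ (φ z) := fun k z hkz hz1 => by
    have hex := hrlim _ hz1
    classical
    obtain ⟨j, hj⟩ : ∃ j, Nat.find hex = j + 1 := by
      refine Nat.exists_eq_succ_of_ne_zero fun h0 => ?_
      have h1 := Nat.find_spec hex
      rw [h0] at h1
      linarith [hrm (Nat.zero_le k)]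
    have h1 : ‖z‖ < r (j + 1) := hj ▸ Nat.find_spec hex
    have h2 : r j ≤ ‖z‖ := not_lt.1 (Nat.find_min hex (by omega))
    have hkj : k ≤ j := by
      by_contra hlt
      linarith [hrm (show j + 1 ≤ k by omega)]
    have h3 := (hseq j).2.2.2.2.1 z h2 hz1.le
    have h4 := (abs_le.1 ((hs (j + 1)).tolerance z hz1.le _ (hφf _ z h1.le)).2).1
    have h5 : (k : ℝ) ≤ j := by exact_mod_cast hkj
    linarith
  have hlen : ∀ k m, RadialLength φ (r k) (r (k + m)) m := fun k m => by
    induction m with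
    | zero => simpa using RadialLength.refl
    | succ m ih =>
      have hδ1 := (hs (k + m + 1)).le_one
      have hδp := (hs (k + m + 1)).pos
      have h1 := (hseq (k + m)).2.2.2.2.2.of_norm_deriv_sub_le (g := φ)
        (ε := 2 * δ (k + m + 1)) (by linarith) (fun z hz => hφf' _ z hz)
      have h2 : δ (k + m + 1) ≤ 1 / 2 := by linarith [hδ2 (k + m), (hs (k + m)).le_one]
      have h3 : 2 * δ (k + m + 1) * (r (k + m + 1) - r (k + m)) ≤ 2 * δ (k + m + 1) :=
        mul_le_of_le_one_right (by linarith)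
          (by linarith [(hs (k + m + 1)).radius_lt, (hs (k + m)).radius_nonneg])
      refine (ih.trans h1).mono ?_
      push_cast
      linarith
  refine ⟨φ, hφd, fun z hz => ?_, hφD, fun K hKD hK => ?_, fun γ hγ => ?_,
    fun h3 z hz w hw hzw => ?_⟩
  · obtain ⟨k, hk⟩ := hrlim ‖z‖ (by simpa using hz)
    exact ((hs k).regular φ hφd (hφf' k)).1 z hk.le
  · obtain ⟨B, hB⟩ := hK.exists_bound_of_continuousOn (h.continuousOn.mono hKD)
    obtain ⟨k, hk⟩ := exists_nat_gt (B + 2 - β)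
    have hrk := closedBall_subset_ball (x := (0 : ℂ)) (hs k).radius_lt
    have heq : {ζ ∈ ball (0 : ℂ) 1 | φ ζ ∈ K} = closedBall 0 (r k) ∩ φ ⁻¹' K := by
      ext z
      refine ⟨fun ⟨hz, hzK⟩ => ⟨?_, hzK⟩, fun ⟨hz, hzK⟩ => ⟨hrk hz, hzK⟩⟩
      by_contra hzk
      have h1 := hlow k z (by simpa using (not_le.1 fun h => hzk (by simpa using h)).le)
        (by simpa using hz)
      have h2 := (le_abs_self _).trans (hB _ hzK)
      linarith
    rw [heq]
    exact (isCompact_closedBall 0 (r k)).of_isClosed_subset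
      ((hφd.continuousOn.mono hrk).preimage_isClosed_of_isClosed isClosed_closedBall hK.isClosed)
      inter_subset_left
  · obtain ⟨hγc, hγm, hγd⟩ := hγ
    obtain ⟨k, hk⟩ := hrlim ‖γ 0‖ (by simpa using hγm 0 (by simp))
    by_contra htop
    obtain ⟨m, hm⟩ := ENNReal.exists_nat_gt htop
    obtain ⟨t, ht, htK⟩ := hγd (closedBall 0 (r (k + m)))
      (closedBall_subset_ball (hs (k + m)).radius_lt) (isCompact_closedBall 0 _)
    have hsub : Icc 0 t ⊆ Ico (0 : ℝ) 1 := fun x hx => ⟨hx.1, hx.2.trans_lt ht.2⟩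
    have h1 := (hlen k m).le_eVariationOn hφd ht.1 (hγc.mono hsub) (fun x hx => hγm x (hsub hx))
      hk.le (by simpa using (not_le.1 fun h => htK t ⟨le_rfl, ht.2⟩ (by simpa using h)).le)
    rw [ENNReal.ofReal_natCast] at h1
    exact absurd (h1.trans (eVariationOn.mono _ hsub)) (not_le.2 hm)
  · obtain ⟨k, hk⟩ := hrlim ‖z‖ (by simpa using hz)
    obtain ⟨l, hl⟩ := hrlim ‖w‖ (by simpa using hw)
    have hmz := hk.le.trans (hrm (le_max_left k l))
    have hmw := hl.le.trans (hrm (le_max_right k l))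
    exact ((hs (max k l)).regular φ hφd (hφf' _)).2 h3 (by simpa using hmz) (by simpa using hmw) hzw
end
end

section
/- Let n ≥ 2. There exists a continuous map φ : 𝔻̄ → ℂⁿ from the closed unit disc such that the restriction of φ to 𝔻 is a holomorphic immersion (φ'(ζ) ≠ 0 for every ζ ∈ 𝔻) which is complete (for every divergent path γ : [0,1) → 𝔻 the path φ ∘ γ has infinite length), and the restriction of φ to the unit circle b𝔻 = {|ζ| = 1} is injective. (Disc case of the theorem on complete bounded complex curves bounded by Jordan curves.) -/
open Set Metric
open scoped ENNReal

noncomputable section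

/-- `G - F` is `η`-Lipschitz on the closed disc of radius `s`. -/
def LipClose {E : Type*} [NormedAddCommGroup E] (η s : ℝ) (F G : ℂ → E) : Prop :=
  ∀ z w : ℂ, ‖z‖ ≤ s → ‖w‖ ≤ s → ‖(G z - F z) - (G w - F w)‖ ≤ η * ‖z - w‖

/-- `F` expands distances between `δ`-close points of the annulus `r ≤ ‖z‖ ≤ s` by at least
the factor `m`. -/
def LocallyExpands {E : Type*} [NormedAddCommGroup E] (F : ℂ → E) (r s m δ : ℝ) : Prop :=
  ∀ z w : ℂ, r ≤ ‖z‖ → ‖z‖ ≤ s → r ≤ ‖w‖ → ‖w‖ ≤ s → ‖z - w‖ < δ → m * ‖z - w‖ ≤ ‖F z - F w‖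

/-- Every map `G` that is `η`-Lipschitz close to `F` sends each path crossing from `‖z‖ ≤ r` to
`s ≤ ‖z‖` to a path of length at least `ℓ`. -/
def LongCrossing {E : Type*} [NormedAddCommGroup E] (F : ℂ → E) (r s ℓ η : ℝ) : Prop :=
  ∀ G : ℂ → E, LipClose η s F G → ∀ (γ : ℝ → ℂ) (a b : ℝ), a ≤ b →
    ContinuousOn γ (Icc a b) → ‖γ a‖ ≤ r → s ≤ ‖γ b‖ →
    ENNReal.ofReal ℓ ≤ eVariationOn (fun t => G (γ t)) (Icc a b)

section Crossing

variable {E : Type*} [NormedAddCommGroup E]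

lemma LipClose.mono {η η' s s' : ℝ} {F G : ℂ → E} (h : LipClose η s F G) (hη : η ≤ η')
    (hs : s' ≤ s) : LipClose η' s' F G := fun z w hz hw =>
  (h z w (hz.trans hs) (hw.trans hs)).trans (by gcongr)

lemma LipClose.trans {η η' s : ℝ} {F G H : ℂ → E} (h : LipClose η s F G)
    (h' : LipClose η' s G H) : LipClose (η + η') s F H := fun z w hz hw => by
  have h₁ := h z w hz hw
  have h₂ := h' z w hz hw
  calc ‖(H z - F z) - (H w - F w)‖
      = ‖((G z - F z) - (G w - F w)) + ((H z - G z) - (H w - G w))‖ := by congr 1; abel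
    _ ≤ _ := norm_add_le _ _
    _ ≤ (η + η') * ‖z - w‖ := by linarith

lemma LongCrossing.mono {F : ℂ → E} {r s ℓ η η' ℓ' : ℝ} (h : LongCrossing F r s ℓ η)
    (hη : η' ≤ η) (hℓ : ℓ' ≤ ℓ) : LongCrossing F r s ℓ' η' :=
  fun G hG γ a b hab hγ ha hb =>
    (ENNReal.ofReal_le_ofReal hℓ).trans (h G (hG.mono hη le_rfl) γ a b hab hγ ha hb)

lemma LongCrossing.of_lipClose {F F' : ℂ → E} {r s ℓ η η₁ : ℝ} (h : LongCrossing F r s ℓ η)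
    (hF : LipClose η₁ s F F') : LongCrossing F' r s ℓ (η - η₁) :=
  fun G hG γ a b hab hγ ha hb =>
    h G ((hF.trans hG).mono (by linarith) le_rfl) γ a b hab hγ ha hb

/-- Consecutive crossings add up. -/
lemma LongCrossing.append {F : ℂ → E} {r s r' s' ℓ ℓ' η : ℝ} (h : LongCrossing F r s ℓ η)
    (h' : LongCrossing F r' s' ℓ' η) (hr : r ≤ s) (hs : s ≤ r') (hs' : r' ≤ s') (hℓ : 0 ≤ ℓ)
    (hℓ' : 0 ≤ ℓ') : LongCrossing F r s' (ℓ + ℓ') η := by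
  intro G hG γ a b hab hγ ha hb
  obtain ⟨c, hc, hcs⟩ := intermediate_value_Icc hab hγ.norm
    (⟨ha.trans hr, (hs.trans hs').trans hb⟩ : s ∈ Icc ‖γ a‖ ‖γ b‖)
  have h₁ := h G (hG.mono le_rfl (hs.trans hs')) γ a c hc.1
    (hγ.mono (Icc_subset_Icc le_rfl hc.2)) ha hcs.ge
  have h₂ := h' G hG γ c b hc.2 (hγ.mono (Icc_subset_Icc hc.1 le_rfl)) (hcs.le.trans hs) hb
  have h₃ := eVariationOn.Icc_add_Icc (fun t => G (γ t)) (s := univ) hc.1 hc.2 (mem_univ c)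
  simp only [univ_inter] at h₃
  rw [← h₃, ENNReal.ofReal_add hℓ hℓ']
  exact add_le_add h₁ h₂

/-- A continuous path crossing an annulus contains a subpath that stays in the annulus. -/
lemma exists_crossing_subpath {γ : ℝ → ℂ} {a b r s : ℝ} (hab : a ≤ b)
    (hγ : ContinuousOn γ (Icc a b)) (hrs : r ≤ s) (ha : ‖γ a‖ ≤ r) (hb : s ≤ ‖γ b‖) :
    ∃ a' b', a ≤ a' ∧ a' ≤ b' ∧ b' ≤ b ∧ ‖γ a'‖ = r ∧ ‖γ b'‖ = s ∧
      ∀ t ∈ Icc a' b', r ≤ ‖γ t‖ ∧ ‖γ t‖ ≤ s := by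
  have hn : ContinuousOn (fun t => ‖γ t‖) (Icc a b) := hγ.norm
  have hT : IsCompact (Icc a b ∩ (fun t => ‖γ t‖) ⁻¹' {s}) :=
    isCompact_Icc.of_isClosed_subset
      (hn.preimage_isClosed_of_isClosed isClosed_Icc isClosed_singleton) inter_subset_left
  obtain ⟨c, hc, hcs⟩ := intermediate_value_Icc hab hn ⟨ha.trans hrs, hb⟩
  obtain ⟨b', ⟨hb', hbs⟩, hmin⟩ := hT.exists_isLeast ⟨c, hc, hcs⟩
  have hle : ∀ t ∈ Icc a b', ‖γ t‖ ≤ s := by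
    intro t ht
    by_contra! hlt
    obtain ⟨u, hu, hus⟩ := intermediate_value_Icc ht.1
      (hn.mono (Icc_subset_Icc le_rfl (ht.2.trans hb'.2))) ⟨ha.trans hrs, hlt.le⟩
    have : b' ≤ u := hmin ⟨⟨hu.1, hu.2.trans (ht.2.trans hb'.2)⟩, hus⟩
    have htu : t = u := le_antisymm (ht.2.trans this) hu.2
    subst htu
    exact hlt.ne' hus
  have hn' : ContinuousOn (fun t => ‖γ t‖) (Icc a b') := hn.mono (Icc_subset_Icc le_rfl hb'.2)
  have hT' : IsCompact (Icc a b' ∩ (fun t => ‖γ t‖) ⁻¹' {r}) :=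
    isCompact_Icc.of_isClosed_subset
      (hn'.preimage_isClosed_of_isClosed isClosed_Icc isClosed_singleton) inter_subset_left
  obtain ⟨d, hd, hdr⟩ := intermediate_value_Icc hb'.1 hn'
    ⟨ha, hrs.trans (show s ≤ ‖γ b'‖ from (show ‖γ b'‖ = s from hbs).ge)⟩
  obtain ⟨a', ⟨ha', har⟩, hmax⟩ := hT'.exists_isGreatest ⟨d, hd, hdr⟩
  refine ⟨a', b', ha'.1, ha'.2, hb'.2, har, hbs, fun t ht => ⟨?_, hle t ⟨ha'.1.trans ht.1, ht.2⟩⟩⟩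
  by_contra! hlt
  obtain ⟨u, hu, hur⟩ := intermediate_value_Icc ht.2
    (hn'.mono (Icc_subset_Icc (ha'.1.trans ht.1) le_rfl))
    ⟨hlt.le, hrs.trans (show s ≤ ‖γ b'‖ from (show ‖γ b'‖ = s from hbs).ge)⟩
  have : u ≤ a' := hmax ⟨⟨(ha'.1.trans ht.1).trans hu.1, hu.2⟩, hur⟩
  have htu : t = u := le_antisymm hu.1 (this.trans ht.1)
  subst htu
  exact hlt.ne hur

lemma LocallyExpands.of_lipClose {F G : ℂ → E} {r s m δ η : ℝ} (h : LocallyExpands F r s m δ)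
    (hG : LipClose η s F G) : LocallyExpands G r s (m - η) δ := by
  intro z w hz hz' hw hw' hzw
  have h₁ := h z w hz hz' hw hw' hzw
  have h₂ := hG z w hz' hw'
  have h₃ : ‖F z - F w‖ ≤ ‖G z - G w‖ + ‖(G z - F z) - (G w - F w)‖ := by
    calc ‖F z - F w‖ = ‖(G z - G w) - ((G z - F z) - (G w - F w))‖ := by congr 1; abel
      _ ≤ _ := norm_sub_le _ _
  linarith

lemma LocallyExpands.le_eVariationOn {G : ℂ → E} {r s m δ : ℝ} (h : LocallyExpands G r s m δ)
    (hm : 0 ≤ m) (hδ : 0 < δ) (hrs : r ≤ s) {γ : ℝ → ℂ} {a b : ℝ} (hab : a ≤ b)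
    (hγ : ContinuousOn γ (Icc a b)) (ha : ‖γ a‖ ≤ r) (hb : s ≤ ‖γ b‖) :
    ENNReal.ofReal (m * (s - r)) ≤ eVariationOn (fun t => G (γ t)) (Icc a b) := by
  obtain ⟨a', b', haa, hab', hbb, har, hbs, hmem⟩ := exists_crossing_subpath hab hγ hrs ha hb
  refine le_trans ?_ (eVariationOn.mono _ (Icc_subset_Icc haa hbb))
  have hγ' : ContinuousOn γ (Icc a' b') := hγ.mono (Icc_subset_Icc haa hbb)
  obtain ⟨ε, hε, hu⟩ := Metric.uniformContinuousOn_iff.1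
    (isCompact_Icc.uniformContinuousOn_of_continuous hγ') δ hδ
  obtain ⟨n, hn⟩ := exists_nat_gt ((b' - a') / ε)
  have hn0 : (0 : ℝ) < n := lt_of_le_of_lt (div_nonneg (by linarith) hε.le) hn
  have hstep : (b' - a') / n < ε := by
    rw [div_lt_iff₀ hε] at hn
    rw [div_lt_iff₀ hn0]
    linarith
  have hd0 : 0 ≤ (b' - a') / n := div_nonneg (by linarith) hn0.le
  set u : ℕ → ℝ := fun i => a' + i * ((b' - a') / n) with hu_def
  have humono : Monotone u := fun i j hij => by
    simp only [hu_def]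
    gcongr
  have hun : u n = b' := by simp only [hu_def]; field_simp; ring
  have hu0 : u 0 = a' := by simp [hu_def]
  have hmemu : ∀ i ≤ n, u i ∈ Icc a' b' := fun i hi =>
    ⟨hu0 ▸ humono (Nat.zero_le i), hun ▸ humono hi⟩
  refine le_trans ?_ (eVariationOn.sum_le_of_monotoneOn_Iic (n := n) (humono.monotoneOn _) hmemu)
  have hterm : ∀ i ∈ Finset.range n, ENNReal.ofReal (m * ‖γ (u (i + 1)) - γ (u i)‖) ≤
      edist (G (γ (u (i + 1)))) (G (γ (u i))) := by
    intro i hi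
    have hi' := Finset.mem_range.1 hi
    have h₁ := hmemu i hi'.le
    have h₂ := hmemu (i + 1) hi'
    rw [edist_dist, dist_eq_norm]
    refine ENNReal.ofReal_le_ofReal (h _ _ (hmem _ h₂).1 (hmem _ h₂).2 (hmem _ h₁).1 (hmem _ h₁).2 ?_)
    rw [← dist_eq_norm]
    refine hu _ h₂ _ h₁ ?_
    have : u (i + 1) - u i = (b' - a') / n := by simp only [hu_def]; push_cast; ring
    rw [Real.dist_eq, this, abs_of_nonneg hd0]
    exact hstep
  refine le_trans ?_ (Finset.sum_le_sum hterm)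
  rw [← ENNReal.ofReal_sum_of_nonneg (fun i _ => by positivity), ← Finset.mul_sum]
  refine ENNReal.ofReal_le_ofReal (mul_le_mul_of_nonneg_left ?_ hm)
  calc s - r = ‖γ (u n)‖ - ‖γ (u 0)‖ := by rw [hun, hu0, har, hbs]
    _ ≤ ‖γ (u n) - γ (u 0)‖ := norm_sub_norm_le _ _
    _ = ‖∑ i ∈ Finset.range n, (γ (u (i + 1)) - γ (u i))‖ := by
        rw [Finset.sum_range_sub (fun i => γ (u i))]
    _ ≤ _ := norm_sum_le _ _

lemma LocallyExpands.longCrossing {F : ℂ → E} {r s m δ : ℝ} (h : LocallyExpands F r s m δ)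
    (hm : 0 ≤ m) (hδ : 0 < δ) (hrs : r ≤ s) : LongCrossing F r s (m / 2 * (s - r)) (m / 2) := by
  intro G hG γ a b hab hγ ha hb
  have := h.of_lipClose hG
  rw [sub_half] at this
  exact this.le_eVariationOn (by linarith) hδ hrs hab hγ ha hb

/-- A `C¹` map whose derivative is bounded below on a compact annulus is locally expanding there. -/
lemma exists_locallyExpands [NormedSpace ℂ E] {F : ℂ → E} (hF : ContDiff ℂ 1 F) {r s m : ℝ}
    (hm : ∀ z : ℂ, r ≤ ‖z‖ → ‖z‖ ≤ s → m < ‖deriv F z‖) :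
    ∃ δ > 0, LocallyExpands F r s m δ := by
  set K : Set ℂ := {z | r ≤ ‖z‖} ∩ closedBall 0 s with hK
  have hKc : IsCompact K := (isCompact_closedBall 0 s).inter_left
    (isClosed_le continuous_const continuous_norm)
  have hloc : ∀ x ∈ K, ∃ ε > 0, ∀ z ∈ ball x ε, ∀ w ∈ ball x ε, m * ‖z - w‖ ≤ ‖F z - F w‖ := by
    intro x hx
    have hx' := hm x hx.1 (by simpa using hx.2)
    have hs := (hF.contDiffAt (x := x)).hasStrictDerivAt one_ne_zero
    have hlit := hs.isLittleO.bound (sub_pos.2 hx')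
    rw [nhds_prod_eq] at hlit
    obtain ⟨ε, hε, hb⟩ := (Metric.nhds_basis_ball.prod_self.eventually_iff).1 hlit
    refine ⟨ε, hε, fun z hz w hw => ?_⟩
    have h₁ := hb (Set.mk_mem_prod hz hw)
    simp only at h₁
    have h₂ : ‖(z - w) • deriv F x‖ ≤ ‖F z - F w‖ + ‖F z - F w - (z - w) • deriv F x‖ := by
      calc ‖(z - w) • deriv F x‖ = ‖(F z - F w) - (F z - F w - (z - w) • deriv F x)‖ := by
            congr 1; abel
        _ ≤ _ := norm_sub_le _ _
    rw [norm_smul] at h₂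
    simp only [ContinuousLinearMap.toSpanSingleton_apply] at h₁
    nlinarith
  choose! ε hε hb using hloc
  obtain ⟨δ, hδ, hL⟩ := lebesgue_number_lemma_of_metric (s := K) (ι := K)
    (c := fun x => ball (x : ℂ) (ε x)) hKc (fun _ => isOpen_ball)
    (fun x hx => mem_iUnion.2 ⟨⟨x, hx⟩, mem_ball_self (hε x hx)⟩)
  refine ⟨δ, hδ, fun z w hz hz' hw hw' hzw => ?_⟩
  obtain ⟨x, hx⟩ := hL z ⟨hz, by simpa using hz'⟩
  exact hb x x.2 z (hx (mem_ball_self hδ)) w (hx (by rwa [mem_ball', dist_eq_norm]))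

lemma LocallyExpands.deriv_ne_zero [NormedSpace ℂ E] {G : ℂ → E} {r s m δ : ℝ}
    (h : LocallyExpands G r s m δ) (hm : 0 < m) (hδ : 0 < δ) (hr : r ≤ 0) {z : ℂ} (hz : ‖z‖ < s)
    (hG : DifferentiableAt ℂ G z) : deriv G z ≠ 0 := by
  intro h0
  have hd := hG.hasDerivAt
  rw [h0, hasDerivAt_iff_isLittleO] at hd
  have hb := hd.bound (half_pos hm)
  have hball : ∀ᶠ w in nhds z, ‖w‖ < s := continuous_norm.continuousAt.eventually_lt_const hz
  have hnear : ∀ᶠ w in nhds z, ‖w - z‖ < δ := by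
    filter_upwards [ball_mem_nhds z hδ] with w hw
    rwa [mem_ball, dist_eq_norm] at hw
  have hev : ∀ᶠ w in nhds z, w = z := by
    filter_upwards [hb, hball, hnear] with w h₁ h₂ h₃
    have h₄ := h w z (hr.trans (norm_nonneg _)) h₂.le (hr.trans (norm_nonneg _)) hz.le h₃
    simp only [smul_zero, sub_zero] at h₁
    have : ‖w - z‖ ≤ 0 := by nlinarith
    exact sub_eq_zero.1 (norm_le_zero_iff.1 this)
  have : ∀ᶠ w in nhdsWithin z {z}ᶜ, w = z := hev.filter_mono nhdsWithin_le_nhds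
  obtain ⟨w, hw, hw'⟩ := (this.and self_mem_nhdsWithin).exists
  exact hw' hw

end Crossing

open Polynomial in
/-- The map `ℂ → ℂ × ℂ` defined by a pair of polynomials. -/
def polyMap (P : ℂ[X] × ℂ[X]) (z : ℂ) : ℂ × ℂ := (P.1.eval z, P.2.eval z)

section PolyMap

open Polynomial

lemma polyMap_add (P Q : ℂ[X] × ℂ[X]) (z : ℂ) :
    polyMap (P + Q) z = polyMap P z + polyMap Q z := by
  simp [polyMap]

lemma polyMap_smul (p : ℂ[X]) (P : ℂ[X] × ℂ[X]) (z : ℂ) :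
    polyMap (p • P) z = p.eval z • polyMap P z := by
  simp [polyMap]

lemma contDiff_polyMap (P : ℂ[X] × ℂ[X]) {n : WithTop ℕ∞} : ContDiff ℂ n (polyMap P) :=
  (P.1.contDiff_aeval n).prodMk (P.2.contDiff_aeval n)

lemma continuous_polyMap (P : ℂ[X] × ℂ[X]) : Continuous (polyMap P) :=
  (contDiff_polyMap P (n := 0)).continuous

lemma hasDerivAt_polyMap (P : ℂ[X] × ℂ[X]) (z : ℂ) :
    HasDerivAt (polyMap P) (polyMap (derivative P.1, derivative P.2) z) z :=
  (P.1.hasDerivAt z).prodMk (P.2.hasDerivAt z)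

lemma exists_norm_polyMap_le (P : ℂ[X] × ℂ[X]) :
    ∃ B > 0, ∀ z : ℂ, ‖z‖ ≤ 1 → ‖polyMap P z‖ ≤ B := by
  obtain ⟨B, hB⟩ := (isCompact_closedBall (0 : ℂ) 1).exists_bound_of_continuousOn
    (continuous_polyMap P).continuousOn
  exact ⟨max B 1, by positivity, fun z hz => (hB z (by simpa using hz)).trans (le_max_left _ _)⟩

lemma norm_polyMap_sub_le {P : ℂ[X] × ℂ[X]} {s B : ℝ}
    (hB : ∀ z : ℂ, ‖z‖ ≤ s → ‖polyMap (derivative P.1, derivative P.2) z‖ ≤ B) {z w : ℂ}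
    (hz : ‖z‖ ≤ s) (hw : ‖w‖ ≤ s) : ‖polyMap P z - polyMap P w‖ ≤ B * ‖z - w‖ := by
  refine (convex_closedBall (0 : ℂ) s).norm_image_sub_le_of_norm_deriv_le (𝕜 := ℂ)
    (fun x _ => (hasDerivAt_polyMap P x).differentiableAt) (fun x hx => ?_)
    (by simpa using hw) (by simpa using hz)
  rw [(hasDerivAt_polyMap P x).deriv]
  exact hB x (by simpa using hx)

lemma norm_polyMap_le_of_sphere {P : ℂ[X] × ℂ[X]} {C : ℝ}
    (h : ∀ z : ℂ, ‖z‖ = 1 → ‖polyMap P z‖ ≤ C) {z : ℂ} (hz : ‖z‖ ≤ 1) : ‖polyMap P z‖ ≤ C := by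
  refine Complex.norm_le_of_forall_mem_frontier_norm_le (U := ball (0 : ℂ) 1) isBounded_ball
    ((contDiff_polyMap P (n := 1)).differentiable one_ne_zero).diffContOnCl (fun w hw => ?_) ?_
  · rw [frontier_ball _ one_ne_zero] at hw
    exact h w (by simpa using hw)
  · rw [closure_ball _ one_ne_zero]
    simpa using hz

/-- Divided differences of polynomials are smooth functions of two variables. -/
lemma exists_divided_difference (p : ℂ[X]) :
    ∃ D : ℂ × ℂ → ℂ, ContDiff ℂ 1 D ∧ ∀ z w, p.eval z - p.eval w = (z - w) * D (z, w) := by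
  induction p using Polynomial.induction_on' with
  | add p q hp hq =>
    obtain ⟨D, hD, h⟩ := hp
    obtain ⟨D', hD', h'⟩ := hq
    refine ⟨D + D', hD.add hD', fun z w => ?_⟩
    simp only [eval_add, Pi.add_apply, mul_add, ← h, ← h']
    ring
  | monomial n a =>
    refine ⟨fun x => a * ∑ i ∈ Finset.range n, x.1 ^ i * x.2 ^ (n - 1 - i), ?_, fun z w => ?_⟩
    · exact contDiff_const.mul (ContDiff.sum fun i _ =>
        (contDiff_fst.pow _).mul (contDiff_snd.pow _))
    · have := geom_sum₂_mul z w n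
      simp only [eval_monomial]
      linear_combination -a * this

/-- A generic small linear perturbation of a polynomial map is an immersion, injective on the
unit circle. -/
lemma exists_generic_perturbation (P : ℂ[X] × ℂ[X]) {ε : ℝ} (hε : 0 < ε) :
    ∃ c : ℂ × ℂ, ‖c‖ < ε ∧ (∀ z, deriv (polyMap (P + (C c.1 * X, C c.2 * X))) z ≠ 0) ∧
      InjOn (polyMap (P + (C c.1 * X, C c.2 * X))) (sphere 0 1) := by
  obtain ⟨D₁, hD₁, h₁⟩ := exists_divided_difference P.1
  obtain ⟨D₂, hD₂, h₂⟩ := exists_divided_difference P.2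
  set e : ℝ × ℝ → ℂ × ℂ := fun x => (Complex.exp (x.1 * Complex.I), Complex.exp (x.2 * Complex.I))
  have he : ContDiff ℝ 1 e :=
    ((Complex.ofRealCLM.contDiff.comp contDiff_fst).mul contDiff_const).cexp.prodMk
      ((Complex.ofRealCLM.contDiff.comp contDiff_snd).mul contDiff_const).cexp
  set T : ℝ × ℝ → ℂ × ℂ := fun x => -(D₁ (e x), D₂ (e x))
  have hT : ContDiff ℝ 1 T :=
    (((hD₁.restrict_scalars ℝ).comp he).prodMk ((hD₂.restrict_scalars ℝ).comp he)).neg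
  set V : ℂ → ℂ × ℂ := fun z => -polyMap (derivative P.1, derivative P.2) z
  have hV : ContDiff ℝ 1 V := ((contDiff_polyMap _).restrict_scalars ℝ).neg
  have hdim : dimH (range T ∪ range V) < Module.finrank ℝ (ℂ × ℂ) := by
    rw [dimH_union]
    refine (max_le ?_ ?_).trans_lt (b := ((2 : ℕ) : ℝ≥0∞)) ?_
    · simpa using hT.dimH_range_le
    · simpa [Complex.finrank_real_complex] using hV.dimH_range_le
    · simp [Complex.finrank_real_complex]
      norm_num
  obtain ⟨c, hc, hcε⟩ := (dense_compl_of_dimH_lt_finrank hdim).exists_dist_lt 0 hε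
  rw [dist_comm, dist_zero_right] at hcε
  simp only [mem_compl_iff, mem_union, mem_range, not_or, not_exists] at hc
  refine ⟨c, hcε, fun z h => ?_, fun z hz w hw hzw => ?_⟩
  · rw [(hasDerivAt_polyMap _ z).deriv] at h
    refine hc.2 z (neg_eq_of_add_eq_zero_right ?_)
    rw [← h]
    simp [polyMap, Prod.ext_iff]
  · by_contra hne
    have hexp : ∀ u ∈ sphere (0 : ℂ) 1, ∃ t : ℝ, Complex.exp (t * Complex.I) = u := by
      intro u hu
      have := Complex.norm_mul_exp_arg_mul_I u
      rw [mem_sphere_zero_iff_norm.1 hu, Complex.ofReal_one, one_mul] at this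
      exact ⟨_, this⟩
    obtain ⟨s, rfl⟩ := hexp z hz
    obtain ⟨t, rfl⟩ := hexp w hw
    refine hc.1 (s, t) (neg_eq_of_add_eq_zero_right ?_)
    have hsub := sub_ne_zero.2 hne
    simp only [polyMap, Prod.ext_iff, Prod.fst_add, Prod.snd_add, eval_add, eval_mul, eval_C,
      eval_X] at hzw
    ext
    · refine (mul_eq_zero.1 ?_).resolve_left hsub
      have := h₁ (Complex.exp (s * Complex.I)) (Complex.exp (t * Complex.I))
      simp only [e, Prod.fst_add]
      linear_combination hzw.1 - this
    · refine (mul_eq_zero.1 ?_).resolve_left hsub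
      have := h₂ (Complex.exp (s * Complex.I)) (Complex.exp (t * Complex.I))
      simp only [e, Prod.snd_add]
      linear_combination hzw.2 - this

lemma eval_reflect_conj (p : ℂ[X]) {d : ℕ} (hd : p.natDegree ≤ d) {z : ℂ} (hz : ‖z‖ = 1) :
    (reflect d (p.map (starRingEnd ℂ))).eval z = z ^ d * starRingEnd ℂ (p.eval z) := by
  have hz0 : z ≠ 0 := norm_ne_zero_iff.1 (by rw [hz]; exact one_ne_zero)
  have hinv : z⁻¹ = starRingEnd ℂ z := Complex.inv_eq_conj hz
  let _ : Invertible z⁻¹ := invertibleOfNonzero (inv_ne_zero hz0)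
  have h := eval₂_reflect_mul_pow (RingHom.id ℂ) z⁻¹ d (p.map (starRingEnd ℂ))
    (natDegree_map_le.trans hd)
  rw [invOf_eq_inv, inv_inv] at h
  rw [eval₂_id, eval₂_id, hinv, eval_map, eval₂_hom, ← hinv] at h
  rw [← h, mul_left_comm, ← mul_pow, mul_inv_cancel₀ hz0, one_pow, mul_one]

/-- The polynomial partner of `P`: on the unit circle it is a unimodular multiple of the
conjugate-orthogonal vector. -/
lemma exists_conj_partner (P : ℂ[X] × ℂ[X]) :
    ∃ (Q : ℂ[X] × ℂ[X]) (d : ℕ), ∀ z : ℂ, ‖z‖ = 1 →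
      polyMap Q z = (-(z ^ d * starRingEnd ℂ (P.2.eval z)), z ^ d * starRingEnd ℂ (P.1.eval z)) := by
  set d := max P.1.natDegree P.2.natDegree
  refine ⟨(-reflect d (P.2.map (starRingEnd ℂ)), reflect d (P.1.map (starRingEnd ℂ))), d,
    fun z hz => ?_⟩
  rw [polyMap, eval_neg, eval_reflect_conj P.1 (le_max_left _ _) hz,
    eval_reflect_conj P.2 (le_max_right _ _) hz]

lemma sq_norm_add_sq_norm_partner {f g u : ℂ} {a : ℝ} (hu : ‖u‖ = 1) :
    ‖f + a * (-(u * starRingEnd ℂ g))‖ ^ 2 + ‖g + a * (u * starRingEnd ℂ f)‖ ^ 2 =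
      (‖f‖ ^ 2 + ‖g‖ ^ 2) * (1 + a ^ 2) := by
  have hu' : u.re * u.re + u.im * u.im = 1 := by
    rw [← Complex.normSq_apply, Complex.normSq_eq_norm_sq, hu, one_pow]
  simp only [← Complex.normSq_eq_norm_sq, Complex.normSq_apply, Complex.add_re, Complex.add_im,
    Complex.mul_re, Complex.mul_im, Complex.neg_re, Complex.neg_im, Complex.conj_re,
    Complex.conj_im, Complex.ofReal_re, Complex.ofReal_im]
  linear_combination (a ^ 2 * (f.re ^ 2 + f.im ^ 2 + g.re ^ 2 + g.im ^ 2)) * hu'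

end PolyMap

section Oscillation

open Polynomial Filter

lemma lipClose_polyMap_add {P R : ℂ[X] × ℂ[X]} {s η : ℝ}
    (h : ∀ z : ℂ, ‖z‖ ≤ s → ‖polyMap (derivative R.1, derivative R.2) z‖ ≤ η) :
    LipClose η s (polyMap P) (polyMap (P + R)) := fun z w hz hw => by
  simpa [polyMap_add] using norm_polyMap_sub_le h hz hw

lemma polyMap_derivative_mul_X_pow (Q : ℂ[X] × ℂ[X]) (a : ℂ) (n : ℕ) (z : ℂ) :
    polyMap (derivative ((C a * X ^ (n + 1)) • Q).1, derivative ((C a * X ^ (n + 1)) • Q).2) z =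
      (a * ((n + 1) * z ^ n)) • polyMap Q z +
        (a * z ^ (n + 1)) • polyMap (derivative Q.1, derivative Q.2) z := by
  ext <;> simp [polyMap]

/-- High-frequency terms have small derivative on compact subsets of the open disc. -/
lemma eventually_norm_derivative_mul_X_pow_le (Q : ℂ[X] × ℂ[X]) {a : ℝ} (ha : 0 ≤ a) {s η : ℝ}
    (hs0 : 0 ≤ s) (hs : s < 1) (hη : 0 < η) : ∀ᶠ n : ℕ in atTop, ∀ z : ℂ, ‖z‖ ≤ s →
      ‖polyMap (derivative ((C (a : ℂ) * X ^ (n + 1)) • Q).1,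
        derivative ((C (a : ℂ) * X ^ (n + 1)) • Q).2) z‖ ≤ η := by
  obtain ⟨B, hB, hQ⟩ := exists_norm_polyMap_le Q
  obtain ⟨B', hB', hQ'⟩ := exists_norm_polyMap_le (derivative Q.1, derivative Q.2)
  have h₁ := tendsto_self_mul_const_pow_of_lt_one hs0 hs
  have h₂ := tendsto_pow_atTop_nhds_zero_of_lt_one hs0 hs
  have h₃ : Tendsto (fun n : ℕ => a * (n * s ^ n + s ^ n) * B + a * (s ^ n * s) * B') atTop
      (nhds 0) := by
    have := (((h₁.add h₂).const_mul a).mul_const B).add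
      (((h₂.mul_const s).const_mul a).mul_const B')
    simpa using this
  filter_upwards [h₃.eventually_le_const hη] with n hn z hz
  rw [polyMap_derivative_mul_X_pow]
  refine le_trans ?_ hn
  refine (norm_add_le _ _).trans (add_le_add ?_ ?_)
  · rw [norm_smul]
    refine mul_le_mul ?_ (hQ z (hz.trans hs.le)) (norm_nonneg _) (by positivity)
    have : ‖(n : ℂ) + 1‖ = n + 1 := by exact_mod_cast Complex.norm_natCast (n + 1)
    rw [norm_mul, norm_mul, this, Complex.norm_real, norm_pow, Real.norm_of_nonneg ha,
      ← add_one_mul]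
    gcongr
  · rw [norm_smul]
    refine mul_le_mul ?_ (hQ' z (hz.trans hs.le)) (norm_nonneg _) (by positivity)
    rw [norm_mul, Complex.norm_real, norm_pow, Real.norm_of_nonneg ha, ← pow_succ]
    gcongr

/-- Near the unit circle a high-frequency term dominates the derivative. -/
lemma eventually_lt_norm_deriv (P Q : ℂ[X] × ℂ[X]) {a δ : ℝ} (ha : 0 < a) (hδ : 0 < δ)
    (hQ : ∀ z : ℂ, ‖z‖ = 1 → 5 / 8 * δ ≤ ‖polyMap Q z‖) :
    ∀ᶠ n : ℕ in atTop, ∀ z : ℂ, 1 - 1 / (2 * (n + 1)) ≤ ‖z‖ → ‖z‖ ≤ 1 →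
      a * δ * (n + 1) / 8 < ‖deriv (polyMap (P + (C (a : ℂ) * X ^ (n + 1)) • Q)) z‖ := by
  obtain ⟨B, hB, hPB⟩ := exists_norm_polyMap_le (derivative P.1, derivative P.2)
  obtain ⟨L, hL, hQL⟩ := exists_norm_polyMap_le (derivative Q.1, derivative Q.2)
  have hlarge : Tendsto (fun n : ℕ => ((n : ℝ) + 1)) atTop atTop :=
    tendsto_atTop_add_const_right _ _ tendsto_natCast_atTop_atTop
  filter_upwards [hlarge.eventually_gt_atTop (4 * L / δ),
    hlarge.eventually_gt_atTop (8 * (B + a * L) / (a * δ))] with n hn₁ hn₂ z hz hz1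
  set N : ℝ := (n : ℝ) + 1
  have hN : 1 ≤ N := by simp [N]
  rw [div_lt_iff₀ hδ] at hn₁
  rw [div_lt_iff₀ (by positivity)] at hn₂
  have hinv : 1 / (2 * N) ≤ 1 / 2 := by
    rw [div_le_div_iff₀ (by positivity) (by norm_num)]
    linarith
  have hz0 : 0 < ‖z‖ := by linarith
  have hzne : (‖z‖ : ℂ) ≠ 0 := by exact_mod_cast hz0.ne'
  have hu : ‖z / ‖z‖‖ = 1 := by
    rw [norm_div, Complex.norm_real, norm_norm, div_self hz0.ne']
  have huz : ‖z / ‖z‖ - z‖ = 1 - ‖z‖ := by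
    have : z / ‖z‖ - z = z / ‖z‖ * ((1 - ‖z‖ : ℝ) : ℂ) := by
      push_cast
      field_simp
    rw [this, norm_mul, hu, one_mul, Complex.norm_real, Real.norm_of_nonneg (by linarith)]
  have hQz : δ / 2 ≤ ‖polyMap Q z‖ := by
    have h₁ := norm_polyMap_sub_le hQL hu.le hz1
    rw [huz] at h₁
    have h₂ := norm_sub_norm_le (polyMap Q (z / ‖z‖)) (polyMap Q z)
    have h₃ := hQ _ hu
    have h₄ : L * (1 - ‖z‖) ≤ L * (1 / (2 * N)) := by
      refine mul_le_mul_of_nonneg_left (by linarith) hL.le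
    have h₅ : L * (1 / (2 * N)) ≤ δ / 8 := by
      rw [mul_one_div, div_le_iff₀ (by positivity)]
      linarith
    linarith
  have hpow : 1 / 2 ≤ ‖z‖ ^ n := by
    have h₁ := one_add_mul_le_pow (a := ‖z‖ - 1) (by linarith) (n + 1)
    have h₂ : ‖z‖ ^ (n + 1) ≤ ‖z‖ ^ n := pow_le_pow_of_le_one hz0.le hz1 n.le_succ
    rw [add_sub_cancel] at h₁
    have h₃ : -(1 / 2) ≤ N * (‖z‖ - 1) := by
      have : N * -(1 / (2 * N)) ≤ N * (‖z‖ - 1) :=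
        mul_le_mul_of_nonneg_left (by linarith) (by linarith)
      have h₄ : N * -(1 / (2 * N)) = -(1 / 2) := by field_simp
      linarith
    push_cast at h₁
    linarith
  have hderiv : deriv (polyMap (P + (C (a : ℂ) * X ^ (n + 1)) • Q)) z =
      polyMap (derivative P.1, derivative P.2) z + ((a * ((n + 1) * z ^ n)) • polyMap Q z +
        (a * z ^ (n + 1)) • polyMap (derivative Q.1, derivative Q.2) z) := by
    rw [(hasDerivAt_polyMap _ z).deriv, ← polyMap_derivative_mul_X_pow, ← polyMap_add]
    simp only [Prod.fst_add, Prod.snd_add, derivative_add, Prod.mk_add_mk]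
  have hmain : a * (N * (1 / 2)) * (δ / 2) ≤ ‖((a : ℂ) * ((n + 1) * z ^ n)) • polyMap Q z‖ := by
    have : ‖(n : ℂ) + 1‖ = N := by
      simp only [N]
      exact_mod_cast Complex.norm_natCast (n + 1)
    rw [norm_smul, norm_mul, norm_mul, this, Complex.norm_real, norm_pow, Real.norm_of_nonneg ha.le]
    gcongr
  have hrest : ‖((a : ℂ) * z ^ (n + 1)) • polyMap (derivative Q.1, derivative Q.2) z‖ ≤ a * L := by
    rw [norm_smul, norm_mul, Complex.norm_real, norm_pow, Real.norm_of_nonneg ha.le]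
    have h₁ : ‖z‖ ^ (n + 1) ≤ 1 := pow_le_one₀ hz0.le hz1
    have h₂ := hQL z hz1
    calc a * ‖z‖ ^ (n + 1) * ‖polyMap (derivative Q.1, derivative Q.2) z‖ ≤ a * 1 * L := by gcongr
      _ = a * L := by ring
  have hP := hPB z hz1
  rw [hderiv]
  generalize polyMap (derivative P.1, derivative P.2) z = x at *
  generalize ((a : ℂ) * ((n + 1) * z ^ n)) • polyMap Q z = y at *
  generalize ((a : ℂ) * z ^ (n + 1)) • polyMap (derivative Q.1, derivative Q.2) z = v at *
  have htri : ‖y‖ ≤ ‖x + (y + v)‖ + ‖x‖ + ‖v‖ := by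
    calc ‖y‖ = ‖(x + (y + v)) - x - v‖ := by congr 1; abel
      _ ≤ _ := (norm_sub_le _ _).trans (by gcongr; exact norm_sub_le _ _)
  nlinarith

/-- A polynomial perturbation of constant norm on the unit circle, built by `k` Rudin–Shapiro
steps; each step lengthens crossing paths by a fixed amount. -/
lemma exists_oscillation (P : ℂ[X] × ℂ[X]) {s δ a : ℝ} (hs0 : 0 ≤ s) (hs : s < 1) (hδ : 0 < δ)
    (ha : 0 < a) (k : ℕ) : ∀ η > 0, ∃ (R : ℂ[X] × ℂ[X]) (s' η' : ℝ), s ≤ s' ∧ s' < 1 ∧ 0 < η' ∧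
      (∀ z : ℂ, ‖z‖ = 1 → ‖(polyMap R z).1‖ ^ 2 + ‖(polyMap R z).2‖ ^ 2 =
        δ ^ 2 * (1 + a ^ 2) ^ k) ∧
      LipClose η s (polyMap P) (polyMap (P + R)) ∧
      LongCrossing (polyMap (P + R)) s s' (k * (a * δ / 64)) η' := by
  induction k with
  | zero =>
    intro η hη
    refine ⟨(C (δ : ℂ), 0), s, 1, le_rfl, hs, one_pos, fun z _ => ?_, ?_, ?_⟩
    · simp [polyMap]
    · exact lipClose_polyMap_add fun z _ => by simpa [polyMap] using hη.le
    · intro G _ γ b c _ _ _ _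
      simp
  | succ k ih =>
    intro η hη
    obtain ⟨R, s', η', hss', hs', hη', hnorm, hlip, hlong⟩ := ih (η / 2) (half_pos hη)
    obtain ⟨Q, d, hQ⟩ := exists_conj_partner R
    have hQnorm : ∀ z : ℂ, ‖z‖ = 1 → 5 / 8 * δ ≤ ‖polyMap Q z‖ := by
      intro z hz
      have h₁ : ‖(polyMap Q z).1‖ ^ 2 + ‖(polyMap Q z).2‖ ^ 2 = δ ^ 2 * (1 + a ^ 2) ^ k := by
        rw [← hnorm z hz, hQ z hz]
        simp [polyMap, hz]
        ring
      have h₂ : δ ^ 2 ≤ δ ^ 2 * (1 + a ^ 2) ^ k :=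
        le_mul_of_one_le_right (by positivity) (one_le_pow₀ (by nlinarith))
      have h₃ := norm_fst_le (polyMap Q z)
      have h₄ := norm_snd_le (polyMap Q z)
      have h₅ := pow_le_pow_left₀ (norm_nonneg _) h₃ 2
      have h₆ := pow_le_pow_left₀ (norm_nonneg _) h₄ 2
      by_contra! h₇
      have h₉ := pow_lt_pow_left₀ h₇ (norm_nonneg _) two_ne_zero
      nlinarith
    have hs0' : 0 ≤ s' := hs0.trans hss'
    have hη₁ : 0 < min (η / 2) (η' / 2) := lt_min (half_pos hη) (half_pos hη')
    have hlarge : Tendsto (fun n : ℕ => ((n : ℝ) + 1)) atTop atTop :=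
      tendsto_atTop_add_const_right _ _ tendsto_natCast_atTop_atTop
    obtain ⟨n, ⟨hn₁, hn₂⟩, hn₃⟩ :=
      (((eventually_norm_derivative_mul_X_pow_le Q ha.le hs0' hs' hη₁).and
        (eventually_lt_norm_deriv (P + R) Q ha hδ hQnorm)).and
        (hlarge.eventually_gt_atTop (1 / (2 * (1 - s'))))).exists
    set S : ℂ[X] × ℂ[X] := (C (a : ℂ) * X ^ (n + 1)) • Q
    set N : ℝ := (n : ℝ) + 1
    have hN : 1 ≤ N := by simp [N]
    have hr : s' ≤ 1 - 1 / (2 * N) := by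
      rw [div_lt_iff₀ (by linarith)] at hn₃
      have : 1 / (2 * N) ≤ 1 - s' := by
        rw [div_le_iff₀ (by positivity)]
        linarith
      linarith
    have hwidth : (1 - 1 / (4 * N)) - (1 - 1 / (2 * N)) = 1 / (4 * N) := by field_simp; ring
    have hNinv : 0 < 1 / (4 * N) := by positivity
    have hlipS : LipClose (min (η / 2) (η' / 2)) s' (polyMap (P + R)) (polyMap (P + R + S)) :=
      lipClose_polyMap_add hn₁
    obtain ⟨ε, hε, hexp⟩ := exists_locallyExpands (r := 1 - 1 / (2 * N)) (s := 1 - 1 / (4 * N))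
      (contDiff_polyMap (P + R + S)) fun z hz hz' => hn₂ z hz (by linarith)
    have hlongS := hexp.longCrossing (by positivity) hε (by linarith)
    have hm : 0 < a * δ * N / 8 / 2 := by positivity
    refine ⟨R + S, 1 - 1 / (4 * N), min (η' / 2) (a * δ * N / 8 / 2), by linarith, by linarith,
      lt_min (half_pos hη') hm, fun z hz => ?_, ?_, ?_⟩
    · rw [polyMap_add, polyMap_smul, hQ z hz]
      have := sq_norm_add_sq_norm_partner (f := R.1.eval z) (g := R.2.eval z)
        (u := z ^ (n + 1) * z ^ d) (a := a) (by simp [hz])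
      have h₁ := hnorm z hz
      simp only [polyMap] at h₁ ⊢
      rw [h₁] at this
      rw [pow_succ (1 + a ^ 2), ← mul_assoc, ← this]
      simp only [eval_mul, eval_C, eval_pow, eval_X, Prod.smul_mk, smul_eq_mul, Prod.mk_add_mk]
      congr 4 <;> ring
    · rw [← add_assoc]
      exact (hlip.trans (hlipS.mono (min_le_left _ _) hss')).mono (by linarith) le_rfl
    · rw [← add_assoc]
      have h₁ := (hlong.of_lipClose (hlipS.mono (min_le_right _ _) le_rfl)).mono
        (by linarith [min_le_left (η' / 2) (a * δ * N / 8 / 2)] :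
          min (η' / 2) (a * δ * N / 8 / 2) ≤ η' - η' / 2) le_rfl
      have h₂ := hlongS.mono (min_le_right (η' / 2) _) le_rfl
      refine (h₁.append h₂ hss' hr (by linarith) (by positivity) ?_).mono le_rfl (le_of_eq ?_)
      · rw [hwidth]; positivity
      · rw [hwidth]; push_cast; field_simp; ring

end Oscillation

section Limit

open Polynomial Filter

/-- Arbitrarily small polynomial perturbations can make crossing paths longer than `1`. -/
lemma exists_small_perturbation_longCrossing (P : ℂ[X] × ℂ[X]) {s η : ℝ} (hs0 : 0 ≤ s)
    (hs : s < 1) (hη : 0 < η) : ∃ (R : ℂ[X] × ℂ[X]) (s' η' : ℝ), s ≤ s' ∧ s' < 1 ∧ 0 < η' ∧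
      (∀ z : ℂ, ‖z‖ ≤ 1 → ‖polyMap R z‖ ≤ η) ∧ LipClose η s (polyMap P) (polyMap (P + R)) ∧
      LongCrossing (polyMap (P + R)) s s' 1 η' := by
  obtain ⟨K, hK⟩ := exists_nat_gt (max 1 ((128 / η) ^ 2))
  have hK1 : (1 : ℝ) < K := (le_max_left _ _).trans_lt hK
  have hKη : (128 / η) ^ 2 < K := (le_max_right _ _).trans_lt hK
  have hK0 : (0 : ℝ) < K := by linarith
  have hsq : √(K : ℝ) ^ 2 = K := Real.sq_sqrt hK0.le
  have hsq0 : 0 < √(K : ℝ) := Real.sqrt_pos.2 hK0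
  obtain ⟨R, s', η', hss', hs', hη', hnorm, hlip, hlong⟩ :=
    exists_oscillation P hs0 hs (half_pos hη) (inv_pos.2 hsq0) K η hη
  refine ⟨R, s', η', hss', hs', hη', fun z hz => norm_polyMap_le_of_sphere (fun w hw => ?_) hz,
    hlip, hlong.mono le_rfl ?_⟩
  · have h₁ := hnorm w hw
    have h₂ : (1 + (√(K : ℝ))⁻¹ ^ 2) ^ K ≤ 4 := by
      have h₃ : 1 + (√(K : ℝ))⁻¹ ^ 2 ≤ Real.exp (1 / K) := by
        rw [inv_pow, hsq, add_comm, ← one_div]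
        exact Real.add_one_le_exp _
      calc (1 + (√(K : ℝ))⁻¹ ^ 2) ^ K ≤ Real.exp (1 / K) ^ K := by gcongr
        _ = Real.exp 1 := by rw [← Real.exp_nat_mul, mul_one_div_cancel hK0.ne']
        _ ≤ 4 := by linarith [Real.exp_one_lt_d9]
    have h₃ : (η / 2) ^ 2 * (1 + (√(K : ℝ))⁻¹ ^ 2) ^ K ≤ (η / 2) ^ 2 * 4 := by gcongr
    have h₄ : ‖(polyMap R w).1‖ ^ 2 ≤ η ^ 2 := by nlinarith [sq_nonneg ‖(polyMap R w).2‖]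
    have h₅ : ‖(polyMap R w).2‖ ^ 2 ≤ η ^ 2 := by nlinarith [sq_nonneg ‖(polyMap R w).1‖]
    exact norm_prod_le_iff.2 ⟨le_of_sq_le_sq h₄ hη.le, le_of_sq_le_sq h₅ hη.le⟩
  · have h₁ : 128 / η ≤ √(K : ℝ) := Real.le_sqrt_of_sq_le hKη.le
    rw [div_le_iff₀ hη] at h₁
    have h₂ : (K : ℝ) * ((√(K : ℝ))⁻¹ * (η / 2) / 64) = √(K : ℝ) * η / 128 := by
      nth_rewrite 1 [← hsq]
      field_simp
      ring
    rw [h₂]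
    linarith

/-- Properties, stable under small perturbations, of one map in the approximating sequence. -/
structure IsGoodStage (F : ℂ → ℂ × ℂ) (s s' τ : ℝ) : Prop where
  longCrossing : LongCrossing F s s' 1 τ
  deriv_ne_zero : ∀ G : ℂ → ℂ × ℂ, LipClose τ s' F G → ∀ z : ℂ, ‖z‖ < s' →
    DifferentiableAt ℂ G z → deriv G z ≠ 0
  injective : ∀ G : ℂ → ℂ × ℂ, (∀ z : ℂ, ‖z‖ ≤ 1 → ‖G z - F z‖ ≤ τ) →
    ∀ z w : ℂ, ‖z‖ = 1 → ‖w‖ = 1 → 1 - s' ≤ ‖z - w‖ → G z ≠ G w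

lemma exists_good_stage (P : ℂ[X] × ℂ[X]) {s τ : ℝ} (hs0 : 0 ≤ s) (hs : s < 1) (hτ : 0 < τ) :
    ∃ (P' : ℂ[X] × ℂ[X]) (s' τ' : ℝ), (1 + s) / 2 ≤ s' ∧ s' < 1 ∧ 0 < τ' ∧ τ' ≤ τ / 2 ∧
      (∀ z : ℂ, ‖z‖ ≤ 1 → ‖polyMap P' z - polyMap P z‖ ≤ τ / 2) ∧
      LipClose (τ / 2) s (polyMap P) (polyMap P') ∧ IsGoodStage (polyMap P') s s' τ' := by
  have hτ4 : 0 < τ / 4 := by positivity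
  obtain ⟨R, s', η, hss', hs', hη, hsmall, hlip, hlong⟩ :=
    exists_small_perturbation_longCrossing P (s := (1 + s) / 2) (by linarith) (by linarith) hτ4
  obtain ⟨c, hc, himm, hinj⟩ :=
    exists_generic_perturbation (P + R) (lt_min hτ4 (half_pos hη))
  set P' := P + R + (C c.1 * X, C c.2 * X)
  have hlin : ∀ z : ℂ, ‖polyMap (C c.1 * X, C c.2 * X) z‖ ≤ ‖c‖ * ‖z‖ := fun z => by
    have : polyMap (C c.1 * X, C c.2 * X) z = z • c := by
      simp only [polyMap, eval_mul, eval_C, eval_X, mul_comm _ z]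
      rfl
    rw [this, norm_smul, mul_comm]
  have hlip' : LipClose ‖c‖ s' (polyMap (P + R)) (polyMap P') :=
    lipClose_polyMap_add fun z _ => le_of_eq (by simp [polyMap])
  have hP' := contDiff_polyMap P' (n := 1)
  have hcont := continuous_polyMap P'
  obtain ⟨m, hm, hmin⟩ := (isCompact_closedBall (0 : ℂ) s').exists_forall_le'
    (hP'.continuous_deriv_one.norm.continuousOn) (a := 0) fun z _ => norm_pos_iff.2 (himm z)
  obtain ⟨δ, hδ, hexp⟩ := exists_locallyExpands hP' (r := 0) (s := s') (m := m / 2)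
    fun z _ hz => (half_lt_self hm).trans_le (hmin z (by simpa using hz))
  have hcomp : IsCompact ((sphere (0 : ℂ) 1 ×ˢ sphere (0 : ℂ) 1) ∩ {x | 1 - s' ≤ ‖x.1 - x.2‖}) :=
    ((isCompact_sphere _ _).prod (isCompact_sphere _ _)).inter_right
      (isClosed_le continuous_const (by fun_prop))
  obtain ⟨μ, hμ, hsep⟩ := hcomp.exists_forall_le' (f := fun x => ‖polyMap P' x.1 - polyMap P' x.2‖)
    (a := 0) (by fun_prop) fun x hx => norm_pos_iff.2 (sub_ne_zero.2 fun h => by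
      have h₁ := hinj hx.1.1 hx.1.2 h
      have h₂ : 1 - s' ≤ ‖x.1 - x.2‖ := hx.2
      rw [h₁, sub_self, norm_zero] at h₂
      linarith)
  have hc₁ := hc.trans_le (min_le_left _ _)
  have hc₂ := hc.trans_le (min_le_right _ _)
  set τ' := min (min (τ / 2) (η / 2)) (min (m / 4) (μ / 3))
  have hτ₁ : τ' ≤ τ / 2 := (min_le_left _ _).trans (min_le_left _ _)
  have hτ₂ : τ' ≤ η / 2 := (min_le_left _ _).trans (min_le_right _ _)
  have hτ₃ : τ' ≤ m / 4 := (min_le_right _ _).trans (min_le_left _ _)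
  have hτ₄ : τ' ≤ μ / 3 := (min_le_right _ _).trans (min_le_right _ _)
  refine ⟨P', s', τ', hss', hs', by positivity, hτ₁, fun z hz => ?_, ?_, ?_, ?_, ?_⟩
  · rw [polyMap_add, polyMap_add]
    have h₁ : ‖c‖ * ‖z‖ ≤ ‖c‖ := mul_le_of_le_one_right (norm_nonneg _) hz
    calc _ = ‖polyMap R z + polyMap (C c.1 * X, C c.2 * X) z‖ := by congr 1; abel
      _ ≤ _ := norm_add_le _ _
      _ ≤ τ / 2 := by linarith [hsmall z hz, hlin z]
  · exact ((hlip.mono le_rfl (by linarith)).trans (hlip'.mono le_rfl (by linarith))).mono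
      (by linarith) le_rfl
  · intro G hG γ a b hab hγ ha hb
    exact (hlong.of_lipClose hlip').mono (by linarith) le_rfl G hG γ a b hab hγ
      (by linarith) hb
  · intro G hG z hz hd
    exact (hexp.of_lipClose hG).deriv_ne_zero (by linarith) hδ le_rfl hz hd
  · intro G hG z w hz hw hzw heq
    have h₁ := hsep (z, w) ⟨⟨by simpa using hz, by simpa using hw⟩, hzw⟩
    have h₂ := hG z hz.le
    have h₃ := hG w hw.le
    have h₄ : ‖polyMap P' z - polyMap P' w‖ ≤ ‖G z - polyMap P' z‖ + ‖G w - polyMap P' w‖ := by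
      calc _ = ‖(G w - polyMap P' w) - (G z - polyMap P' z)‖ := by rw [heq]; congr 1; abel
        _ ≤ _ := norm_sub_le _ _
        _ = _ := add_comm _ _
    simp only at h₁
    linarith

lemma exists_stage_sequence : ∃ (P : ℕ → ℂ[X] × ℂ[X]) (s τ : ℕ → ℝ),
    (∀ j, 0 ≤ s j ∧ s j < 1 ∧ 0 < τ j) ∧ ∀ j, (1 + s j) / 2 ≤ s (j + 1) ∧ τ (j + 1) ≤ τ j / 2 ∧
      (∀ z : ℂ, ‖z‖ ≤ 1 → ‖polyMap (P (j + 1)) z - polyMap (P j) z‖ ≤ τ j / 2) ∧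
      LipClose (τ j / 2) (s j) (polyMap (P j)) (polyMap (P (j + 1))) ∧
      IsGoodStage (polyMap (P (j + 1))) (s j) (s (j + 1)) (τ (j + 1)) := by
  let S := {x : (ℂ[X] × ℂ[X]) × ℝ × ℝ // 0 ≤ x.2.1 ∧ x.2.1 < 1 ∧ 0 < x.2.2}
  have hstep : ∀ x : S, ∃ y : S, (1 + x.1.2.1) / 2 ≤ y.1.2.1 ∧ y.1.2.2 ≤ x.1.2.2 / 2 ∧
      (∀ z : ℂ, ‖z‖ ≤ 1 → ‖polyMap y.1.1 z - polyMap x.1.1 z‖ ≤ x.1.2.2 / 2) ∧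
      LipClose (x.1.2.2 / 2) x.1.2.1 (polyMap x.1.1) (polyMap y.1.1) ∧
      IsGoodStage (polyMap y.1.1) x.1.2.1 y.1.2.1 y.1.2.2 := by
    rintro ⟨⟨P, s, τ⟩, hs0, hs, hτ⟩
    obtain ⟨P', s', τ', h₁, h₂, h₃, h₄, h₅, h₆, h₇⟩ := exists_good_stage P hs0 hs hτ
    have : 0 ≤ s' := by simp only at hs0; linarith
    exact ⟨⟨(P', s', τ'), this, h₂, h₃⟩, h₁, h₄, h₅, h₆, h₇⟩
  choose next hnext using hstep
  let x : ℕ → S := fun j => next^[j] ⟨(0, 0, 1), le_rfl, one_pos, one_pos⟩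
  refine ⟨fun j => (x j).1.1, fun j => (x j).1.2.1, fun j => (x j).1.2.2, fun j => (x j).2,
    fun j => ?_⟩
  have : x (j + 1) = next (x j) := Function.iterate_succ_apply' _ _ _
  simp only [this]
  exact hnext (x j)

/-- A divergent path has infinite length under a map with a long crossing of each of a sequence of
annuli exhausting the disc. -/
lemma eVariationOn_eq_top_of_crossings {E : Type*} [NormedAddCommGroup E] {G : ℂ → E} {s : ℕ → ℝ}
    (hs1 : ∀ j, s j < 1) (hmono : Monotone s) (hlim : Tendsto s atTop (nhds 1))
    (hcross : ∀ j (γ : ℝ → ℂ) (a b : ℝ), a ≤ b → ContinuousOn γ (Icc a b) → ‖γ a‖ ≤ s j →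
      s (j + 1) ≤ ‖γ b‖ → 1 ≤ eVariationOn (fun t => G (γ t)) (Icc a b))
    {γ : ℝ → ℂ} (hγ : DivergentPathIn (ball (0 : ℂ) 1) γ) :
    eVariationOn (fun t => G (γ t)) (Ico 0 1) = ⊤ := by
  obtain ⟨hcont, hmem, hdiv⟩ := hγ
  have hγ0 : ‖γ 0‖ < 1 := by simpa using hmem 0 (by simp)
  obtain ⟨J, hJ⟩ := (hlim.eventually_const_lt hγ0).exists
  have key : ∀ k : ℕ, ∃ b ∈ Ico (0 : ℝ) 1, ‖γ b‖ ≤ s (J + k) ∧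
      (k : ℝ≥0∞) ≤ eVariationOn (fun t => G (γ t)) (Icc 0 b) := by
    intro k
    induction k with
    | zero => exact ⟨0, by simp, hJ.le, by simp⟩
    | succ k ih =>
      obtain ⟨b, hb, hbs, hvar⟩ := ih
      obtain ⟨t₀, ht₀, hout⟩ := hdiv (closedBall 0 (s (J + k + 1)))
        (closedBall_subset_ball (hs1 _)) (isCompact_closedBall _ _)
      have ht : max b t₀ ∈ Ico t₀ 1 := ⟨le_max_right _ _, max_lt hb.2 ht₀.2⟩
      have hlt : s (J + k + 1) < ‖γ (max b t₀)‖ := by simpa using hout _ ht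
      have hsub : Icc b (max b t₀) ⊆ Ico 0 1 := fun u hu => ⟨hb.1.trans hu.1, hu.2.trans_lt ht.2⟩
      obtain ⟨c, hc, hcs⟩ := intermediate_value_Icc (le_max_left b t₀)
        (hcont.mono hsub).norm ⟨hbs.trans (hmono (Nat.le_succ _)), hlt.le⟩
      refine ⟨c, hsub hc, hcs.le, ?_⟩
      have h₁ := hcross (J + k) γ b c hc.1
        (hcont.mono ((Icc_subset_Icc le_rfl hc.2).trans hsub)) hbs hcs.ge
      have h₂ := eVariationOn.Icc_add_Icc (fun t => G (γ t)) (s := univ) hb.1 hc.1 (mem_univ b)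
      simp only [univ_inter] at h₂
      rw [← h₂, Nat.cast_succ]
      exact add_le_add hvar h₁
  refine ENNReal.eq_top_of_forall_nnreal_le fun r => ?_
  obtain ⟨k, hk⟩ := exists_nat_ge r
  obtain ⟨b, hb, -, hvar⟩ := key k
  calc (r : ℝ≥0∞) ≤ k := by exact_mod_cast hk
    _ ≤ _ := hvar
    _ ≤ _ := eVariationOn.mono _ (Icc_subset_Ico_right hb.2)

/-- The two-dimensional case, with values in `ℂ × ℂ`. -/
lemma exists_complete_disc_prod : ∃ φ : ℂ → ℂ × ℂ,
    ContinuousOn φ (closedBall 0 1) ∧ DifferentiableOn ℂ φ (ball 0 1) ∧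
      (∀ ζ ∈ ball (0 : ℂ) 1, deriv φ ζ ≠ 0) ∧
      (∀ γ : ℝ → ℂ, DivergentPathIn (ball (0 : ℂ) 1) γ →
        eVariationOn (fun t => φ (γ t)) (Ico 0 1) = ⊤) ∧
      InjOn φ (sphere 0 1) := by
  obtain ⟨P, s, τ, hpos, hstep⟩ := exists_stage_sequence
  choose hs0 hs1 hτ0 using hpos
  choose hs hτ hdist hlip hgood using hstep
  have hmono : Monotone s := monotone_nat_of_le_succ fun j => by linarith [hs j, hs1 j]
  have hgeom : Tendsto (fun j : ℕ => (1 / 2 : ℝ) ^ j) atTop (nhds 0) :=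
    tendsto_pow_atTop_nhds_zero_of_lt_one (by norm_num) (by norm_num)
  have hτlim : Tendsto τ atTop (nhds 0) := by
    have hle : ∀ j, τ j ≤ τ 0 * (1 / 2) ^ j := fun j => by
      induction j with
      | zero => simp
      | succ j ih => rw [pow_succ]; linarith [hτ j]
    have h := hgeom.const_mul (τ 0)
    rw [mul_zero] at h
    exact squeeze_zero (fun j => (hτ0 j).le) hle h
  have hslim : Tendsto s atTop (nhds 1) := by
    have hle : ∀ j, 1 - (1 / 2) ^ j ≤ s j := fun j => by
      induction j with
      | zero => simpa using hs0 0
      | succ j ih => rw [pow_succ]; linarith [hs j]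
    have h := hgeom.const_sub 1
    rw [sub_zero] at h
    exact tendsto_of_tendsto_of_tendsto_of_le_of_le h tendsto_const_nhds hle fun j => (hs1 j).le
  have hdist' : ∀ j i, j ≤ i → ∀ z : ℂ, ‖z‖ ≤ 1 →
      ‖polyMap (P i) z - polyMap (P j) z‖ ≤ τ j - τ i := by
    intro j i hji z hz
    induction i, hji using Nat.le_induction with
    | base => simp
    | succ i _ ih =>
      have := norm_sub_le_norm_sub_add_norm_sub (polyMap (P (i + 1)) z) (polyMap (P i) z)
        (polyMap (P j) z)
      linarith [hdist i z hz, hτ i]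
  have hlip' : ∀ j i, j ≤ i → LipClose (τ j - τ i) (s j) (polyMap (P j)) (polyMap (P i)) := by
    intro j i hji
    induction i, hji using Nat.le_induction with
    | base => intro z w _ _; simp
    | succ i hji ih =>
      exact (ih.trans ((hlip i).mono le_rfl (hmono hji))).mono (by linarith [hτ i]) le_rfl
  have hlimit : ∀ z : ℂ, ∃ y, ‖z‖ ≤ 1 → Tendsto (fun i => polyMap (P i) z) atTop (nhds y) := by
    intro z
    by_cases hz : ‖z‖ ≤ 1
    · have hC : CauchySeq fun i => polyMap (P i) z :=
        cauchySeq_of_le_tendsto_0' τ (fun j i hji => by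
          rw [dist_comm, dist_eq_norm]
          linarith [hdist' j i hji z hz, hτ0 i]) hτlim
      obtain ⟨y, hy⟩ := cauchySeq_tendsto_of_complete hC
      exact ⟨y, fun _ => hy⟩
    · exact ⟨0, fun h => absurd h hz⟩
  choose φ hφ using hlimit
  have hφdist : ∀ j, ∀ z : ℂ, ‖z‖ ≤ 1 → ‖φ z - polyMap (P j) z‖ ≤ τ j := fun j z hz =>
    le_of_tendsto ((hφ z hz).sub_const _).norm (by
      filter_upwards [eventually_ge_atTop j] with i hi
      linarith [hdist' j i hi z hz, hτ0 i])
  have hφlip : ∀ j, LipClose (τ j) (s j) (polyMap (P j)) φ := fun j z w hz hw => by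
    have h₁ := ((hφ z (hz.trans (hs1 j).le)).sub_const (polyMap (P j) z)).sub
      ((hφ w (hw.trans (hs1 j).le)).sub_const (polyMap (P j) w))
    refine le_of_tendsto h₁.norm ?_
    filter_upwards [eventually_ge_atTop j] with i hi
    exact (hlip' j i hi).mono (by linarith [hτ0 i]) le_rfl z w hz hw
  have hunif : TendstoUniformlyOn (fun j => polyMap (P j)) φ atTop (closedBall 0 1) := by
    rw [Metric.tendstoUniformlyOn_iff]
    intro ε hε
    filter_upwards [hτlim.eventually_lt_const hε] with j hj z hz
    rw [dist_eq_norm]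
    exact (hφdist j z (by simpa using hz)).trans_lt hj
  have hdiff : DifferentiableOn ℂ φ (ball 0 1) :=
    (hunif.mono ball_subset_closedBall).tendstoLocallyUniformlyOn.differentiableOn
      (Eventually.of_forall fun j =>
        ((contDiff_polyMap (P j) (n := 1)).differentiable one_ne_zero).differentiableOn) isOpen_ball
  refine ⟨φ, hunif.continuousOn (Frequently.of_forall fun j => (continuous_polyMap _).continuousOn),
    hdiff, fun z hz => ?_, fun γ hγ => ?_, fun z hz w hw hzw => ?_⟩
  · obtain ⟨j, hj⟩ := ((tendsto_add_atTop_iff_nat 1).2 hslim |>.eventually_const_lt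
      (by simpa using hz : ‖z‖ < 1)).exists
    exact (hgood j).deriv_ne_zero φ (hφlip _) z hj (hdiff.differentiableAt (isOpen_ball.mem_nhds hz))
  · refine eVariationOn_eq_top_of_crossings hs1 hmono hslim (fun j γ a b hab hγ ha hb => ?_) hγ
    have := (hgood j).longCrossing φ (hφlip _) γ a b hab hγ ha hb
    rwa [ENNReal.ofReal_one] at this
  · by_contra hne
    have h₁ : 1 - ‖z - w‖ < 1 := sub_lt_self _ (norm_pos_iff.2 (sub_ne_zero.2 hne))
    obtain ⟨j, hj⟩ := ((tendsto_add_atTop_iff_nat 1).2 hslim |>.eventually_const_lt h₁).exists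
    exact (hgood j).injective φ (hφdist _) z w (by simpa using hz) (by simpa using hw)
      (by linarith) hzw

end Limit

/-- Embedding of `ℂ × ℂ` as the first two coordinates of `ℂⁿ`. -/
def prodToEuclidean (n : ℕ) : ℂ × ℂ →L[ℂ] EuclideanSpace ℂ (Fin n) :=
  (EuclideanSpace.equiv (Fin n) ℂ).symm.toContinuousLinearMap.comp
    (ContinuousLinearMap.pi fun i => if (i : ℕ) = 0 then ContinuousLinearMap.fst ℂ ℂ ℂ
      else if (i : ℕ) = 1 then ContinuousLinearMap.snd ℂ ℂ ℂ else 0)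

lemma norm_le_norm_prodToEuclidean {n : ℕ} (hn : 2 ≤ n) (x : ℂ × ℂ) :
    ‖x‖ ≤ ‖prodToEuclidean n x‖ := by
  have h₀ := PiLp.norm_apply_le (prodToEuclidean n x) ⟨0, by omega⟩
  have h₁ := PiLp.norm_apply_le (prodToEuclidean n x) ⟨1, by omega⟩
  exact norm_prod_le_iff.2 ⟨by simpa [prodToEuclidean] using h₀, by simpa [prodToEuclidean] using h₁⟩

lemma antilipschitzWith_prodToEuclidean {n : ℕ} (hn : 2 ≤ n) :
    AntilipschitzWith 1 (prodToEuclidean n) :=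
  ContinuousLinearMap.antilipschitz_of_bound _ fun x => by
    simpa using norm_le_norm_prodToEuclidean hn x

/-- Disc case of the theorem on complete bounded complex curves bounded by Jordan curves:
there is a continuous map on the closed disc, holomorphic, immersive and complete on the
open disc, and injective on the boundary circle. -/
theorem complete_disc_bounded_by_jordan_curve (n : ℕ) (hn : 2 ≤ n) :
    ∃ φ : ℂ → EuclideanSpace ℂ (Fin n),
      ContinuousOn φ (Metric.closedBall (0 : ℂ) 1) ∧
      DifferentiableOn ℂ φ (Metric.ball (0 : ℂ) 1) ∧
      (∀ ζ ∈ Metric.ball (0 : ℂ) 1, deriv φ ζ ≠ 0) ∧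
      (∀ γ : ℝ → ℂ, DivergentPathIn (Metric.ball (0 : ℂ) 1) γ →
        eVariationOn (fun t => φ (γ t)) (Set.Ico 0 1) = ⊤) ∧
      Set.InjOn φ (Metric.sphere (0 : ℂ) 1) := by
  obtain ⟨φ, hcont, hdiff, himm, hcomp, hinj⟩ := exists_complete_disc_prod
  have hanti := antilipschitzWith_prodToEuclidean hn
  refine ⟨prodToEuclidean n ∘ φ, (prodToEuclidean n).continuous.comp_continuousOn hcont,
    (prodToEuclidean n).differentiable.comp_differentiableOn hdiff, fun ζ hζ => ?_, fun γ hγ => ?_,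
    hanti.injective.comp_injOn hinj⟩
  · have hd := (hdiff.differentiableAt (isOpen_ball.mem_nhds hζ)).hasDerivAt
    rw [((prodToEuclidean n).hasFDerivAt.comp_hasDerivAt ζ hd).deriv]
    exact (map_ne_zero_iff _ hanti.injective).2 (himm ζ hζ)
  · rw [eq_top_iff, ← hcomp γ hγ]
    refine iSup_mono fun p => Finset.sum_le_sum fun i _ => ?_
    simpa using hanti (φ (γ (p.2.1 (i + 1)))) (φ (γ (p.2.1 i)))
end
end
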